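/- For every j ∈ ℕ there is a constant L_j ≥ 1 such that the following holds. Let k ≥ 2 be a natural number and let δ ∈ (0,1/2). Let M₁,…,M_k be integers such that the intervals [Mᵢ, (1 + 1/(4k))·Mᵢ) are pairwise disjoint. Set Q := k^k · ∏_{i=1}^k log Mᵢ, and suppose that min_i Mᵢ > Q^{L_j}. For each i, let ηᵢ be a parameter with 1/(8k) ≤ ηᵢ ≤ 1/(4k), let 𝒫ᵢ be the set of primes p with Mᵢ ≤ p < Mᵢ(1+ηᵢ), and set S := {p₁^j ⋯ p_k^j : pᵢ ∈ 𝒫ᵢ}. Then S is (L_j, k, (M₁⋯M_k)^j)-diophantine. -/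

import Mathlib

noncomputable section

open Finset
open scoped Classical

/-- `e(x) = exp(2πix)`. -/
def eC (x : ℝ) : ℂ := Complex.exp (2 * Real.pi * Complex.I * x)

/-- Distance to the nearest integer. -/
def dZ (x : ℝ) : ℝ := |x - (round x : ℝ)|

/-- Uniform average of a complex-valued function over a finite set. -/
def avgC {α : Type*} (s : Finset α) (f : α → ℂ) : ℂ := (∑ x ∈ s, f x) / s.card

/-- A set `S` of integers is `(L, L', D)`-diophantine. -/
def IsDiophantine (L L' D : ℝ) (S : Finset ℤ) : Prop :=
  ∀ δ θ : ℝ, 0 < δ → δ < 1 / 2 →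
    δ ≤ ‖avgC S (fun s => eC (θ * (s : ℝ)))‖ →
    ∃ q : ℕ, 0 < q ∧ (q : ℝ) ≤ (L' / δ) ^ L ∧ dZ ((q : ℝ) * θ) ≤ (L' / δ) ^ L / D

/-- The set of primes `p` with `M ≤ p < M * (1 + η)`. -/
def primesNear (M : ℕ) (η : ℝ) : Finset ℕ :=
  (Finset.Icc M (2 * M)).filter (fun p => Nat.Prime p ∧ (p : ℝ) < (M : ℝ) * (1 + η))

/-! ### Distance to the nearest integer and additive characters -/

lemma dZ_nonneg (x : ℝ) : 0 ≤ dZ x := abs_nonneg _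

lemma dZ_le_abs_sub_int (x : ℝ) (n : ℤ) : dZ x ≤ |x - n| := round_le x n

lemma dZ_le_half (x : ℝ) : dZ x ≤ 1 / 2 := abs_sub_round x

lemma dZ_le_one (x : ℝ) : dZ x ≤ 1 := (dZ_le_half x).trans (by norm_num)

lemma exists_int_dZ (x : ℝ) : ∃ n : ℤ, dZ x = |x - n| := ⟨round x, rfl⟩

lemma dZ_add_le (x y : ℝ) : dZ (x + y) ≤ dZ x + dZ y := by
  refine (dZ_le_abs_sub_int (x + y) (round x + round y)).trans ?_
  push_cast
  rw [show x + y - ((round x : ℝ) + round y) = (x - round x) + (y - round y) by ring]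
  exact abs_add_le _ _

lemma dZ_neg_le (x : ℝ) : dZ (-x) ≤ dZ x := by
  refine (dZ_le_abs_sub_int (-x) (-round x)).trans (le_of_eq ?_)
  push_cast
  rw [show -x - -(round x : ℝ) = -(x - round x) by ring, abs_neg]; rfl

lemma dZ_neg (x : ℝ) : dZ (-x) = dZ x :=
  le_antisymm (dZ_neg_le x) (by simpa using dZ_neg_le (-x))

lemma dZ_sub_le (x y : ℝ) : dZ (x - y) ≤ dZ x + dZ y := by
  rw [sub_eq_add_neg, ← dZ_neg y]; exact dZ_add_le _ _

lemma dZ_int_mul_le (n : ℤ) (x : ℝ) : dZ (n * x) ≤ |(n : ℝ)| * dZ x := by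
  refine (dZ_le_abs_sub_int (n * x) (n * round x)).trans (le_of_eq ?_)
  push_cast
  rw [← mul_sub, abs_mul]; rfl

lemma dZ_nat_mul_le (n : ℕ) (x : ℝ) : dZ (n * x) ≤ n * dZ x := by
  simpa using dZ_int_mul_le n x

lemma dZ_add_int (x : ℝ) (n : ℤ) : dZ (x + n) = dZ x := by
  simp [dZ, round_add_intCast]

lemma dZ_eq_abs_of_le {x : ℝ} (h : |x| < 1 / 2) : dZ x = |x| := by
  have h' := abs_lt.1 h
  have : round x = 0 := by
    rw [round_eq, Int.floor_eq_zero_iff]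
    constructor <;> linarith [h'.1, h'.2]
  simp [dZ, this]

lemma eC_add (x y : ℝ) : eC (x + y) = eC x * eC y := by
  simp only [eC, ← Complex.exp_add]; congr 1; push_cast; ring

lemma norm_eC (x : ℝ) : ‖eC x‖ = 1 := by
  rw [eC, show 2 * Real.pi * Complex.I * x = ((2 * Real.pi * x : ℝ) : ℂ) * Complex.I by
    push_cast; ring, Complex.norm_exp_ofReal_mul_I]

lemma eC_int (n : ℤ) : eC n = 1 := by
  rw [eC, Complex.exp_eq_one_iff]; exact ⟨n, by push_cast; ring⟩

lemma eC_zero : eC 0 = 1 := by simpa using eC_int 0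

lemma eC_add_int (x : ℝ) (n : ℤ) : eC (x + n) = eC x := by rw [eC_add, eC_int, mul_one]

lemma conj_eC (x : ℝ) : (starRingEnd ℂ) (eC x) = eC (-x) := by
  rw [eC, eC, ← Complex.exp_conj]; congr 1; simp [Complex.conj_ofNat]

lemma eC_sub (x y : ℝ) : eC (x - y) = eC x * (starRingEnd ℂ) (eC y) := by
  rw [conj_eC, ← eC_add, sub_eq_add_neg]

lemma norm_eC_sub_one (x : ℝ) : ‖eC x - 1‖ = 2 * |Real.sin (Real.pi * x)| := by
  have h := Complex.norm_exp_I_mul_ofReal_sub_one (2 * Real.pi * x)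
  rw [eC, show 2 * Real.pi * Complex.I * x = Complex.I * ((2 * Real.pi * x : ℝ) : ℂ) by
    push_cast; ring, h]
  rw [Real.norm_eq_abs, abs_mul, abs_of_pos (by norm_num : (0:ℝ) < 2)]
  congr 3; ring

lemma norm_eC_sub_one_le (x : ℝ) : ‖eC x - 1‖ ≤ 7 * |x| := by
  rw [norm_eC_sub_one]
  have h := Real.abs_sin_le_abs (x := Real.pi * x)
  rw [abs_mul, abs_of_pos Real.pi_pos] at h
  nlinarith [Real.pi_lt_d2, abs_nonneg x]

lemma four_mul_dZ_le (x : ℝ) : 4 * dZ x ≤ ‖eC x - 1‖ := by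
  obtain ⟨n, hn⟩ : ∃ n : ℤ, n = round x := ⟨_, rfl⟩
  have e : eC x = eC (x - n) := by
    have := eC_add_int (x - n) n; simpa using this
  have hd : dZ x = |x - n| := by rw [hn]; rfl
  have hh := dZ_le_half x
  rw [e, norm_eC_sub_one, hd]
  rw [hd] at hh
  have := Real.mul_abs_le_abs_sin (x := Real.pi * (x - n)) (by
    rw [abs_mul, abs_of_pos Real.pi_pos]; nlinarith [Real.pi_pos])
  rw [abs_mul, abs_of_pos Real.pi_pos] at this
  have h2 : 2 / Real.pi * (Real.pi * |x - n|) = 2 * |x - n| := by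
    field_simp
  linarith

/-- The geometric sum bound. -/
lemma norm_sum_eC_linear_mul_dZ (γ β : ℝ) (a b : ℤ) :
    ‖∑ n ∈ Finset.Ico a b, eC (γ * n + β)‖ * dZ γ ≤ 1 := by
  rcases le_total b a with h | h
  · simp [Finset.Ico_eq_empty_of_le h]
  have key : ∀ b : ℤ, a ≤ b →
      (∑ n ∈ Finset.Ico a b, eC (γ * n + β)) * (eC γ - 1) = eC (γ * b + β) - eC (γ * a + β) := by
    intro b hb
    induction b, hb using Int.leInduction with
    | base => simp
    | succ m hm ih =>
      have : Finset.Ico a (m + 1) = insert m (Finset.Ico a m) := by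
        ext x; simp only [Finset.mem_Ico, Finset.mem_insert]; omega
      rw [this, Finset.sum_insert (by simp), add_mul, ih, mul_sub, ← eC_add]
      push_cast
      rw [show γ * m + β + γ = γ * (m + 1) + β by ring]
      ring
  have h1 := congrArg norm (key b h)
  rw [norm_mul] at h1
  have h2 : ‖eC (γ * b + β) - eC (γ * a + β)‖ ≤ 2 := by
    refine (norm_sub_le _ _).trans ?_
    rw [norm_eC, norm_eC]; norm_num
  have h3 := four_mul_dZ_le γ
  have h4 := norm_nonneg (∑ n ∈ Finset.Ico a b, eC (γ * n + β))
  nlinarith [mul_le_mul_of_nonneg_left h3 h4]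

lemma pow_le_pow_of_two_le {T : ℝ} (hT : 2 ≤ T) {m n : ℕ} (h : m ≤ n) : T ^ m ≤ T ^ n :=
  pow_le_pow_right₀ (by linarith) h

lemma two_mul_pow_le {T : ℝ} (hT : 2 ≤ T) (n : ℕ) : 2 * T ^ n ≤ T ^ (n + 1) := by
  rw [pow_succ]; nlinarith [pow_pos (by linarith : 0 < T) n]

lemma one_le_pow_of_two_le {T : ℝ} (hT : 2 ≤ T) (n : ℕ) : 1 ≤ T ^ n :=
  one_le_pow₀ (by linarith)

lemma natCast_le_pow {T : ℝ} (hT : 2 ≤ T) (n : ℕ) : (n : ℝ) ≤ T ^ n := by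
  have h : (n : ℝ) ≤ 2 ^ n := by exact_mod_cast Nat.lt_two_pow_self.le
  exact h.trans (pow_le_pow_left₀ (by norm_num) hT n)

set_option maxHeartbeats 1000000 in
/-- If `α` is already known to be close to a rational with denominator `q`, and `α y ^ j + β` is
within `κ` of an integer for many `y`, then `q α` is much closer to an integer. -/
lemma dZ_mul_le_of_many_close (j : ℕ) (hj : 1 ≤ j) (A : ℕ) :
    ∃ C : ℕ, ∀ T : ℝ, 2 ≤ T → ∀ N : ℝ, T ^ C ≤ N →
      ∀ (α β κ : ℝ) (q : ℕ) (Y : Finset ℕ), 0 < q → (q : ℝ) ≤ T ^ A →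
        dZ (q * α) ≤ T ^ A / N ^ j → (∀ y ∈ Y, (y : ℝ) ≤ N) → N / T ≤ (#Y : ℝ) →
        (∀ y ∈ Y, dZ (α * (y : ℝ) ^ j + β) ≤ κ) → dZ (q * α) ≤ κ * T ^ C / N ^ j := by
  obtain ⟨B, hB⟩ : ∃ B, B = A + j + 2 := ⟨_, rfl⟩
  obtain ⟨E, hE⟩ : ∃ E, E = A + B + 3 := ⟨_, rfl⟩
  refine ⟨E * j + A + 1, fun T hT N hN α β κ q Y hq hqT hqα hYN hYc hYκ => ?_⟩
  have hT0 : 0 < T := by linarith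
  have hTE : T ^ E ≤ N := (pow_le_pow_of_two_le hT (by nlinarith)).trans hN
  have hN0 : 0 < N := lt_of_lt_of_le (pow_pos hT0 _) hN
  set w : ℝ := N / T ^ B with hw
  have hw0 : 0 < w := by positivity
  set f : ℕ → ℕ × ℕ := fun y => (y % q, ⌊(y : ℝ) / w⌋₊) with hf
  set t : Finset (ℕ × ℕ) := Finset.range q ×ˢ Finset.range (⌊T ^ B⌋₊ + 1) with ht
  have hmaps : ∀ y ∈ Y, f y ∈ t := by
    intro y hy
    simp only [hf, ht, Finset.mem_product, Finset.mem_range]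
    refine ⟨Nat.mod_lt _ hq, Nat.lt_succ_of_le (Nat.floor_le_floor ?_)⟩
    rw [hw, div_div_eq_mul_div, div_le_iff₀ hN0]
    nlinarith [hYN y hy, pow_pos hT0 B]
  have htne : t.Nonempty := ⟨(0, 0), by simp [ht, hq]⟩
  have htc : (#t : ℝ) ≤ T ^ (A + B + 1) := by
    simp only [ht, Finset.card_product, Finset.card_range]
    push_cast
    have h1 : (⌊T ^ B⌋₊ : ℝ) ≤ T ^ B := Nat.floor_le (by positivity)
    have h2 := one_le_pow_of_two_le hT B
    calc (q : ℝ) * (⌊T ^ B⌋₊ + 1) ≤ T ^ A * (2 * T ^ B) := by gcongr; linarith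
      _ ≤ T ^ A * T ^ (B + 1) := by gcongr; exact two_mul_pow_le hT B
      _ = _ := by rw [← pow_add]; rfl
  set b : ℝ := N / T ^ (A + B + 2) with hb
  have hb2 : 2 ≤ b := by
    rw [hb, le_div_iff₀ (by positivity)]
    exact (two_mul_pow_le hT _).trans (by rw [← hE] at *; exact hTE)
  have hbs : #t • b ≤ (#Y : ℝ) := by
    rw [nsmul_eq_mul]
    refine le_trans ?_ hYc
    calc (#t : ℝ) * b ≤ T ^ (A + B + 1) * b := by gcongr
      _ = N / T := by rw [hb, pow_succ T (A + B + 1)]; field_simp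
  obtain ⟨c, -, hc⟩ := Finset.exists_le_card_fiber_of_nsmul_le_card_of_maps_to hmaps htne hbs
  set F := {x ∈ Y | f x = c} with hF
  have hFne : F.Nonempty := by
    rw [← Finset.card_pos]
    have : (0 : ℝ) < #F := by linarith
    exact_mod_cast this
  obtain ⟨y₁, hy₁⟩ : ∃ y, y = F.min' hFne := ⟨_, rfl⟩
  obtain ⟨y₂, hy₂⟩ : ∃ y, y = F.max' hFne := ⟨_, rfl⟩
  have m₁ : y₁ ∈ F := hy₁ ▸ F.min'_mem hFne
  have m₂ : y₂ ∈ F := hy₂ ▸ F.max'_mem hFne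
  have h12 : y₁ ≤ y₂ := hy₂ ▸ F.le_max' _ m₁
  have hcard : #F ≤ y₂ + 1 - y₁ := by
    rw [← Nat.card_Icc]
    refine Finset.card_le_card fun x hx => ?_
    rw [Finset.mem_Icc]
    exact ⟨hy₁ ▸ F.min'_le _ hx, hy₂ ▸ F.le_max' _ hx⟩
  have hgap : N / T ^ E ≤ (y₂ : ℝ) - y₁ := by
    have h1 : (#F : ℝ) ≤ y₂ + 1 - y₁ := by
      have : #F + y₁ ≤ y₂ + 1 := by omega
      have : ((#F + y₁ : ℕ) : ℝ) ≤ ((y₂ + 1 : ℕ) : ℝ) := by exact_mod_cast this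
      push_cast at this; linarith
    have h2 : N / T ^ E ≤ b / 2 := by
      rw [hb, hE, div_div]
      refine div_le_div_of_nonneg_left hN0.le (by positivity) ?_
      rw [mul_comm]; exact two_mul_pow_le hT _
    linarith
  simp only [hF, Finset.mem_filter] at m₁ m₂
  have hff : f y₁ = f y₂ := m₁.2.trans m₂.2.symm
  simp only [hf, Prod.mk.injEq] at hff
  have hgap2 : (y₂ : ℝ) - y₁ ≤ w := by
    have h1 := Nat.floor_le (show 0 ≤ (y₁ : ℝ) / w by positivity)
    have h2 := Nat.lt_floor_add_one ((y₂ : ℝ) / w)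
    rw [← hff.2] at h2
    have : ((y₂ : ℝ) - y₁) / w < 1 := by rw [sub_div]; linarith
    rw [div_lt_one hw0] at this; exact this.le
  obtain ⟨a, ha⟩ := exists_int_dZ (q * α)
  set γ : ℝ := α - a / q with hγ
  have hq0 : (0 : ℝ) < q := by exact_mod_cast hq
  have hqγ : dZ (q * α) = q * |γ| := by
    rw [ha, hγ, ← abs_of_pos hq0, ← abs_mul, abs_of_pos hq0]; congr 1; field_simp
  have hγ1 : |γ| ≤ T ^ A / N ^ j := by
    refine le_trans ?_ hqα
    rw [hqγ]
    have : (1 : ℝ) ≤ q := by exact_mod_cast hq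
    nlinarith [abs_nonneg γ]
  have hdvd : (q : ℤ) ∣ (y₂ : ℤ) ^ j - (y₁ : ℤ) ^ j := by
    refine (?_ : (q : ℤ) ∣ (y₂ : ℤ) - y₁).trans (sub_dvd_pow_sub_pow _ _ _)
    have : y₁ ≡ y₂ [MOD q] := hff.1
    exact (Nat.modEq_iff_dvd.1 this)
  obtain ⟨m, hm⟩ := hdvd
  have hmR : (y₂ : ℝ) ^ j - (y₁ : ℝ) ^ j = q * m := by exact_mod_cast hm
  have hy12 : (y₁ : ℝ) ≤ y₂ := by exact_mod_cast h12
  have hΔ0 : 0 ≤ (y₂ : ℝ) ^ j - (y₁ : ℝ) ^ j := by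
    have := pow_le_pow_left₀ (Nat.cast_nonneg y₁) hy12 j; linarith
  have hΔup : (y₂ : ℝ) ^ j - (y₁ : ℝ) ^ j ≤ j * N ^ (j - 1) * w := by
    have h1 := Commute.mul_geom_sum₂ (Commute.all (y₂ : ℝ) (y₁ : ℝ)) j
    rw [← h1]
    have h2 : ∑ i ∈ Finset.range j, (y₂ : ℝ) ^ i * (y₁ : ℝ) ^ (j - 1 - i) ≤ j * N ^ (j - 1) := by
      calc _ ≤ ∑ i ∈ Finset.range j, N ^ (j - 1) := by
            refine Finset.sum_le_sum fun i hi => ?_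
            have hi' : i + (j - 1 - i) = j - 1 := by
              have := Finset.mem_range.1 hi; omega
            calc _ ≤ N ^ i * N ^ (j - 1 - i) := by
                  gcongr
                  · exact hYN _ m₂.1
                  · exact hYN _ m₁.1
              _ = _ := by rw [← pow_add, hi']
        _ = _ := by simp
    rw [mul_comm]
    have h3 : 0 ≤ (y₂ : ℝ) - y₁ := by linarith
    have : (0 : ℝ) ≤ j * N ^ (j - 1) := by positivity
    exact mul_le_mul h2 hgap2 h3 this
  have hΔlow : (N / T ^ E) ^ j ≤ (y₂ : ℝ) ^ j - (y₁ : ℝ) ^ j := by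
    refine (pow_le_pow_left₀ (by positivity) hgap j).trans ?_
    have h3 : 0 ≤ (y₂ : ℝ) - y₁ := by linarith
    have := pow_add_pow_le h3 (Nat.cast_nonneg y₁) (by omega : j ≠ 0)
    rw [sub_add_cancel] at this; linarith
  have hsmall : |γ * ((y₂ : ℝ) ^ j - (y₁ : ℝ) ^ j)| < 1 / 2 := by
    rw [abs_mul, abs_of_nonneg hΔ0]
    have h1 : |γ| * ((y₂ : ℝ) ^ j - (y₁ : ℝ) ^ j) ≤ T ^ A / N ^ j * (j * N ^ (j - 1) * w) := by
      gcongr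
    have h2 : T ^ A / N ^ j * (j * N ^ (j - 1) * w) = j / T ^ (j + 2) := by
      obtain ⟨i, rfl⟩ : ∃ i, j = i + 1 := ⟨j - 1, by omega⟩
      rw [hw, hB, show A + (i + 1) + 2 = A + ((i + 1) + 2) by ring, pow_add T A, pow_succ N i,
        Nat.add_sub_cancel]
      field_simp
    rw [h2] at h1
    refine lt_of_le_of_lt h1 ?_
    rw [div_lt_iff₀ (by positivity), pow_add]
    have h3 := natCast_le_pow hT j
    have : (4 : ℝ) ≤ T ^ 2 := by nlinarith
    have h5 := mul_le_mul_of_nonneg_left this (pow_pos hT0 j).le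
    linarith [pow_pos hT0 j]
  have hclose : |γ| * ((y₂ : ℝ) ^ j - (y₁ : ℝ) ^ j) ≤ 2 * κ := by
    have h1 : α * (y₂ : ℝ) ^ j + β - (α * (y₁ : ℝ) ^ j + β)
        = γ * ((y₂ : ℝ) ^ j - (y₁ : ℝ) ^ j) + ((a * m : ℤ) : ℝ) := by
      push_cast
      have : α = γ + a / q := by rw [hγ]; ring
      rw [show α * (y₂ : ℝ) ^ j + β - (α * (y₁ : ℝ) ^ j + β) =
        α * ((y₂ : ℝ) ^ j - (y₁ : ℝ) ^ j) by ring, this, add_mul]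
      congr 1
      rw [hmR]; field_simp
    have h2 := dZ_sub_le (α * (y₂ : ℝ) ^ j + β) (α * (y₁ : ℝ) ^ j + β)
    rw [h1, dZ_add_int, dZ_eq_abs_of_le hsmall, abs_mul, abs_of_nonneg hΔ0] at h2
    linarith [hYκ _ m₁.1, hYκ _ m₂.1]
  have hκ0 : 0 ≤ κ := (dZ_nonneg _).trans (hYκ _ m₁.1)
  have hγ2 : |γ| ≤ 2 * κ * (T ^ E) ^ j / N ^ j := by
    rw [le_div_iff₀ (by positivity)]
    have h1 : |γ| * (N / T ^ E) ^ j ≤ 2 * κ :=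
      (mul_le_mul_of_nonneg_left hΔlow (abs_nonneg _)).trans hclose
    rw [div_pow, mul_div_assoc', div_le_iff₀ (by positivity)] at h1
    exact h1
  rw [hqγ]
  calc (q : ℝ) * |γ| ≤ T ^ A * (2 * κ * (T ^ E) ^ j / N ^ j) := by gcongr
    _ = κ * (2 * T ^ (E * j + A)) / N ^ j := by rw [pow_add, pow_mul]; ring
    _ ≤ κ * T ^ (E * j + A + 1) / N ^ j := by
        gcongr; exact two_mul_pow_le hT _

/-- Vinogradov's lemma: if `h α` is close to an integer for many `h ≤ N`, then `α` is close to a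
rational with small denominator. -/
lemma exists_denom_of_many_close_linear (A : ℕ) :
    ∃ C : ℕ, ∀ T : ℝ, 2 ≤ T → ∀ N : ℝ, 1 ≤ N → ∀ (α κ : ℝ) (H : Finset ℕ),
      (∀ h ∈ H, 0 < h ∧ (h : ℝ) ≤ N) → N / T ≤ (#H : ℝ) → κ ≤ T ^ A / N →
      (∀ h ∈ H, dZ (α * h) ≤ κ) →
      ∃ q : ℕ, 0 < q ∧ (q : ℝ) ≤ T ^ C ∧ dZ (q * α) ≤ κ * T ^ C / N := by
  obtain ⟨C₁, hC₁⟩ := dZ_mul_le_of_many_close 1 le_rfl (A + 2)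
  refine ⟨C₁ + 4 + A, fun T hT N hN α κ H hH hHc hκ hHκ => ?_⟩
  have hT0 : 0 < T := by linarith
  have hHne : H.Nonempty := by
    rw [← Finset.card_pos]
    have : (0 : ℝ) < #H := lt_of_lt_of_le (by positivity) hHc
    exact_mod_cast this
  obtain ⟨h₀, hh₀⟩ := hHne
  have hκ0 : 0 ≤ κ := (dZ_nonneg _).trans (hHκ _ hh₀)
  rcases lt_or_ge N (T ^ (C₁ + 4)) with hlt | hge
  · refine ⟨h₀, (hH _ hh₀).1, ?_, ?_⟩
    · exact ((hH _ hh₀).2.trans hlt.le).trans (pow_le_pow_of_two_le hT (by omega))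
    · rw [mul_comm]
      refine (hHκ _ hh₀).trans ?_
      rw [le_div_iff₀ (by linarith)]
      exact mul_le_mul_of_nonneg_left
        (hlt.le.trans (pow_le_pow_of_two_le hT (by omega))) hκ0
  -- two elements at distance at most `2 T`
  obtain ⟨x, hx, y, hy, hxy, hd⟩ : ∃ x ∈ H, ∃ y ∈ H, x < y ∧ (y : ℝ) - x ≤ 2 * T := by
    set f : ℕ → ℕ := fun h => ⌊(h : ℝ) / (2 * T)⌋₊
    set t := Finset.range (⌊N / (2 * T)⌋₊ + 1)
    have hmaps : ∀ h ∈ H, f h ∈ t := fun h hh => by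
      simp only [f, t, Finset.mem_range]
      refine Nat.lt_succ_of_le (Nat.floor_le_floor ?_)
      have := (hH h hh).2
      gcongr
    have hct : #t < #H := by
      have h1 : (#t : ℝ) ≤ N / (2 * T) + 1 := by
        simp only [t, Finset.card_range]; push_cast
        have := Nat.floor_le (show 0 ≤ N / (2 * T) by positivity)
        linarith
      have h2 : N / (2 * T) + 1 < N / T := by
        have : N / T = N / (2 * T) + N / (2 * T) := by field_simp; ring
        rw [this]
        have h3 : 1 < N / (2 * T) := by
          rw [lt_div_iff₀ (by positivity)]
          have : T ^ 4 ≤ N := (pow_le_pow_of_two_le hT (by omega)).trans hge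
          nlinarith [pow_pos hT0 2, pow_pos hT0 3]
        linarith
      have : (#t : ℝ) < #H := by linarith
      exact_mod_cast this
    obtain ⟨x, hx, y, hy, hne, hfxy⟩ := Finset.exists_ne_map_eq_of_card_lt_of_maps_to hct hmaps
    have key : ∀ x y : ℕ, f x = f y → (y : ℝ) - x ≤ 2 * T := by
      intro x y hfxy
      have h1 := Nat.floor_le (show 0 ≤ (x : ℝ) / (2 * T) by positivity)
      have h2 := Nat.lt_floor_add_one ((y : ℝ) / (2 * T))
      have h4 : (⌊(x : ℝ) / (2 * T)⌋₊ : ℝ) = ⌊(y : ℝ) / (2 * T)⌋₊ := by exact_mod_cast hfxy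
      rw [← h4] at h2
      have : ((y : ℝ) - x) / (2 * T) < 1 := by rw [sub_div]; linarith
      rw [div_lt_one (by positivity)] at this; exact this.le
    rcases lt_or_gt_of_ne hne with h | h
    · exact ⟨x, hx, y, hy, h, key _ _ hfxy⟩
    · exact ⟨y, hy, x, hx, h, key _ _ hfxy.symm⟩
  have hcast : ((y - x : ℕ) : ℝ) = (y : ℝ) - x := by push_cast [hxy.le]; ring
  have hT2 : 2 * T ≤ T ^ 2 := by nlinarith
  have hqT : ((y - x : ℕ) : ℝ) ≤ T ^ (A + 2) := by
    rw [hcast]; exact (hd.trans hT2).trans (pow_le_pow_of_two_le hT (by omega))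
  have hN' : T ^ C₁ ≤ N := (pow_le_pow_of_two_le hT (by omega)).trans hge
  have := hC₁ T hT N hN' α 0 κ (y - x) H (by omega) hqT (by
    rw [hcast, sub_mul, pow_one]
    refine (dZ_sub_le _ _).trans ?_
    rw [mul_comm, mul_comm _ α]
    have h1 := hHκ _ hx
    have h2 := hHκ _ hy
    have h3 : T ^ (A + 1) / N ≤ T ^ (A + 2) / N := by
      gcongr <;> [linarith; omega]
    have h4 : T ^ A / N + T ^ A / N ≤ T ^ (A + 1) / N := by
      rw [← add_div]; gcongr; linarith [two_mul_pow_le hT A]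
    linarith) (fun y hy => (hH y hy).2) hHc (by simpa using hHκ)
  refine ⟨y - x, by omega, hqT.trans (pow_le_pow_of_two_le hT (by omega)), this.trans ?_⟩
  rw [pow_one]
  have := pow_le_pow_of_two_le hT (show C₁ ≤ C₁ + 4 + A by omega)
  gcongr

/-- Van der Corput differencing. -/
lemma norm_sum_sq_le_sum_norm_diff (u : ℤ → ℂ) (a b : ℤ) :
    ‖∑ n ∈ Finset.Ico a b, u n‖ ^ 2 ≤ ∑ h ∈ Finset.Ioo (a - b) (b - a),
      ‖∑ m ∈ Finset.Ico (max a (a - h)) (min b (b - h)), u (m + h) * (starRingEnd ℂ) (u m)‖ := by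
  have h1 : ((‖∑ n ∈ Finset.Ico a b, u n‖ ^ 2 : ℝ) : ℂ) = ∑ h ∈ Finset.Ioo (a - b) (b - a),
      ∑ m ∈ Finset.Ico (max a (a - h)) (min b (b - h)), u (m + h) * (starRingEnd ℂ) (u m) := by
    push_cast
    rw [← Complex.mul_conj', map_sum, Finset.sum_mul_sum, Finset.sum_comm]
    have h2 : ∀ m ∈ Finset.Ico a b, ∑ n ∈ Finset.Ico a b, u n * (starRingEnd ℂ) (u m) =
        ∑ h ∈ Finset.Ioo (a - b) (b - a),
          if m + h ∈ Finset.Ico a b then u (m + h) * (starRingEnd ℂ) (u m) else 0 := by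
      intro m hm
      rw [← Finset.sum_filter]
      refine Finset.sum_nbij' (fun n => n - m) (fun h => m + h) ?_ ?_ ?_ ?_ ?_
      · intro n hn
        simp only [Finset.mem_filter, Finset.mem_Ioo, Finset.mem_Ico] at *
        omega
      · intro h hh
        exact (Finset.mem_filter.1 hh).2
      · intro n _; ring
      · intro h _; ring
      · intro n _; congr 2; ring
    rw [Finset.sum_congr rfl h2, Finset.sum_comm]
    refine Finset.sum_congr rfl fun h hh => ?_
    rw [← Finset.sum_filter]
    refine Finset.sum_congr ?_ fun _ _ => rfl
    ext m
    simp only [Finset.mem_filter, Finset.mem_Ico, max_le_iff, lt_min_iff]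
    omega
  have h3 := congrArg norm h1
  rw [Complex.norm_real, Real.norm_eq_abs, abs_of_nonneg (by positivity)] at h3
  rw [h3]
  exact norm_sum_le _ _

/-- `P` is a polynomial phase of degree at most `d` whose coefficient of degree `d` is `γ`. -/
def HasTopCoeff : ℕ → ℝ → (ℤ → ℝ) → Prop
  | 0, γ, P => ∀ n, P n = γ
  | d + 1, γ, P => ∀ h : ℤ, HasTopCoeff d ((d + 1) * h * γ) (fun n => P (n + h) - P n)

lemma hasTopCoeff_eval (d : ℕ) (p : Polynomial ℝ) (hp : p.natDegree ≤ d) :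
    HasTopCoeff d (p.coeff d) (fun n => p.eval (n : ℝ)) := by
  induction d generalizing p with
  | zero =>
    intro n
    rw [Polynomial.eq_C_of_natDegree_le_zero hp]; simp
  | succ d ih =>
    intro h
    set r : Polynomial ℝ := Polynomial.taylor (h : ℝ) p - p with hr
    have hc : ∀ m, d ≤ m → r.coeff m = if m = d then (d + 1) * h * p.coeff (d + 1) else 0 := by
      intro m hm
      rw [hr, Polynomial.coeff_sub, Polynomial.taylor_coeff, Polynomial.hasseDeriv_apply,
        Polynomial.sum_over_range' _ (by simp) (d + 2) (by omega), Polynomial.eval_finsetSum,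
        Finset.sum_range_succ, Finset.sum_range_succ]
      have hz : ∑ i ∈ Finset.range d, Polynomial.eval (h : ℝ)
          (Polynomial.monomial (i - m) ((i.choose m : ℝ) * p.coeff i)) = 0 := by
        refine Finset.sum_eq_zero fun i hi => ?_
        rw [Nat.choose_eq_zero_of_lt (by have := Finset.mem_range.1 hi; omega)]; simp
      rw [hz]
      split_ifs with hmd
      · subst hmd
        simp; ring
      · rcases Nat.lt_or_ge m (d + 2) with h1 | h1
        · obtain rfl : m = d + 1 := by omega
          simp
        · have h2 : p.coeff m = 0 := Polynomial.coeff_eq_zero_of_natDegree_lt (by omega)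
          rw [Nat.choose_eq_zero_of_lt (by omega : d < m),
            Nat.choose_eq_zero_of_lt (by omega : d + 1 < m), h2]
          simp
    have hdeg : r.natDegree ≤ d := by
      rw [Polynomial.natDegree_le_iff_coeff_eq_zero]
      intro m hm
      rw [hc m hm.le, if_neg (by omega)]
    have := ih r hdeg
    rw [hc d le_rfl, if_pos rfl] at this
    convert this using 2 with n
    rw [hr, Polynomial.eval_sub, Polynomial.taylor_eval]; push_cast; ring_nf

lemma hasTopCoeff_pow (j : ℕ) (γ : ℝ) : HasTopCoeff j γ (fun n => γ * (n : ℝ) ^ j) := by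
  have := hasTopCoeff_eval j (Polynomial.C γ * Polynomial.X ^ j)
    (Polynomial.natDegree_C_mul_X_pow_le γ j)
  simpa using this

lemma exists_large_fiber {α : Type*} {T : ℝ} (hT : 2 ≤ T) (C : ℕ) (s : Finset α) (q : α → ℕ)
    (hq : ∀ a ∈ s, 0 < q a ∧ (q a : ℝ) ≤ T ^ C) {X : ℝ} (hX : 0 < X) (hs : X ≤ #s) :
    ∃ q₀ : ℕ, 0 < q₀ ∧ (q₀ : ℝ) ≤ T ^ C ∧ X / T ^ C ≤ #{a ∈ s | q a = q₀} := by
  have hT0 : 0 < T := by linarith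
  have hfl : (⌊T ^ C⌋₊ : ℝ) ≤ T ^ C := Nat.floor_le (by positivity)
  have hm : ∀ a ∈ s, q a ∈ Finset.Icc 1 ⌊T ^ C⌋₊ := fun a ha =>
    Finset.mem_Icc.2 ⟨(hq a ha).1, Nat.le_floor (hq a ha).2⟩
  have hne : (Finset.Icc 1 ⌊T ^ C⌋₊).Nonempty :=
    ⟨1, by simp [Nat.one_le_floor_iff, one_le_pow_of_two_le hT C]⟩
  obtain ⟨q₀, hq₀, h⟩ := Finset.exists_le_card_fiber_of_nsmul_le_card_of_maps_to (b := X / T ^ C)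
    hm hne (by
      rw [nsmul_eq_mul, Nat.card_Icc, Nat.add_sub_cancel]
      refine le_trans ?_ hs
      rw [mul_div_assoc', div_le_iff₀ (by positivity), mul_comm]
      gcongr)
  rw [Finset.mem_Icc] at hq₀
  refine ⟨q₀, hq₀.1, le_trans ?_ hfl, h⟩
  exact_mod_cast hq₀.2

/-- A large value somewhere on average produces many large values. -/
lemma card_large_of_sum {α : Type*} (s : Finset α) (F : α → ℝ) {B X δ : ℝ}
    (hB : 0 < B) (hF : ∀ a ∈ s, F a ≤ B) (hs : #s * δ + B * X ≤ ∑ a ∈ s, F a) (hδ : 0 ≤ δ) :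
    X ≤ #{a ∈ s | δ ≤ F a} := by
  have h1 : ∑ a ∈ s, F a ≤ #s * δ + B * #{a ∈ s | δ ≤ F a} := by
    rw [← Finset.sum_filter_add_sum_filter_not s (fun a => δ ≤ F a)]
    have h2 : ∑ a ∈ s with δ ≤ F a, F a ≤ #{a ∈ s | δ ≤ F a} * B := by
      rw [← nsmul_eq_mul]
      exact Finset.sum_le_card_nsmul _ _ _ fun a ha => hF a (Finset.mem_filter.1 ha).1
    have h3 : ∑ a ∈ s with ¬ δ ≤ F a, F a ≤ #s * δ := by
      refine (Finset.sum_le_card_nsmul _ _ δ fun a ha =>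
        (not_le.1 (Finset.mem_filter.1 ha).2).le).trans ?_
      rw [nsmul_eq_mul]
      gcongr
      exact Finset.filter_subset _ _
    linarith
  nlinarith

set_option maxHeartbeats 1000000 in
/-- Weyl's inequality in inverse form. -/
lemma weyl_inverse (d : ℕ) : ∃ C : ℕ, ∀ T : ℝ, 2 ≤ T → ∀ N : ℝ, 1 ≤ N →
    ∀ (γ : ℝ) (P : ℤ → ℝ), HasTopCoeff (d + 1) γ P → ∀ a b : ℤ, ((b : ℝ) - a) ≤ N →
      N / T ≤ ‖∑ n ∈ Finset.Ico a b, eC (P n)‖ →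
      ∃ q : ℕ, 0 < q ∧ (q : ℝ) ≤ T ^ C ∧ dZ (q * γ) ≤ T ^ C / N ^ (d + 1) := by
  induction d with
  | zero =>
    refine ⟨1, fun T hT N hN γ P hP a b hab hS => ⟨1, one_pos, ?_, ?_⟩⟩
    · simp; linarith
    · have hP' : ∀ n, P n = γ * n + P 0 := by
        intro n
        have h : P (0 + n) - P 0 = ((0 : ℕ) + 1) * n * γ := hP n 0
        rw [zero_add, Nat.cast_zero] at h
        linarith
      rw [Finset.sum_congr rfl fun n _ => by rw [hP' n]] at hS
      have h1 := norm_sum_eC_linear_mul_dZ γ (P 0) a b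
      have h2 := mul_le_mul_of_nonneg_right hS (dZ_nonneg γ)
      have h3 : N / T * dZ γ ≤ 1 := h2.trans h1
      rw [zero_add, pow_one, pow_one, le_div_iff₀ (by linarith)]
      rw [div_mul_eq_mul_div, div_le_one (by linarith)] at h3
      simp; linarith
  | succ d ih =>
    obtain ⟨C, hC⟩ := ih
    obtain ⟨C₂, hC₂⟩ := exists_denom_of_many_close_linear 1
    obtain ⟨E, hE⟩ : ∃ E, E = 4 * C + 5 := ⟨_, rfl⟩
    obtain ⟨K, hK⟩ : ∃ K, K = E * C₂ + 4 * C + (d + 2) + 4 * (d + 2) := ⟨_, rfl⟩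
    refine ⟨K, fun T hT N hN γ P hP a b hab hS => ?_⟩
    have hT0 : 0 < T := by linarith
    have hN0 : 0 < N := by linarith
    rcases lt_or_ge N (T ^ 4) with hlt | hge
    · refine ⟨1, one_pos, by simpa using one_le_pow_of_two_le hT _, (dZ_le_one _).trans ?_⟩
      rw [one_le_div (by positivity)]
      calc N ^ (d + 1 + 1) ≤ (T ^ 4) ^ (d + 1 + 1) := pow_le_pow_left₀ hN0.le hlt.le _
        _ = T ^ (4 * (d + 2)) := by rw [← pow_mul]
        _ ≤ _ := pow_le_pow_of_two_le hT (by omega)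
    set S := fun h : ℤ => ∑ m ∈ Finset.Ico (max a (a - h)) (min b (b - h)),
      eC (P (m + h) - P m) with hSdef
    have hvdc : (N / T) ^ 2 ≤ ∑ h ∈ Finset.Ioo (a - b) (b - a), ‖S h‖ := by
      refine (pow_le_pow_left₀ (by positivity) hS 2).trans ?_
      refine (norm_sum_sq_le_sum_norm_diff (fun n => eC (P n)) a b).trans (le_of_eq ?_)
      simp only [hSdef, eC_sub]
    have hSN : ∀ h, ‖S h‖ ≤ N := by
      intro h
      refine (norm_sum_le _ _).trans ?_
      simp only [norm_eC, Finset.sum_const, nsmul_eq_mul, mul_one, Int.card_Ico]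
      have : ((min b (b - h) - max a (a - h)).toNat : ℤ) ≤ max (b - a) 0 := by omega
      have h2 : ((min b (b - h) - max a (a - h)).toNat : ℝ) ≤ max ((b : ℝ) - a) 0 := by
        exact_mod_cast this
      exact h2.trans (max_le hab hN0.le)
    have hcardI : (#(Finset.Ioo (a - b) (b - a)) : ℝ) ≤ 2 * N := by
      rw [Int.card_Ioo]
      have : ((b - a - (a - b) - 1).toNat : ℤ) ≤ max (2 * (b - a)) 0 := by omega
      have h2 : ((b - a - (a - b) - 1).toNat : ℝ) ≤ max (2 * ((b : ℝ) - a)) 0 := by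
        exact_mod_cast this
      exact h2.trans (max_le (by linarith) (by linarith))
    set 𝓗 := {h ∈ Finset.Ioo (a - b) (b - a) | N / T ^ 4 ≤ ‖S h‖} with h𝓗
    have hcH : N / T ^ 3 ≤ #𝓗 := by
      refine card_large_of_sum _ _ hN0 (fun h _ => hSN h) (le_trans ?_ hvdc) (by positivity)
      calc _ ≤ 2 * N * (N / T ^ 4) + N * (N / T ^ 3) := by gcongr
        _ = N ^ 2 / T ^ 4 * (2 + T) := by field_simp
        _ ≤ N ^ 2 / T ^ 4 * T ^ 2 := by gcongr; nlinarith
        _ = _ := by field_simp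
    set 𝓗₁ := (𝓗.erase 0).image Int.natAbs with h𝓗₁
    have hcH1 : N / T ^ 5 ≤ #𝓗₁ := by
      have h1 : #(𝓗.erase 0) ≤ 2 * #𝓗₁ := by
        refine Finset.card_le_mul_card_image _ 2 fun n _ => ?_
        refine (Finset.card_le_card (t := {(n : ℤ), -(n : ℤ)}) fun x hx => ?_).trans
          (Finset.card_le_two)
        have := (Finset.mem_filter.1 hx).2
        simp only [Finset.mem_insert, Finset.mem_singleton]
        omega
      have h2 : #𝓗 ≤ #(𝓗.erase 0) + 1 := by
        have := Finset.pred_card_le_card_erase (s := 𝓗) (a := (0 : ℤ)); omega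
      have h3 : (#𝓗 : ℝ) ≤ 2 * #𝓗₁ + 1 := by exact_mod_cast h2.trans (by omega)
      have h4 : 2 * (N / T ^ 5) ≤ N / T ^ 4 := by
        rw [mul_div_assoc', div_le_div_iff₀ (by positivity) (by positivity)]
        have : 2 * T ^ 4 ≤ T ^ 5 := two_mul_pow_le hT 4
        have := mul_le_mul_of_nonneg_left this hN0.le
        linarith
      have h5 : N / T ^ 4 + 1 ≤ N / T ^ 3 := by
        have e1 : N / T ^ 3 = N / T ^ 4 * T := by field_simp
        have e2 : 1 ≤ N / T ^ 4 := by rwa [one_le_div (by positivity)]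
        rw [e1]; nlinarith
      linarith
    have hq : ∀ h : ℕ, ∃ q : ℕ, h ∈ 𝓗₁ → 0 < q ∧ (q : ℝ) ≤ T ^ (4 * C) ∧
        dZ (q * ((d + 1 + 1) * h * γ)) ≤ T ^ (4 * C) / N ^ (d + 1) := by
      intro h
      by_cases hh : h ∈ 𝓗₁
      · obtain ⟨x, hx, rfl⟩ := Finset.mem_image.1 hh
        have hx' := Finset.mem_filter.1 (Finset.mem_erase.1 hx).2
        obtain ⟨q, hq0, hqT, hqd⟩ := hC (T ^ 4) (by nlinarith [pow_le_pow_left₀ (by norm_num) hT 4])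
          N hN _ _ (hP x) _ _ (by
            have : ((min b (b - x) - max a (a - x)) : ℤ) ≤ (b - a) := by omega
            have h2 : ((min b (b - x) : ℤ) : ℝ) - ((max a (a - x) : ℤ) : ℝ) ≤ (b : ℝ) - a := by
              exact_mod_cast this
            exact h2.trans hab) hx'.2
        rw [← pow_mul] at hqT hqd
        refine ⟨q, fun _ => ⟨hq0, hqT, ?_⟩⟩
        push_cast at hqd
        rw [Nat.cast_natAbs, Int.cast_abs]
        rcases abs_choice (x : ℝ) with h1 | h1
        · rw [h1]; exact hqd
        · rw [h1, ← dZ_neg]; convert hqd using 2; ring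
      · exact ⟨0, fun h => absurd h hh⟩
    choose q hq using hq
    obtain ⟨q₀, hq₀, hq₀T, hfib⟩ := exists_large_fiber hT (4 * C) 𝓗₁ q
      (fun h hh => ⟨(hq h hh).1, (hq h hh).2.1⟩) (by positivity) hcH1
    have hTE : 2 ≤ T ^ E := by
      have := two_mul_pow_le hT (4 * C + 4)
      have := one_le_pow_of_two_le hT (4 * C + 4)
      rw [hE]; linarith
    obtain ⟨r, hr0, hrT, hrd⟩ := hC₂ (T ^ E) hTE N hN (q₀ * ((d + 1 + 1) * γ))
      (T ^ (4 * C) / N ^ (d + 1)) {h ∈ 𝓗₁ | q h = q₀} (by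
        intro h hh
        obtain ⟨x, hx, rfl⟩ := Finset.mem_image.1 (Finset.mem_filter.1 hh).1
        have hx0 := (Finset.mem_erase.1 hx).1
        have hxI := Finset.mem_Ioo.1 (Finset.mem_filter.1 (Finset.mem_erase.1 hx).2).1
        refine ⟨by omega, le_trans ?_ hab⟩
        have h1 : (x.natAbs : ℤ) ≤ b - a := by omega
        have h2 : ((x.natAbs : ℤ) : ℝ) ≤ ((b - a : ℤ) : ℝ) := Int.cast_le.2 h1
        rwa [Int.cast_natCast, Int.cast_sub] at h2) (by
        refine le_trans (le_of_eq ?_) hfib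
        rw [hE, pow_add, div_div, mul_comm]) (by
        rw [pow_one]
        gcongr
        · linarith
        · omega
        · exact le_self_pow₀ hN (by omega)) (by
        intro h hh
        have hh' := Finset.mem_filter.1 hh
        have := (hq h hh'.1).2.2
        rw [hh'.2] at this
        convert this using 2; ring)
    refine ⟨r * (q₀ * (d + 2)), by positivity, ?_, ?_⟩
    · push_cast
      have h1 : ((d : ℝ) + 2) ≤ T ^ (d + 2) := by exact_mod_cast natCast_le_pow hT (d + 2)
      calc (r : ℝ) * (q₀ * (d + 2)) ≤ (T ^ E) ^ C₂ * (T ^ (4 * C) * T ^ (d + 2)) := by gcongr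
        _ = T ^ (E * C₂ + 4 * C + (d + 2)) := by rw [← pow_mul, ← pow_add, ← pow_add]; ring_nf
        _ ≤ _ := pow_le_pow_of_two_le hT (by omega)
    · push_cast
      rw [show (r : ℝ) * (q₀ * (d + 2)) * γ = r * (q₀ * ((d + 1 + 1) * γ)) by ring]
      refine hrd.trans ?_
      calc _ = T ^ (E * C₂ + 4 * C) / N ^ (d + 1 + 1) := by
            rw [← pow_mul, pow_add, pow_succ N (d + 1)]; field_simp; ring
        _ ≤ _ := by gcongr <;> [linarith; omega]

lemma two_le_pow {T : ℝ} (hT : 2 ≤ T) {n : ℕ} (hn : 1 ≤ n) : 2 ≤ T ^ n :=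
  hT.trans (le_self_pow₀ (by linarith) (by omega))

lemma weyl_inverse_pow (j : ℕ) (hj : 1 ≤ j) : ∃ C : ℕ, ∀ T : ℝ, 2 ≤ T → ∀ N : ℝ, 1 ≤ N →
    ∀ (γ : ℝ) (a b : ℤ), ((b : ℝ) - a) ≤ N →
      N / T ≤ ‖∑ n ∈ Finset.Ico a b, eC (γ * (n : ℝ) ^ j)‖ →
      ∃ q : ℕ, 0 < q ∧ (q : ℝ) ≤ T ^ C ∧ dZ (q * γ) ≤ T ^ C / N ^ j := by
  obtain ⟨d, rfl⟩ : ∃ d, j = d + 1 := ⟨j - 1, by omega⟩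
  obtain ⟨C, hC⟩ := weyl_inverse d
  exact ⟨C, fun T hT N hN γ a b hab h =>
    hC T hT N hN γ _ (hasTopCoeff_pow (d + 1) γ) a b hab h⟩

lemma norm_eC_sub_one_le_dZ (x : ℝ) : ‖eC x - 1‖ ≤ 7 * dZ x := by
  have h := eC_add_int (x - round x) (round x)
  rw [sub_add_cancel] at h
  rw [h]
  exact norm_eC_sub_one_le _

lemma norm_sum_eC_mul_ge (t κ : ℝ) (H : ℕ) (ht : dZ t ≤ κ) (hH : 14 * H * κ ≤ 1) :
    (H : ℝ) / 2 ≤ ‖∑ h ∈ Finset.range H, eC (h * t)‖ := by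
  have h1 : ‖∑ h ∈ Finset.range H, (eC (h * t) - 1)‖ ≤ H * (7 * (H * κ)) := by
    refine (norm_sum_le _ _).trans ?_
    have : ∀ h ∈ Finset.range H, ‖eC (h * t) - 1‖ ≤ 7 * (H * κ) := by
      intro h hh
      refine (norm_eC_sub_one_le_dZ _).trans ?_
      have h2 : (h : ℝ) ≤ H := by exact_mod_cast (Finset.mem_range.1 hh).le
      have := (dZ_nat_mul_le h t).trans
        (mul_le_mul h2 ht (dZ_nonneg _) (by positivity))
      linarith
    refine (Finset.sum_le_card_nsmul _ _ _ this).trans ?_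
    simp
  have h2 : (∑ h ∈ Finset.range H, eC (h * t)) = H + ∑ h ∈ Finset.range H, (eC (h * t) - 1) := by
    simp
  have h3 : (H : ℝ) - ‖∑ h ∈ Finset.range H, (eC (h * t) - 1)‖ ≤
      ‖∑ h ∈ Finset.range H, eC (h * t)‖ := by
    rw [h2]
    have := norm_sub_le_norm_add (H : ℂ) (∑ h ∈ Finset.range H, (eC (h * t) - 1))
    simpa using this
  have h4 : (0 : ℝ) ≤ H := by positivity
  nlinarith

lemma sum_norm_sq_sum_eC (f : ℤ → ℝ) (H : ℕ) (s : Finset ℤ) :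
    ∑ y ∈ s, ‖∑ h ∈ Finset.range H, eC (h * f y)‖ ^ 2 ≤
      ∑ h ∈ Finset.range H, ∑ h' ∈ Finset.range H, ‖∑ y ∈ s, eC (((h : ℝ) - h') * f y)‖ := by
  have h1 : ((∑ y ∈ s, ‖∑ h ∈ Finset.range H, eC (h * f y)‖ ^ 2 : ℝ) : ℂ) =
      ∑ h ∈ Finset.range H, ∑ h' ∈ Finset.range H, ∑ y ∈ s, eC (((h : ℝ) - h') * f y) := by
    push_cast
    simp_rw [← Complex.mul_conj', map_sum, Finset.sum_mul_sum, sub_mul, eC_sub]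
    rw [Finset.sum_comm]
    refine Finset.sum_congr rfl fun h _ => ?_
    rw [Finset.sum_comm]
  have h2 := congrArg norm h1
  rw [Complex.norm_real, Real.norm_eq_abs, abs_of_nonneg (by positivity)] at h2
  rw [h2]
  refine (norm_sum_le _ _).trans (Finset.sum_le_sum fun h _ => norm_sum_le _ _)

set_option maxHeartbeats 1000000 in
/-- A strong form of Vinogradov's lemma: if `α y ^ j + β` is within `κ` of an integer for many
`y`, then `α` is close to a rational with small denominator. -/
lemma exists_denom_of_many_close_pow (j : ℕ) (hj : 1 ≤ j) :
    ∃ C : ℕ, ∀ T : ℝ, 2 ≤ T → ∀ N : ℝ, T ^ C ≤ N → ∀ (α β κ : ℝ) (Y : Finset ℕ),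
      (∀ y ∈ Y, (y : ℝ) ≤ N) → N / T ≤ (#Y : ℝ) → κ * T ^ C ≤ 1 →
      (∀ y ∈ Y, dZ (α * (y : ℝ) ^ j + β) ≤ κ) →
      ∃ q : ℕ, 0 < q ∧ (q : ℝ) ≤ T ^ C ∧ dZ (q * α) ≤ κ * T ^ C / N ^ j := by
  obtain ⟨C₁, hC₁⟩ := weyl_inverse_pow j hj
  obtain ⟨A, hA⟩ : ∃ A, A = 5 * C₁ + 6 := ⟨_, rfl⟩
  obtain ⟨C₂, hC₂⟩ := dZ_mul_le_of_many_close j hj A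
  refine ⟨C₂ + A + 10, fun T hT N hN α β κ Y hYN hYc hκ hY => ?_⟩
  have hT0 : 0 < T := by linarith
  have hN1 : 1 ≤ N := (one_le_pow_of_two_le hT _).trans hN
  have hN0 : 0 < N := by linarith
  have hYne : Y.Nonempty := by
    rw [← Finset.card_pos]
    have : (0 : ℝ) < #Y := lt_of_lt_of_le (by positivity) hYc
    exact_mod_cast this
  have hκ0 : 0 ≤ κ := by
    obtain ⟨y, hy⟩ := hYne
    exact (dZ_nonneg _).trans (hY y hy)
  obtain ⟨H, hH⟩ : ∃ H, H = ⌈16 * T⌉₊ := ⟨_, rfl⟩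
  have hH1 : 16 * T ≤ H := hH ▸ Nat.le_ceil _
  have hH2 : (H : ℝ) ≤ 17 * T := by
    have := Nat.ceil_lt_add_one (show 0 ≤ 16 * T by positivity)
    rw [← hH] at this; linarith
  have hH0 : (0 : ℝ) < H := by linarith
  have hT4 : (16 : ℝ) ≤ T ^ 4 := by
    calc (16 : ℝ) = 2 ^ 4 := by norm_num
      _ ≤ T ^ 4 := pow_le_pow_left₀ (by norm_num) hT 4
  have hH6 : (H : ℝ) ≤ T ^ 6 := by
    have h5 : (32 : ℝ) ≤ T ^ 5 := by
      calc (32 : ℝ) = 2 ^ 5 := by norm_num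
        _ ≤ T ^ 5 := pow_le_pow_left₀ (by norm_num) hT 5
    have := mul_le_mul_of_nonneg_right h5 hT0.le
    calc (H : ℝ) ≤ T ^ 5 * T := by linarith
      _ = T ^ 6 := by ring
  have h14 : 14 * H * κ ≤ 1 := by
    refine le_trans ?_ hκ
    rw [mul_comm]
    gcongr
    calc 14 * (H : ℝ) ≤ T ^ 4 * T ^ 6 := by gcongr; linarith
      _ = T ^ 10 := by ring
      _ ≤ _ := pow_le_pow_of_two_le hT (by omega)
  set f : ℤ → ℝ := fun y => α * (y : ℝ) ^ j + β with hf
  set I := Finset.Ico (0 : ℤ) (⌊N⌋₊ + 1) with hI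
  have hcI : (#I : ℝ) ≤ 2 * N := by
    rw [hI, Int.card_Ico]
    have : ((⌊N⌋₊ : ℤ) + 1 - 0).toNat = ⌊N⌋₊ + 1 := by omega
    rw [this]; push_cast
    have := Nat.floor_le hN0.le
    linarith
  have hlow : #Y * ((H : ℝ) / 2) ^ 2 ≤ ∑ y ∈ I, ‖∑ h ∈ Finset.range H, eC (h * f y)‖ ^ 2 := by
    have hsub : Y.image (fun n : ℕ => (n : ℤ)) ⊆ I := by
      intro x hx
      obtain ⟨y, hy, rfl⟩ := Finset.mem_image.1 hx
      rw [hI, Finset.mem_Ico]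
      have := Nat.le_floor (hYN y hy)
      constructor <;> [positivity; (norm_cast; omega)]
    refine le_trans ?_ (Finset.sum_le_sum_of_subset_of_nonneg hsub fun _ _ _ => by positivity)
    rw [Finset.sum_image (fun a _ b _ h => by exact_mod_cast h), ← nsmul_eq_mul]
    refine Finset.card_nsmul_le_sum _ _ _ fun y hy => ?_
    refine pow_le_pow_left₀ (by positivity) ?_ 2
    exact norm_sum_eC_mul_ge _ κ H (by simpa [hf] using hY y hy) h14
  have hup := hlow.trans (sum_norm_sq_sum_eC f H I)
  obtain ⟨h, h', hne, hhH, hhH', hbig⟩ : ∃ h h' : ℕ, h ≠ h' ∧ h < H ∧ h' < H ∧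
      N / (8 * T) ≤ ‖∑ y ∈ I, eC (((h : ℝ) - h') * f y)‖ := by
    by_contra! hcon
    have hb : ∀ h ∈ Finset.range H, ∑ h' ∈ Finset.range H,
        ‖∑ y ∈ I, eC (((h : ℝ) - h') * f y)‖ < 2 * N + H * (N / (8 * T)) := by
      intro h hh
      rw [← Finset.add_sum_erase _ _ hh]
      have h1 : ‖∑ y ∈ I, eC (((h : ℝ) - h) * f y)‖ ≤ 2 * N := by
        refine (norm_sum_le _ _).trans ?_
        simpa [norm_eC] using hcI
      have h2 : ∑ h' ∈ (Finset.range H).erase h, ‖∑ y ∈ I, eC (((h : ℝ) - h') * f y)‖ ≤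
          #((Finset.range H).erase h) * (N / (8 * T)) := by
        rw [← nsmul_eq_mul]
        refine Finset.sum_le_card_nsmul _ _ _ fun h' hh' => ?_
        rw [Finset.mem_erase] at hh'
        exact (hcon h h' (Ne.symm hh'.1) (Finset.mem_range.1 hh) (Finset.mem_range.1 hh'.2)).le
      have h3 : (#((Finset.range H).erase h) : ℝ) + 1 ≤ H := by
        have := Finset.card_erase_of_mem hh
        rw [Finset.card_range] at this
        have h4 := Finset.mem_range.1 hh
        have : #((Finset.range H).erase h) + 1 ≤ H := by omega
        exact_mod_cast this
      have h5 : 0 < N / (8 * T) := by positivity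
      nlinarith
    have hsum := Finset.sum_lt_sum_of_nonempty
      (Finset.nonempty_range_iff.2 (by rintro rfl; simp at hH0)) hb
    rw [Finset.sum_const, Finset.card_range, nsmul_eq_mul] at hsum
    have h1 := hup.trans_lt hsum
    have h2 : N / T * ((H : ℝ) / 2) ^ 2 < H * (2 * N + H * (N / (8 * T))) :=
      lt_of_le_of_lt (by gcongr) h1
    have h3 : N / T * ((H : ℝ) / 2) ^ 2 = H * (H * (N / (8 * T))) + H * N * (H / (8 * T)) := by
      field_simp; ring
    have h4 : 2 ≤ H / (8 * T) := by
      rw [le_div_iff₀ (by positivity)]; linarith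
    have h5 : H * N * 2 ≤ H * N * (H / (8 * T)) := by gcongr
    linarith
  have hbig' : 2 * N / T ^ 5 ≤ ‖∑ y ∈ I, eC ((((h : ℝ) - h') * α) * (y : ℝ) ^ j)‖ := by
    have e : ∑ y ∈ I, eC (((h : ℝ) - h') * f y) =
        (∑ y ∈ I, eC ((((h : ℝ) - h') * α) * (y : ℝ) ^ j)) * eC (((h : ℝ) - h') * β) := by
      rw [Finset.sum_mul]
      refine Finset.sum_congr rfl fun y _ => ?_
      rw [← eC_add]; congr 1; rw [hf]; ring
    rw [e, norm_mul, norm_eC, mul_one] at hbig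
    refine le_trans ?_ hbig
    rw [div_le_div_iff₀ (by positivity) (by positivity)]
    have : N * T * 16 ≤ N * T * T ^ 4 := by gcongr
    calc 2 * N * (8 * T) = N * T * 16 := by ring
      _ ≤ _ := this
      _ = _ := by ring
  obtain ⟨q, hq0, hqT, hqd⟩ := hC₁ (T ^ 5) (two_le_pow hT (by norm_num))
    (2 * N) (by linarith) _ _ _ (by
      push_cast
      have := Nat.floor_le hN0.le
      linarith) hbig'
  rw [← pow_mul] at hqT hqd
  obtain ⟨m, hm⟩ : ∃ m : ℤ, m = (h : ℤ) - h' := ⟨_, rfl⟩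
  have hm0 : 0 < m.natAbs := by omega
  have hmH : (m.natAbs : ℝ) ≤ T ^ 6 := by
    refine le_trans ?_ hH6
    have : m.natAbs ≤ H := by omega
    exact_mod_cast this
  have hQd : dZ ((q * m.natAbs : ℕ) * α) ≤ T ^ A / N ^ j := by
    have h1 : dZ ((q * m.natAbs : ℕ) * α) = dZ (q * ((((h : ℝ) - h') * α))) := by
      push_cast
      rw [Nat.cast_natAbs, Int.cast_abs]
      have hm' : (m : ℝ) = (h : ℝ) - h' := by rw [hm]; push_cast; ring
      rw [← hm']
      rcases abs_choice (m : ℝ) with h1 | h1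
      · rw [h1, mul_assoc]
      · rw [h1, ← dZ_neg]; congr 1; ring
    rw [h1]
    refine hqd.trans ?_
    have : N ^ j ≤ (2 * N) ^ j := pow_le_pow_left₀ hN0.le (by linarith) _
    gcongr
    · linarith
    · omega
  have hQT : ((q * m.natAbs : ℕ) : ℝ) ≤ T ^ A := by
    push_cast
    calc (q : ℝ) * m.natAbs ≤ T ^ (5 * C₁) * T ^ 6 := by gcongr
      _ = _ := by rw [hA, pow_add]
  have hfin := hC₂ T hT N ((pow_le_pow_of_two_le hT (by omega)).trans hN) α β κ
    (q * m.natAbs) Y (by positivity) hQT hQd hYN hYc hY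
  refine ⟨q * m.natAbs, by positivity, hQT.trans (pow_le_pow_of_two_le hT (by omega)),
    hfin.trans ?_⟩
  gcongr
  · linarith
  · omega

lemma sum_Ico_natCast {β : Type*} [AddCommMonoid β] (F : ℤ → β) (a b : ℕ) :
    ∑ n ∈ Finset.Ico a b, F (n : ℤ) = ∑ n ∈ Finset.Ico (a : ℤ) (b : ℤ), F n := by
  refine Finset.sum_nbij (fun n : ℕ => (n : ℤ)) (fun n hn => ?_)
    (fun x _ y _ h => by simpa using h) (fun z hz => ?_) (fun _ _ => rfl)
  · simpa using hn
  · have hz' := Finset.mem_Ico.1 (Finset.mem_coe.1 hz)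
    refine ⟨z.toNat, ?_, Int.toNat_of_nonneg (by omega)⟩
    simp only [Finset.coe_Ico, Set.mem_Ico]
    omega

lemma weyl_inverse_pow_nat (j : ℕ) (hj : 1 ≤ j) : ∃ C : ℕ, ∀ T : ℝ, 2 ≤ T → ∀ N : ℝ, 1 ≤ N →
    ∀ (γ : ℝ) (a b : ℕ), ((b : ℝ) - a) ≤ N →
      N / T ≤ ‖∑ n ∈ Finset.Ico a b, eC (γ * (n : ℝ) ^ j)‖ →
      ∃ q : ℕ, 0 < q ∧ (q : ℝ) ≤ T ^ C ∧ dZ (q * γ) ≤ T ^ C / N ^ j := by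
  obtain ⟨C, hC⟩ := weyl_inverse_pow j hj
  refine ⟨C, fun T hT N hN γ a b hab h => hC T hT N hN γ a b (by exact_mod_cast hab) ?_⟩
  rw [← sum_Ico_natCast]
  exact_mod_cast h

lemma exists_denom_of_many_pairs (j : ℕ) (hj : 1 ≤ j) :
    ∃ C : ℕ, ∀ T : ℝ, 2 ≤ T → ∀ N₁ N₂ : ℝ, T ^ C ≤ N₁ → T ^ C ≤ N₂ →
      ∀ (θ : ℝ) (Z : Finset (ℕ × ℕ)), (∀ z ∈ Z, (z.1 : ℝ) ≤ N₂ ∧ (z.2 : ℝ) ≤ N₂) →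
        N₂ ^ 2 / T ≤ (#Z : ℝ) →
        (∀ z ∈ Z, ∃ a b : ℕ, ((b : ℝ) - a) ≤ N₁ ∧ N₁ / T ≤
          ‖∑ n ∈ Finset.Ico a b, eC ((θ * ((z.1 : ℝ) ^ j - (z.2 : ℝ) ^ j)) * (n : ℝ) ^ j)‖) →
        ∃ q : ℕ, 0 < q ∧ (q : ℝ) ≤ T ^ C ∧ dZ (q * θ) ≤ T ^ C / (N₁ * N₂) ^ j := by
  obtain ⟨C₁, hC₁⟩ := weyl_inverse_pow_nat j hj
  obtain ⟨C₂, hC₂⟩ := exists_denom_of_many_close_pow j hj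
  obtain ⟨E, hE⟩ : ∃ E, E = C₁ + 2 := ⟨_, rfl⟩
  refine ⟨C₁ + E * C₂, fun T hT N₁ N₂ hN₁ hN₂ θ Z hZ hZc hK => ?_⟩
  have hT0 : 0 < T := by linarith
  have hN₁1 : 1 ≤ N₁ := (one_le_pow_of_two_le hT _).trans hN₁
  have hN₂1 : 1 ≤ N₂ := (one_le_pow_of_two_le hT _).trans hN₂
  have hN₁0 : 0 < N₁ := by linarith
  have hN₂0 : 0 < N₂ := by linarith
  have hq : ∀ z : ℕ × ℕ, ∃ q : ℕ, z ∈ Z → 0 < q ∧ (q : ℝ) ≤ T ^ C₁ ∧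
      dZ (q * (θ * ((z.1 : ℝ) ^ j - (z.2 : ℝ) ^ j))) ≤ T ^ C₁ / N₁ ^ j := by
    intro z
    by_cases hz : z ∈ Z
    · obtain ⟨a, b, hab, h⟩ := hK z hz
      obtain ⟨q, hq⟩ := hC₁ T hT N₁ hN₁1 _ a b hab h
      exact ⟨q, fun _ => hq⟩
    · exact ⟨0, fun h => absurd h hz⟩
  choose q hq using hq
  obtain ⟨q₀, hq₀, hq₀T, hfib⟩ := exists_large_fiber hT C₁ Z q
    (fun z hz => ⟨(hq z hz).1, (hq z hz).2.1⟩) (by positivity) hZc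
  set Z' := {z ∈ Z | q z = q₀} with hZ'
  have hfl : (⌊N₂⌋₊ : ℝ) ≤ N₂ := Nat.floor_le hN₂0.le
  obtain ⟨y', hy', hY⟩ := Finset.exists_le_card_fiber_of_nsmul_le_card_of_maps_to
    (s := Z') (t := Finset.range (⌊N₂⌋₊ + 1)) (f := Prod.snd) (b := N₂ / T ^ E)
    (fun z hz => Finset.mem_range.2 (Nat.lt_succ_of_le
      (Nat.le_floor (hZ z (Finset.mem_filter.1 hz).1).2))) ⟨0, by simp⟩ (by
      rw [Finset.card_range, nsmul_eq_mul]
      refine le_trans ?_ hfib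
      push_cast
      calc ((⌊N₂⌋₊ : ℝ) + 1) * (N₂ / T ^ E) ≤ (T * N₂) * (N₂ / T ^ E) := by
            gcongr; nlinarith
        _ = N₂ ^ 2 / T / T ^ C₁ := by rw [hE, pow_add]; field_simp)
  set Y := ({z ∈ Z' | z.2 = y'}).image Prod.fst with hYdef
  have hYc : N₂ / T ^ E ≤ #Y := by
    rw [hYdef, Finset.card_image_of_injOn]
    · exact hY
    · intro z hz w hw h
      have h1 := (Finset.mem_filter.1 (Finset.mem_coe.1 hz)).2
      have h2 := (Finset.mem_filter.1 (Finset.mem_coe.1 hw)).2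
      exact Prod.ext h (h1.trans h2.symm)
  obtain ⟨r, hr0, hrT, hrd⟩ := hC₂ (T ^ E) (two_le_pow hT (by omega)) N₂ (by
      rw [← pow_mul]
      exact (pow_le_pow_of_two_le hT (by omega)).trans hN₂) (q₀ * θ) (-(q₀ * θ * (y' : ℝ) ^ j))
    (T ^ C₁ / N₁ ^ j) Y (by
      intro y hy
      obtain ⟨z, hz, rfl⟩ := Finset.mem_image.1 hy
      exact (hZ z (Finset.mem_filter.1 (Finset.mem_filter.1 hz).1).1).1) hYc (by
      rw [div_mul_eq_mul_div, div_le_one (by positivity), ← pow_mul, ← pow_add]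
      exact hN₁.trans (le_self_pow₀ hN₁1 (by omega))) (by
      intro y hy
      obtain ⟨z, hz, rfl⟩ := Finset.mem_image.1 hy
      have hz1 := Finset.mem_filter.1 hz
      have hz2 := Finset.mem_filter.1 hz1.1
      have := (hq z hz2.1).2.2
      rw [hz2.2, hz1.2] at this
      convert this using 2; ring)
  refine ⟨r * q₀, by positivity, ?_, ?_⟩
  · push_cast
    rw [← pow_mul] at hrT
    calc (r : ℝ) * q₀ ≤ T ^ (E * C₂) * T ^ C₁ := by gcongr
      _ = _ := by rw [← pow_add, add_comm]
  · push_cast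
    rw [mul_assoc]
    refine hrd.trans (le_of_eq ?_)
    rw [← pow_mul, mul_pow, pow_add]; field_simp

lemma exists_eq_Ico_of_ordConnected (s : Finset ℕ) (n : ℕ) (hn : ∀ x ∈ s, x < n)
    (hs : ∀ x ∈ s, ∀ z ∈ s, ∀ y, x ≤ y → y ≤ z → y ∈ s) :
    ∃ a b : ℕ, b ≤ n ∧ s = Finset.Ico a b := by
  rcases s.eq_empty_or_nonempty with rfl | hne
  · exact ⟨0, 0, Nat.zero_le _, by simp⟩
  · refine ⟨s.min' hne, s.max' hne + 1, hn _ (s.max'_mem hne), ?_⟩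
    ext y
    rw [Finset.mem_Ico, Nat.lt_succ_iff]
    exact ⟨fun h => ⟨s.min'_le _ h, s.le_max' _ h⟩,
      fun h => hs _ (s.min'_mem hne) _ (s.max'_mem hne) y h.1 h.2⟩

set_option maxHeartbeats 1000000 in
/-- Bilinear (type II) inverse theorem for the phase `θ x ^ j y ^ j`. -/
lemma bilinear_inverse (j : ℕ) (hj : 1 ≤ j) :
    ∃ C : ℕ, ∀ T : ℝ, 2 ≤ T → ∀ N₁ N₂ : ℝ, T ^ C ≤ N₁ → T ^ C ≤ N₂ →
      ∀ (θ : ℝ) (X Y : Finset ℕ) (f g : ℕ → ℂ) (a b : ℕ),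
        (∀ x ∈ X, (x : ℝ) ≤ N₁) → (∀ y ∈ Y, (y : ℝ) ≤ N₂) →
        ∑ x ∈ X, ‖f x‖ ^ 2 ≤ T * N₁ → ∑ y ∈ Y, ‖g y‖ ^ 2 ≤ T * N₂ →
        N₁ * N₂ / T ≤ ‖∑ x ∈ X, ∑ y ∈ Y with a ≤ x * y ∧ x * y < b,
          f x * g y * eC (θ * ((x : ℝ) ^ j * (y : ℝ) ^ j))‖ →
        ∃ q : ℕ, 0 < q ∧ (q : ℝ) ≤ T ^ C ∧ dZ (q * θ) ≤ T ^ C / (N₁ * N₂) ^ j := by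
  obtain ⟨C₁, hC₁⟩ := exists_denom_of_many_pairs j hj
  refine ⟨12 * C₁, fun T hT N₁ N₂ hN₁ hN₂ θ X Y f g a b hX hY hf hg hS => ?_⟩
  have hT0 : 0 < T := by linarith
  have hN₁1 : 1 ≤ N₁ := (one_le_pow_of_two_le hT _).trans hN₁
  have hN₂1 : 1 ≤ N₂ := (one_le_pow_of_two_le hT _).trans hN₂
  have hN₁0 : 0 < N₁ := by linarith
  have hN₂0 : 0 < N₂ := by linarith
  obtain ⟨n, hn⟩ : ∃ n, n = ⌊N₁⌋₊ + 1 := ⟨_, rfl⟩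
  have hn2 : (n : ℝ) ≤ 2 * N₁ := by
    have := Nat.floor_le hN₁0.le
    rw [hn]; push_cast; linarith
  set c : ℕ → ℕ → ℂ := fun x y => if a ≤ x * y ∧ x * y < b then 1 else 0 with hc
  set G : ℕ → ℂ := fun x => ∑ y ∈ Y, c x y * g y * eC (θ * ((x : ℝ) ^ j * (y : ℝ) ^ j)) with hG
  set K : ℕ × ℕ → ℂ := fun z => ∑ x ∈ Finset.range n, c x z.1 * c x z.2 *
    eC ((θ * ((z.1 : ℝ) ^ j - (z.2 : ℝ) ^ j)) * (x : ℝ) ^ j) with hKdef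
  have hcn : ∀ x y, ‖c x y‖ ≤ 1 := by
    intro x y; simp only [hc]; split_ifs <;> simp
  have hS1 : ∑ x ∈ X, ∑ y ∈ Y with a ≤ x * y ∧ x * y < b,
      f x * g y * eC (θ * ((x : ℝ) ^ j * (y : ℝ) ^ j)) = ∑ x ∈ X, f x * G x := by
    refine Finset.sum_congr rfl fun x _ => ?_
    rw [hG, Finset.mul_sum, Finset.sum_filter]
    refine Finset.sum_congr rfl fun y _ => ?_
    simp only [hc]; split_ifs <;> ring
  have hXn : X ⊆ Finset.range n := fun x hx => by
    rw [Finset.mem_range, hn, Nat.lt_succ_iff]; exact Nat.le_floor (hX x hx)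
  have h1 : (N₁ * N₂ / T) ^ 2 ≤ (T * N₁) * ∑ x ∈ Finset.range n, ‖G x‖ ^ 2 := by
    rw [hS1] at hS
    calc (N₁ * N₂ / T) ^ 2 ≤ (∑ x ∈ X, ‖f x‖ * ‖G x‖) ^ 2 := by
          refine pow_le_pow_left₀ (by positivity) (hS.trans ((norm_sum_le _ _).trans ?_)) 2
          simp only [norm_mul, le_refl]
      _ ≤ (∑ x ∈ X, ‖f x‖ ^ 2) * ∑ x ∈ X, ‖G x‖ ^ 2 := Finset.sum_mul_sq_le_sq_mul_sq _ _ _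
      _ ≤ _ := by
          gcongr
  have h2 : ∑ x ∈ Finset.range n, ‖G x‖ ^ 2 ≤ ∑ z ∈ Y ×ˢ Y, ‖g z.1‖ * ‖g z.2‖ * ‖K z‖ := by
    have e : ((∑ x ∈ Finset.range n, ‖G x‖ ^ 2 : ℝ) : ℂ) =
        ∑ z ∈ Y ×ˢ Y, g z.1 * (starRingEnd ℂ) (g z.2) * K z := by
      push_cast
      have e0 : ∀ x, (‖G x‖ : ℂ) ^ 2 = ∑ z ∈ Y ×ˢ Y,
          (c x z.1 * g z.1 * eC (θ * ((x : ℝ) ^ j * (z.1 : ℝ) ^ j))) * (starRingEnd ℂ)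
          (c x z.2 * g z.2 * eC (θ * ((x : ℝ) ^ j * (z.2 : ℝ) ^ j))) := by
        intro x
        rw [← Complex.mul_conj', hG]
        simp only [map_sum]
        rw [Finset.sum_mul_sum, Finset.sum_product]
      rw [Finset.sum_congr rfl fun x _ => e0 x, Finset.sum_comm]
      refine Finset.sum_congr rfl fun z _ => ?_
      rw [hKdef, Finset.mul_sum]
      refine Finset.sum_congr rfl fun x _ => ?_
      have e1 : (θ * ((z.1 : ℝ) ^ j - (z.2 : ℝ) ^ j)) * (x : ℝ) ^ j =
        θ * ((x : ℝ) ^ j * (z.1 : ℝ) ^ j) - θ * ((x : ℝ) ^ j * (z.2 : ℝ) ^ j) := by ring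
      have e2 : (starRingEnd ℂ) (c x z.2) = c x z.2 := by
        simp only [hc]; split_ifs <;> simp
      rw [e1, eC_sub, map_mul, map_mul, e2]; ring
    have := congrArg norm e
    rw [Complex.norm_real, Real.norm_eq_abs, abs_of_nonneg (by positivity)] at this
    rw [this]
    refine (norm_sum_le _ _).trans (le_of_eq (Finset.sum_congr rfl fun z _ => ?_))
    rw [norm_mul, norm_mul, RCLike.norm_conj]
  have h3 : (∑ z ∈ Y ×ˢ Y, ‖g z.1‖ * ‖g z.2‖ * ‖K z‖) ^ 2 ≤
      (T * N₂) ^ 2 * ∑ z ∈ Y ×ˢ Y, ‖K z‖ ^ 2 := by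
    refine (Finset.sum_mul_sq_le_sq_mul_sq _ _ _).trans ?_
    have : ∑ z ∈ Y ×ˢ Y, (‖g z.1‖ * ‖g z.2‖) ^ 2 = (∑ y ∈ Y, ‖g y‖ ^ 2) ^ 2 := by
      rw [sq (∑ y ∈ Y, ‖g y‖ ^ 2), Finset.sum_mul_sum, Finset.sum_product]
      simp only [mul_pow]
    rw [this]
    gcongr
  have h4 : N₁ ^ 2 * N₂ ^ 2 / T ^ 8 ≤ ∑ z ∈ Y ×ˢ Y, ‖K z‖ ^ 2 := by
    have h5 : N₁ * N₂ ^ 2 / T ^ 3 ≤ ∑ z ∈ Y ×ˢ Y, ‖g z.1‖ * ‖g z.2‖ * ‖K z‖ := by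
      refine le_trans ?_ h2
      have e : (N₁ * N₂ / T) ^ 2 = (T * N₁) * (N₁ * N₂ ^ 2 / T ^ 3) := by field_simp
      rw [e] at h1
      exact le_of_mul_le_mul_left h1 (by positivity)
    have h6 := (pow_le_pow_left₀ (by positivity) h5 2).trans h3
    have e : (N₁ * N₂ ^ 2 / T ^ 3) ^ 2 = (T * N₂) ^ 2 * (N₁ ^ 2 * N₂ ^ 2 / T ^ 8) := by
      field_simp
    rw [e] at h6
    exact le_of_mul_le_mul_left h6 (by positivity)
  have hKn : ∀ z ∈ Y ×ˢ Y, ‖K z‖ ^ 2 ≤ 4 * N₁ ^ 2 := by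
    intro z _
    have : ‖K z‖ ≤ 2 * N₁ := by
      refine (norm_sum_le _ _).trans (le_trans ?_ hn2)
      refine (Finset.sum_le_card_nsmul _ _ 1 fun x _ => ?_).trans (by simp)
      rw [norm_mul, norm_mul, norm_eC, mul_one]
      exact mul_le_one₀ (hcn _ _) (norm_nonneg _) (hcn _ _)
    calc ‖K z‖ ^ 2 ≤ (2 * N₁) ^ 2 := pow_le_pow_left₀ (norm_nonneg _) this 2
      _ = _ := by ring
  have hYc : (#Y : ℝ) ≤ 2 * N₂ := by
    have h1 : Y ⊆ Finset.range (⌊N₂⌋₊ + 1) := fun y hy => by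
      rw [Finset.mem_range, Nat.lt_succ_iff]; exact Nat.le_floor (hY y hy)
    have h2 := Finset.card_le_card h1
    rw [Finset.card_range] at h2
    have h3 : (#Y : ℝ) ≤ ⌊N₂⌋₊ + 1 := by exact_mod_cast h2
    linarith [Nat.floor_le hN₂0.le]
  have hYYc : (#(Y ×ˢ Y) : ℝ) ≤ 4 * N₂ ^ 2 := by
    rw [Finset.card_product]; push_cast
    calc (#Y : ℝ) * #Y ≤ (2 * N₂) * (2 * N₂) := by gcongr
      _ = _ := by ring
  have h7 : N₂ ^ 2 / T ^ 11 ≤ #{z ∈ Y ×ˢ Y | (N₁ / T ^ 6) ^ 2 ≤ ‖K z‖ ^ 2} := by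
    refine card_large_of_sum _ (fun z => ‖K z‖ ^ 2) (B := 4 * N₁ ^ 2) (by positivity) hKn
      (le_trans ?_ h4) (by positivity)
    have hT3 : (8 : ℝ) ≤ T ^ 3 := by
      calc (8 : ℝ) = 2 ^ 3 := by norm_num
        _ ≤ T ^ 3 := pow_le_pow_left₀ (by norm_num) hT 3
    calc _ ≤ 4 * N₂ ^ 2 * (N₁ / T ^ 6) ^ 2 + 4 * N₁ ^ 2 * (N₂ ^ 2 / T ^ 11) := by gcongr
      _ = N₁ ^ 2 * N₂ ^ 2 / T ^ 12 * (4 * (1 + T)) := by field_simp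
      _ ≤ N₁ ^ 2 * N₂ ^ 2 / T ^ 12 * T ^ 4 := by
          gcongr
          have : T ^ 4 = T ^ 3 * T := by ring
          nlinarith
      _ = _ := by field_simp
  obtain ⟨q, hq0, hqT, hqd⟩ := hC₁ (T ^ 12) (two_le_pow hT (by norm_num)) (2 * N₁) N₂
    (by rw [← pow_mul]; linarith) (by rw [← pow_mul]; linarith) θ
    {z ∈ Y ×ˢ Y | (N₁ / T ^ 6) ^ 2 ≤ ‖K z‖ ^ 2} (by
      intro z hz
      have := Finset.mem_product.1 (Finset.mem_filter.1 hz).1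
      exact ⟨hY _ this.1, hY _ this.2⟩) (le_trans (by
        gcongr
        · linarith
        · norm_num) h7) (by
      intro z hz
      have hz2 := (Finset.mem_filter.1 hz).2
      have hz3 := (pow_le_pow_iff_left₀ (by positivity) (norm_nonneg _) two_ne_zero).1 hz2
      obtain ⟨u, v, hv, huv⟩ := exists_eq_Ico_of_ordConnected
        {x ∈ Finset.range n | (a ≤ x * z.1 ∧ x * z.1 < b) ∧ (a ≤ x * z.2 ∧ x * z.2 < b)} n
        (fun x hx => Finset.mem_range.1 (Finset.mem_filter.1 hx).1) (by
          intro x hx w hw y hxy hyw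
          rw [Finset.mem_filter, Finset.mem_range] at *
          refine ⟨by omega, ⟨hx.2.1.1.trans ?_, lt_of_le_of_lt ?_ hw.2.1.2⟩,
            ⟨hx.2.2.1.trans ?_, lt_of_le_of_lt ?_ hw.2.2.2⟩⟩ <;> gcongr)
      refine ⟨u, v, ?_, ?_⟩
      · have : (v : ℝ) ≤ n := by exact_mod_cast hv
        have hu : (0 : ℝ) ≤ u := by positivity
        linarith
      · have e : K z = ∑ x ∈ Finset.Ico u v,
            eC ((θ * ((z.1 : ℝ) ^ j - (z.2 : ℝ) ^ j)) * (x : ℝ) ^ j) := by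
          rw [← huv, Finset.sum_filter, hKdef]
          refine Finset.sum_congr rfl fun x _ => ?_
          by_cases h1 : a ≤ x * z.1 ∧ x * z.1 < b <;> by_cases h2 : a ≤ x * z.2 ∧ x * z.2 < b <;>
            simp [hc, h1, h2]
        rw [← e]
        refine le_trans ?_ hz3
        rw [div_le_div_iff₀ (by positivity) (by positivity)]
        have h6 : 2 ≤ T ^ 6 := two_le_pow hT (by norm_num)
        calc 2 * N₁ * T ^ 6 = N₁ * T ^ 6 * 2 := by ring
          _ ≤ N₁ * T ^ 6 * T ^ 6 := by gcongr
          _ = _ := by ring)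
  rw [← pow_mul] at hqT hqd
  refine ⟨q, hq0, hqT, hqd.trans ?_⟩
  gcongr
  linarith

open ArithmeticFunction in
lemma sum_divisors_moebius (n : ℕ) :
    ∑ d ∈ n.divisors, (moebius d : ℝ) = if n = 1 then 1 else 0 := by
  have h := congrArg (fun f : ArithmeticFunction ℤ => f n) moebius_mul_coe_zeta
  simp only [coe_mul_zeta_apply, one_apply] at h
  have := congrArg (fun x : ℤ => (x : ℝ)) h
  simp only [Int.cast_sum] at this
  rw [this]; split_ifs <;> simp

/-- Squarefree moduli up to `R` coprime to `q`. -/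
def sieveModuli (q R : ℕ) : Finset ℕ := {d ∈ Finset.Icc 1 R | Squarefree d ∧ d.Coprime q}

lemma mem_sieveModuli {q R d : ℕ} :
    d ∈ sieveModuli q R ↔ (1 ≤ d ∧ d ≤ R) ∧ Squarefree d ∧ d.Coprime q := by
  rw [sieveModuli, Finset.mem_filter, Finset.mem_Icc]

lemma mem_sieveModuli_of_dvd {q R d g : ℕ} (hg : g ∈ sieveModuli q R) (hd : d ∣ g) :
    d ∈ sieveModuli q R := by
  rw [mem_sieveModuli] at *
  exact ⟨⟨Nat.pos_of_dvd_of_pos hd hg.1.1, (Nat.le_of_dvd hg.1.1 hd).trans hg.1.2⟩,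
    hg.2.1.squarefree_of_dvd hd, hg.2.2.coprime_dvd_left hd⟩

def sieveMass (q R : ℕ) : ℝ := ∑ f ∈ sieveModuli q R, 1 / (f.totient : ℝ)

def sieveDual (q R f : ℕ) : ℝ :=
  (ArithmeticFunction.moebius f : ℝ) / (f.totient * sieveMass q R)

/-- The Selberg sieve weights. -/
def sieveWeight (q R d : ℕ) : ℝ := d * ∑ g ∈ sieveModuli q R with d ∣ g,
  (ArithmeticFunction.moebius (g / d) : ℝ) * sieveDual q R g

lemma one_le_sieveMass {q R : ℕ} (hR : 1 ≤ R) : 1 ≤ sieveMass q R := by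
  have h1 : 1 ∈ sieveModuli q R := by
    rw [mem_sieveModuli]; simp [hR]
  refine le_trans (by simp) (Finset.single_le_sum (f := fun f : ℕ => 1 / (f.totient : ℝ))
    (fun f _ => by positivity) h1)

lemma sieveWeight_one {q R : ℕ} (hR : 1 ≤ R) : sieveWeight q R 1 = 1 := by
  have hS := one_le_sieveMass (q := q) hR
  have : ∀ g ∈ sieveModuli q R, (ArithmeticFunction.moebius (g / 1) : ℝ) * sieveDual q R g =
      (1 / (g.totient : ℝ)) / sieveMass q R := by
    intro g hg
    rw [sieveDual, Nat.div_one]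
    have h2 : (ArithmeticFunction.moebius g : ℝ) * ArithmeticFunction.moebius g = 1 := by
      have := ArithmeticFunction.moebius_sq_eq_one_of_squarefree (mem_sieveModuli.1 hg).2.1
      rw [sq] at this
      exact_mod_cast this
    rw [← mul_div_assoc, h2, div_div]
  rw [sieveWeight]
  simp only [one_dvd, Finset.filter_true]
  rw [Finset.sum_congr rfl this, ← Finset.sum_div, ← sieveMass, div_self (by linarith)]
  simp

lemma sum_sieveWeight_div {q R f : ℕ} (hf : f ∈ sieveModuli q R) :
    ∑ d ∈ sieveModuli q R with f ∣ d, sieveWeight q R d / d = sieveDual q R f := by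
  have hf1 := (mem_sieveModuli.1 hf).1.1
  have h1 : ∀ d ∈ {d ∈ sieveModuli q R | f ∣ d}, sieveWeight q R d / d =
      ∑ g ∈ sieveModuli q R, if d ∣ g then
        (ArithmeticFunction.moebius (g / d) : ℝ) * sieveDual q R g else 0 := by
    intro d hd
    have hd1 := (mem_sieveModuli.1 (Finset.mem_filter.1 hd).1).1.1
    rw [sieveWeight, mul_div_cancel_left₀ _ (by positivity), Finset.sum_filter]
  rw [Finset.sum_congr rfl h1, Finset.sum_comm]
  have h2 : ∀ g ∈ sieveModuli q R, (∑ d ∈ sieveModuli q R with f ∣ d, if d ∣ g then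
        (ArithmeticFunction.moebius (g / d) : ℝ) * sieveDual q R g else 0) =
      if g = f then sieveDual q R g else 0 := by
    intro g hg
    have hg1 := (mem_sieveModuli.1 hg).1.1
    rw [← Finset.sum_filter, ← Finset.sum_mul]
    by_cases hfg : f ∣ g
    · obtain ⟨m, rfl⟩ := hfg
      have hm : 0 < m := Nat.pos_of_mul_pos_left hg1
      have h3 : ∑ d ∈ {d ∈ sieveModuli q R | f ∣ d} with d ∣ f * m,
          (ArithmeticFunction.moebius (f * m / d) : ℝ) =
          ∑ e ∈ m.divisors, (ArithmeticFunction.moebius e : ℝ) := by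
        refine Finset.sum_nbij' (fun d => f * m / d) (fun e => f * m / e) ?_ ?_ ?_ ?_ ?_
        · intro d hd
          simp only [Finset.mem_filter] at hd
          obtain ⟨⟨-, ⟨c, rfl⟩⟩, hd2⟩ := hd
          have hcm : c ∣ m := (Nat.mul_dvd_mul_iff_left hf1).1 hd2
          rw [Nat.mul_div_mul_left _ _ hf1, Nat.mem_divisors]
          exact ⟨Nat.div_dvd_of_dvd hcm, hm.ne'⟩
        · intro e he
          have he1 := (Nat.mem_divisors.1 he).1
          simp only [Finset.mem_filter]
          have : f * m / e ∣ f * m := Nat.div_dvd_of_dvd (he1.mul_left f)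
          refine ⟨⟨mem_sieveModuli_of_dvd hg this, ?_⟩, this⟩
          rw [Nat.mul_div_assoc _ he1]; exact Nat.dvd_mul_right _ _
        · intro d hd
          simp only [Finset.mem_filter] at hd
          exact Nat.div_div_self hd.2 (by positivity)
        · intro e he
          have he1 := (Nat.mem_divisors.1 he).1
          exact Nat.div_div_self (he1.mul_left f) (by positivity)
        · intro d hd; rfl
      rw [h3, sum_divisors_moebius]
      have : m = 1 ↔ f * m = f := by
        constructor
        · rintro rfl; simp
        · intro h; exact Nat.eq_of_mul_eq_mul_left hf1 (by simpa using h)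
      by_cases hm1 : m = 1
      · rw [if_pos hm1, if_pos (this.1 hm1), one_mul]
      · rw [if_neg hm1, if_neg (fun h => hm1 (this.2 h)), zero_mul]
    · have : {d ∈ {d ∈ sieveModuli q R | f ∣ d} | d ∣ g} = ∅ := by
        refine Finset.filter_eq_empty_iff.2 fun d hd hdg => hfg ?_
        exact (Finset.mem_filter.1 hd).2.trans hdg
      rw [this, Finset.sum_empty, zero_mul, if_neg]
      rintro rfl; exact hfg dvd_rfl
  rw [Finset.sum_congr rfl h2, Finset.sum_ite_eq' , if_pos hf]

lemma abs_sieveWeight_le {q R d : ℕ} (hR : 1 ≤ R) (hd : d ∈ sieveModuli q R) :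
    |sieveWeight q R d| ≤ R := by
  have hS := one_le_sieveMass (q := q) hR
  have hdR : (d : ℝ) ≤ R := by exact_mod_cast (mem_sieveModuli.1 hd).1.2
  have hmu : ∀ n : ℕ, |(ArithmeticFunction.moebius n : ℝ)| ≤ 1 := by
    intro n; exact_mod_cast ArithmeticFunction.abs_moebius_le_one
  have h1 : |∑ g ∈ sieveModuli q R with d ∣ g,
      (ArithmeticFunction.moebius (g / d) : ℝ) * sieveDual q R g| ≤ 1 := by
    refine (Finset.abs_sum_le_sum_abs _ _).trans ?_
    calc _ ≤ ∑ g ∈ sieveModuli q R with d ∣ g, (1 / (g.totient : ℝ)) / sieveMass q R := by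
          refine Finset.sum_le_sum fun g _ => ?_
          rw [abs_mul, sieveDual, abs_div, div_div,
            abs_of_nonneg (show 0 ≤ (g.totient : ℝ) * sieveMass q R by positivity)]
          calc _ ≤ 1 * (1 / (g.totient * sieveMass q R)) := by
                gcongr
                · exact hmu _
                · exact hmu _
            _ = _ := one_mul _
      _ ≤ ∑ g ∈ sieveModuli q R, (1 / (g.totient : ℝ)) / sieveMass q R :=
          Finset.sum_le_sum_of_subset_of_nonneg (Finset.filter_subset _ _)
            fun _ _ _ => by positivity
      _ = 1 := by rw [← Finset.sum_div, ← sieveMass, div_self (by linarith)]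
  rw [sieveWeight, abs_mul, Nat.abs_cast]
  calc _ ≤ (R : ℝ) * 1 := by gcongr
    _ = R := mul_one _

lemma sum_sieveWeight_lcm {q R : ℕ} (hR : 1 ≤ R) :
    ∑ d ∈ sieveModuli q R, ∑ e ∈ sieveModuli q R,
      sieveWeight q R d * sieveWeight q R e / (d.lcm e : ℝ) = 1 / sieveMass q R := by
  have hS := one_le_sieveMass (q := q) hR
  have h1 : ∀ d ∈ sieveModuli q R, ∀ e ∈ sieveModuli q R,
      sieveWeight q R d * sieveWeight q R e / (d.lcm e : ℝ) =
      ∑ f ∈ sieveModuli q R, (f.totient : ℝ) *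
        ((if f ∣ d then sieveWeight q R d / d else 0) *
          (if f ∣ e then sieveWeight q R e / e else 0)) := by
    intro d hd e he
    have hd1 := (mem_sieveModuli.1 hd).1.1
    have he1 := (mem_sieveModuli.1 he).1.1
    have hg : ∑ f ∈ sieveModuli q R with f ∣ d ∧ f ∣ e, (f.totient : ℝ) = (d.gcd e : ℝ) := by
      have := Nat.sum_totient (d.gcd e)
      rw [← this]; push_cast
      refine Finset.sum_congr ?_ fun _ _ => rfl
      ext f
      rw [Finset.mem_filter, Nat.mem_divisors, Nat.dvd_gcd_iff]
      refine ⟨fun h => ⟨h.2, (Nat.gcd_pos_of_pos_left _ hd1).ne'⟩, fun h =>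
        ⟨mem_sieveModuli_of_dvd hd h.1.1, h.1⟩⟩
    have hl : (d.gcd e : ℝ) * (d.lcm e : ℝ) = d * e := by
      exact_mod_cast Nat.gcd_mul_lcm d e
    have hl0 : (d.lcm e : ℝ) ≠ 0 := by
      exact_mod_cast (Nat.lcm_pos hd1 he1).ne'
    have hd0 : (d : ℝ) ≠ 0 := by positivity
    have he0 : (e : ℝ) ≠ 0 := by positivity
    have h2 : ∀ f ∈ sieveModuli q R, (f.totient : ℝ) *
        ((if f ∣ d then sieveWeight q R d / d else 0) *
          (if f ∣ e then sieveWeight q R e / e else 0)) =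
        (if f ∣ d ∧ f ∣ e then (f.totient : ℝ) else 0) *
          (sieveWeight q R d / d * (sieveWeight q R e / e)) := by
      intro f _
      by_cases h1 : f ∣ d <;> by_cases h2 : f ∣ e <;> simp [h1, h2]
    rw [Finset.sum_congr rfl h2, ← Finset.sum_mul, ← Finset.sum_filter, hg]
    field_simp
    linear_combination (-(sieveWeight q R d * sieveWeight q R e)) * hl
  rw [Finset.sum_congr rfl fun d hd => Finset.sum_congr rfl fun e he => h1 d hd e he]
  have h2 : ∑ d ∈ sieveModuli q R, ∑ e ∈ sieveModuli q R, ∑ f ∈ sieveModuli q R,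
      (f.totient : ℝ) * ((if f ∣ d then sieveWeight q R d / d else 0) *
          (if f ∣ e then sieveWeight q R e / e else 0)) =
      ∑ f ∈ sieveModuli q R, (f.totient : ℝ) *
        (∑ d ∈ sieveModuli q R with f ∣ d, sieveWeight q R d / d) ^ 2 := by
    rw [Finset.sum_congr rfl fun d _ => Finset.sum_comm, Finset.sum_comm]
    refine Finset.sum_congr rfl fun f _ => ?_
    rw [sq, Finset.sum_filter, Finset.sum_mul_sum, Finset.mul_sum]
    refine Finset.sum_congr rfl fun d _ => ?_
    rw [Finset.mul_sum]
  rw [h2]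
  have h3 : ∀ f ∈ sieveModuli q R, (f.totient : ℝ) *
        (∑ d ∈ sieveModuli q R with f ∣ d, sieveWeight q R d / d) ^ 2 =
        1 / (f.totient : ℝ) / sieveMass q R ^ 2 := by
    intro f hf
    have hf0 : (f.totient : ℝ) ≠ 0 := by
      exact_mod_cast (Nat.totient_pos.2 (mem_sieveModuli.1 hf).1.1).ne'
    have h2 : (ArithmeticFunction.moebius f : ℝ) ^ 2 = 1 := by
      exact_mod_cast ArithmeticFunction.moebius_sq_eq_one_of_squarefree (mem_sieveModuli.1 hf).2.1
    rw [sum_sieveWeight_div hf, sieveDual, div_pow, h2, mul_pow]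
    field_simp
  rw [Finset.sum_congr rfl h3, ← Finset.sum_div, ← sieveMass]
  field_simp

lemma abs_card_sub_div_le (n q d H : ℕ) (hd : 1 ≤ d) (hdq : d.Coprime q) :
    |(#{i ∈ Finset.range H | d ∣ n + q * i} : ℝ) - H / d| ≤ 1 := by
  have : NeZero d := ⟨by omega⟩
  have hq := ZMod.coe_mul_inv_eq_one q hdq.symm
  obtain ⟨v, hv⟩ : ∃ v : ℕ, v = (-(n : ZMod d) * (q : ZMod d)⁻¹).val := ⟨_, rfl⟩
  have hv' : (v : ZMod d) = -(n : ZMod d) * (q : ZMod d)⁻¹ := by rw [hv, ZMod.natCast_zmod_val]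
  have h1 : #{i ∈ Finset.range H | d ∣ n + q * i} = H.count (· ≡ v [MOD d]) := by
    rw [Nat.count_eq_card_filter_range]
    congr 1
    refine Finset.filter_congr fun i _ => ?_
    rw [← ZMod.natCast_eq_zero_iff, ← ZMod.natCast_eq_natCast_iff, hv']
    push_cast
    constructor
    · intro h
      linear_combination (q : ZMod d)⁻¹ * h - (i : ZMod d) * hq
    · intro h
      linear_combination (q : ZMod d) * h - (n : ZMod d) * hq
  rw [h1, Nat.count_modEq_card _ hd]
  have h2 := Nat.div_add_mod H d
  have h3 := Nat.mod_lt H hd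
  have h2' : (d : ℝ) * (H / d : ℕ) + (H % d : ℕ) = H := by exact_mod_cast h2
  have h3' : ((H % d : ℕ) : ℝ) < d := by exact_mod_cast h3
  have hd0 : (0 : ℝ) < d := by positivity
  have e : (H : ℝ) / d = (H / d : ℕ) + (H % d : ℕ) / d := by
    rw [← h2']; field_simp
  have h4 : ((H % d : ℕ) : ℝ) / d < 1 := by rwa [div_lt_one hd0]
  have h5 : 0 ≤ ((H % d : ℕ) : ℝ) / d := by positivity
  rw [e, abs_le]
  split_ifs <;> constructor <;> push_cast <;> linarith

lemma card_sifted_le (n q R H : ℕ) (hR : 1 ≤ R) :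
    (#{i ∈ Finset.range H | ∃ p : ℕ, p.Prime ∧ R < p ∧ n + q * i = p} : ℝ) ≤
      H / sieveMass q R + (R : ℝ) ^ 4 := by
  set s := {i ∈ Finset.range H | ∃ p : ℕ, p.Prime ∧ R < p ∧ n + q * i = p} with hs
  set w := sieveWeight q R with hw
  set D := sieveModuli q R with hD
  have h1 : (#s : ℝ) ≤ ∑ i ∈ Finset.range H, (∑ d ∈ D with d ∣ n + q * i, w d) ^ 2 := by
    calc (#s : ℝ) = ∑ i ∈ s, (∑ d ∈ D with d ∣ n + q * i, w d) ^ 2 := by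
          rw [Finset.card_eq_sum_ones, Nat.cast_sum]
          refine Finset.sum_congr rfl fun i hi => ?_
          obtain ⟨-, p, hp, hRp, hi⟩ := Finset.mem_filter.1 hi
          have : {d ∈ D | d ∣ n + q * i} = {1} := by
            ext d
            rw [Finset.mem_filter, Finset.mem_singleton, hi, Nat.dvd_prime hp, hD,
              mem_sieveModuli]
            constructor
            · rintro ⟨h, rfl | rfl⟩
              · rfl
              · omega
            · rintro rfl
              simp [hR]
          rw [this, Finset.sum_singleton, hw, sieveWeight_one hR]; simp
      _ ≤ _ := Finset.sum_le_sum_of_subset_of_nonneg (Finset.filter_subset _ _)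
          fun _ _ _ => by positivity
  have h2 : ∑ i ∈ Finset.range H, (∑ d ∈ D with d ∣ n + q * i, w d) ^ 2 =
      ∑ d ∈ D, ∑ e ∈ D, w d * w e * #{i ∈ Finset.range H | d.lcm e ∣ n + q * i} := by
    have : ∀ i ∈ Finset.range H, (∑ d ∈ D with d ∣ n + q * i, w d) ^ 2 =
        ∑ d ∈ D, ∑ e ∈ D, w d * w e * (if d.lcm e ∣ n + q * i then 1 else 0) := by
      intro i _
      rw [sq, Finset.sum_filter, Finset.sum_mul_sum]
      refine Finset.sum_congr rfl fun d _ => Finset.sum_congr rfl fun e _ => ?_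
      by_cases h1 : d ∣ n + q * i <;> by_cases h2 : e ∣ n + q * i <;>
        simp [h1, h2, Nat.lcm_dvd_iff]
    rw [Finset.sum_congr rfl this, Finset.sum_comm]
    refine Finset.sum_congr rfl fun d _ => ?_
    rw [Finset.sum_comm]
    refine Finset.sum_congr rfl fun e _ => ?_
    rw [← Finset.mul_sum, Finset.sum_boole]
  have h3 : ∀ d ∈ D, ∀ e ∈ D, w d * w e * #{i ∈ Finset.range H | d.lcm e ∣ n + q * i} ≤
      H * (w d * w e / (d.lcm e : ℝ)) + (R : ℝ) ^ 2 := by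
    intro d hd e he
    have hd1 := mem_sieveModuli.1 hd
    have he1 := mem_sieveModuli.1 he
    have hc : (d.lcm e).Coprime q :=
      Nat.Coprime.coprime_dvd_left (Nat.lcm_dvd_mul d e) (hd1.2.2.mul_left he1.2.2)
    have h4 := abs_card_sub_div_le n q (d.lcm e) H (Nat.lcm_pos hd1.1.1 he1.1.1) hc
    have h5 : |w d * w e| ≤ (R : ℝ) ^ 2 := by
      rw [abs_mul, sq]
      exact mul_le_mul (abs_sieveWeight_le hR hd) (abs_sieveWeight_le hR he) (abs_nonneg _)
        (by positivity)
    have h6 := abs_mul (w d * w e) (#{i ∈ Finset.range H | d.lcm e ∣ n + q * i} -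
      (H : ℝ) / (d.lcm e : ℕ))
    have h7 : |w d * w e| * |(#{i ∈ Finset.range H | d.lcm e ∣ n + q * i} : ℝ) -
      (H : ℝ) / (d.lcm e : ℕ)| ≤ (R : ℝ) ^ 2 * 1 :=
        mul_le_mul h5 h4 (abs_nonneg _) (by positivity)
    have h8 := le_abs_self (w d * w e * (#{i ∈ Finset.range H | d.lcm e ∣ n + q * i} -
      (H : ℝ) / (d.lcm e : ℕ)))
    have h9 : w d * w e * (#{i ∈ Finset.range H | d.lcm e ∣ n + q * i} : ℝ) =
      w d * w e * (#{i ∈ Finset.range H | d.lcm e ∣ n + q * i} -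
      (H : ℝ) / (d.lcm e : ℕ)) + H * (w d * w e / (d.lcm e : ℝ)) := by ring
    linarith
  have hDc : (#D : ℝ) ≤ R := by
    have : #D ≤ #(Finset.Icc 1 R) := Finset.card_le_card (Finset.filter_subset _ _)
    rw [Nat.card_Icc] at this
    exact_mod_cast this
  calc (#s : ℝ) ≤ _ := h1
    _ = _ := h2
    _ ≤ ∑ d ∈ D, ∑ e ∈ D, (H * (w d * w e / (d.lcm e : ℝ)) + (R : ℝ) ^ 2) :=
        Finset.sum_le_sum fun d hd => Finset.sum_le_sum fun e he => h3 d hd e he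
    _ = H / sieveMass q R + #D * (#D * (R : ℝ) ^ 2) := by
        simp_rw [Finset.sum_add_distrib, ← Finset.mul_sum]
        rw [sum_sieveWeight_lcm hR]
        simp [div_eq_mul_inv]
    _ ≤ H / sieveMass q R + R * (R * (R : ℝ) ^ 2) := by gcongr
    _ = _ := by ring

lemma sum_Icc_one_div_le_one_add_log (q : ℕ) :
    ∑ l ∈ Finset.Icc 1 q, 1 / (l : ℝ) ≤ 1 + Real.log q := by
  have h := harmonic_le_one_add_log q
  rw [harmonic_eq_sum_Icc] at h
  push_cast at h
  simpa [one_div] using h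

lemma log_le_sum_Icc_one_div (q : ℕ) : Real.log q ≤ ∑ l ∈ Finset.Icc 1 q, 1 / (l : ℝ) := by
  have h := log_add_one_le_harmonic q
  rw [harmonic_eq_sum_Icc] at h
  push_cast at h
  rcases Nat.eq_zero_or_pos q with rfl | hq
  · simp
  refine le_trans (Real.log_le_log (by positivity) (by linarith)) (b := Real.log (q + 1)) ?_
  simpa [one_div] using h

lemma sum_Icc_one_div_sq_le (n : ℕ) : ∑ s ∈ Finset.Icc 1 n, 1 / (s : ℝ) ^ 2 ≤ 2 := by
  have : ∀ n : ℕ, ∑ s ∈ Finset.Icc 1 (n + 1), 1 / (s : ℝ) ^ 2 ≤ 2 - 1 / (n + 1 : ℝ) := by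
    intro n
    induction n with
    | zero => norm_num
    | succ n ih =>
      rw [Finset.sum_Icc_succ_top (by omega)]
      have h1 : 1 / ((n + 1 + 1 : ℕ) : ℝ) ^ 2 ≤ 1 / (n + 1 : ℝ) - 1 / ((n + 1 : ℕ) + 1 : ℝ) := by
        push_cast
        rw [div_sub_div _ _ (by positivity) (by positivity),
          div_le_div_iff₀ (by positivity) (by positivity)]
        nlinarith [(Nat.cast_nonneg n : (0 : ℝ) ≤ n)]
      linarith
  rcases n with _ | n
  · simp
  have h2 : 0 ≤ 1 / (n + 1 : ℝ) := by positivity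
  linarith [this n]

lemma log_le_mul_sieveMass (q R : ℕ) (hq : 1 ≤ q) :
    Real.log R ≤ 2 * (1 + Real.log q) * sieveMass q R := by
  set U := Finset.Icc 1 q ×ˢ (sieveModuli q R ×ˢ Finset.Icc 1 R) with hU
  set h : ℕ × (ℕ × ℕ) → ℝ := fun t => 1 / (t.1 : ℝ) * (1 / (t.2.1 : ℝ) * (1 / (t.2.2 : ℝ) ^ 2))
    with hh
  have key : ∀ m : ℕ, ∃ t : ℕ × (ℕ × ℕ), m ∈ Finset.Icc 1 R →
      t ∈ U ∧ t.1 * t.2.1 * t.2.2 ^ 2 = m := by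
    intro m
    by_cases hm : m ∈ Finset.Icc 1 R
    · rw [Finset.mem_Icc] at hm
      obtain ⟨a, b, ha, hb, hab, hsq⟩ := Nat.sq_mul_squarefree_of_pos hm.1
      have hg : 0 < a.gcd q := Nat.gcd_pos_of_pos_left _ ha
      have hga : a.gcd q * (a / a.gcd q) = a := Nat.mul_div_cancel' (Nat.gcd_dvd_left _ _)
      refine ⟨(a.gcd q, a / a.gcd q, b), fun _ => ⟨?_, ?_⟩⟩
      · simp only [hU, Finset.mem_product, Finset.mem_Icc, mem_sieveModuli]
        have hb1 : b ≤ m := by nlinarith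
        have ha1 : a ≤ m := Nat.le_of_dvd hm.1 (hab ▸ Dvd.intro_left _ rfl)
        have hag : a / a.gcd q ≤ a := Nat.div_le_self _ _
        have hag0 : 0 < a / a.gcd q := Nat.div_pos (Nat.le_of_dvd ha (Nat.gcd_dvd_left _ _)) hg
        refine ⟨⟨hg, Nat.le_of_dvd hq (Nat.gcd_dvd_right _ _)⟩, ⟨⟨hag0, by omega⟩, ?_, ?_⟩,
          hb, by omega⟩
        · exact hsq.squarefree_of_dvd (Nat.div_dvd_of_dvd (Nat.gcd_dvd_left _ _))
        · have h1 : (a.gcd q).Coprime (a / a.gcd q) := by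
            rw [← hga] at hsq
            exact Nat.coprime_of_squarefree_mul hsq
          refine Nat.Coprime.symm (Nat.coprime_of_dvd fun p hp hpq hpa => ?_)
          have h2 : p ∣ a := hpa.trans (Nat.div_dvd_of_dvd (Nat.gcd_dvd_left _ _))
          exact Nat.not_coprime_of_dvd_of_dvd hp.one_lt (Nat.dvd_gcd h2 hpq) hpa h1
      · simp only
        rw [hga, ← hab]; ring
    · exact ⟨(0, 0, 0), fun h => absurd h hm⟩
  choose t ht using key
  have h1 : ∑ m ∈ Finset.Icc 1 R, 1 / (m : ℝ) ≤ ∑ u ∈ U, h u := by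
    have : ∀ m ∈ Finset.Icc 1 R, 1 / (m : ℝ) = h (t m) := by
      intro m hm
      have := (ht m hm).2
      have h' : (m : ℝ) = (t m).1 * (t m).2.1 * (t m).2.2 ^ 2 := by exact_mod_cast this.symm
      simp only [hh]
      conv_lhs => rw [h']
      simp only [one_div, mul_inv]
      ring
    rw [Finset.sum_congr rfl this, ← Finset.sum_image (f := h) (g := t)]
    · refine Finset.sum_le_sum_of_subset_of_nonneg ?_ fun _ _ _ => by simp only [hh]; positivity
      intro u hu
      obtain ⟨m, hm, rfl⟩ := Finset.mem_image.1 hu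
      exact (ht m hm).1
    · intro m hm m' hm' e
      rw [← (ht m hm).2, ← (ht m' hm').2, e]
  refine (log_le_sum_Icc_one_div R).trans (h1.trans ?_)
  have h2 : ∑ u ∈ U, h u = (∑ l ∈ Finset.Icc 1 q, 1 / (l : ℝ)) *
      ((∑ f ∈ sieveModuli q R, 1 / (f : ℝ)) * ∑ s ∈ Finset.Icc 1 R, 1 / (s : ℝ) ^ 2) := by
    rw [hU, Finset.sum_product, Finset.sum_mul]
    refine Finset.sum_congr rfl fun l _ => ?_
    rw [Finset.sum_product, Finset.sum_mul_sum, Finset.mul_sum]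
    refine Finset.sum_congr rfl fun f _ => ?_
    rw [Finset.mul_sum]
  have h3 : ∑ f ∈ sieveModuli q R, 1 / (f : ℝ) ≤ sieveMass q R := by
    refine Finset.sum_le_sum fun f hf => ?_
    have := (mem_sieveModuli.1 hf).1.1
    have h4 : (f.totient : ℝ) ≤ f := by exact_mod_cast Nat.totient_le f
    have h5 : (0 : ℝ) < f.totient := by exact_mod_cast Nat.totient_pos.2 this
    gcongr
  have h0 : 0 ≤ sieveMass q R := Finset.sum_nonneg fun _ _ => by positivity
  have hl : 0 ≤ Real.log q := Real.log_natCast_nonneg q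
  rw [h2]
  calc _ ≤ (1 + Real.log q) * (sieveMass q R * 2) := by
        gcongr
        · exact sum_Icc_one_div_le_one_add_log q
        · exact sum_Icc_one_div_sq_le R
    _ = _ := by ring

/-- A Brun–Titchmarsh type bound, valid for all progressions. -/
lemma card_primes_progression_le (n q R H : ℕ) (hq : 1 ≤ q) (hR : 2 ≤ R) :
    (#{i ∈ Finset.range H | ∃ p : ℕ, p.Prime ∧ R < p ∧ n + q * i = p} : ℝ) ≤
      2 * (1 + Real.log q) * H / Real.log R + (R : ℝ) ^ 4 := by
  refine (card_sifted_le n q R H (by omega)).trans ?_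
  have hS := one_le_sieveMass (q := q) (R := R) (by omega)
  have hl : 0 < Real.log R := Real.log_pos (by exact_mod_cast hR)
  have h := log_le_mul_sieveMass q R hq
  refine add_le_add ?_ le_rfl
  rw [div_le_div_iff₀ (by linarith) hl]
  calc H * Real.log R ≤ H * (2 * (1 + Real.log q) * sieveMass q R) := by gcongr
    _ = _ := by ring

lemma norm_sum_Ico_mul_sub_le (w : ℕ → ℝ) (f : ℕ → ℂ) (a b : ℕ) (hab : a ≤ b) (B : ℝ)
    (hB : ∀ c ∈ Finset.Icc a b, ‖∑ n ∈ Finset.Ico a c, f n‖ ≤ B) :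
    ‖∑ n ∈ Finset.Ico a b, (w n : ℂ) * f n - w b * ∑ n ∈ Finset.Ico a b, f n‖ ≤
      (∑ n ∈ Finset.Ico a b, |w (n + 1) - w n|) * B := by
  induction b, hab using Nat.le_induction with
  | base => simp
  | succ b hab ih =>
    rw [Finset.sum_Ico_succ_top hab, Finset.sum_Ico_succ_top hab, Finset.sum_Ico_succ_top hab]
    have h1 := ih fun c hc => hB c (Finset.Icc_subset_Icc_right (Nat.le_succ b) hc)
    have h2 := hB (b + 1) (Finset.mem_Icc.2 ⟨by omega, le_rfl⟩)
    rw [Finset.sum_Ico_succ_top hab] at h2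
    have e : ∑ n ∈ Finset.Ico a b, (w n : ℂ) * f n + w b * f b -
        w (b + 1 : ℕ) * (∑ n ∈ Finset.Ico a b, f n + f b) =
        (∑ n ∈ Finset.Ico a b, (w n : ℂ) * f n - w b * ∑ n ∈ Finset.Ico a b, f n) +
        ((w b - w (b + 1 : ℕ) : ℝ) : ℂ) * (∑ n ∈ Finset.Ico a b, f n + f b) := by
      push_cast; ring
    rw [e]
    refine (norm_add_le _ _).trans ?_
    rw [norm_mul, Complex.norm_real, Real.norm_eq_abs, abs_sub_comm, add_mul]
    gcongr

lemma exists_le_norm_sum_Ico_of_monotone (w : ℕ → ℝ) (hw : Monotone w) (f : ℕ → ℂ) (a b : ℕ)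
    (h0 : 0 ≤ w a) (W : ℝ) (hW : w b ≤ W) :
    ∃ c ≤ b, ‖∑ n ∈ Finset.Ico a b, (w n : ℂ) * f n‖ ≤
      2 * W * ‖∑ n ∈ Finset.Ico a c, f n‖ := by
  rcases le_total b a with hab | hab
  · refine ⟨0, by omega, ?_⟩
    rw [Finset.Ico_eq_empty (by omega), Finset.Ico_eq_empty (by omega)]
    simp
  obtain ⟨c, hc, hmax⟩ := Finset.exists_max_image (Finset.Icc a b)
    (fun c => ‖∑ n ∈ Finset.Ico a c, f n‖) ⟨a, Finset.mem_Icc.2 ⟨le_rfl, hab⟩⟩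
  refine ⟨c, (Finset.mem_Icc.1 hc).2, ?_⟩
  have h1 := norm_sum_Ico_mul_sub_le w f a b hab _ hmax
  have h2 : ∑ n ∈ Finset.Ico a b, |w (n + 1) - w n| = w b - w a := by
    rw [← Finset.sum_Ico_sub w hab]
    exact Finset.sum_congr rfl fun n _ => abs_of_nonneg (sub_nonneg.2 (hw (Nat.le_succ n)))
  rw [h2] at h1
  have h3 := hmax b (Finset.mem_Icc.2 ⟨hab, le_rfl⟩)
  have hwb : 0 ≤ w b := h0.trans (hw hab)
  have h4 : ‖(w b : ℂ) * ∑ n ∈ Finset.Ico a b, f n‖ ≤ w b * ‖∑ n ∈ Finset.Ico a c, f n‖ := by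
    rw [norm_mul, Complex.norm_real, Real.norm_eq_abs, abs_of_nonneg hwb]
    gcongr
  have h5 := norm_sub_norm_le (∑ n ∈ Finset.Ico a b, (w n : ℂ) * f n)
    ((w b : ℂ) * ∑ n ∈ Finset.Ico a b, f n)
  have h6 := norm_nonneg (∑ n ∈ Finset.Ico a c, f n)
  nlinarith

lemma exists_le_norm_sum_Ico_of_antitone (w : ℕ → ℝ) (hw : Antitone w) (h0 : ∀ n, 0 ≤ w n)
    (f : ℕ → ℂ) (a b : ℕ) :
    ∃ c ≤ b, ‖∑ n ∈ Finset.Ico a b, (w n : ℂ) * f n‖ ≤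
      w a * ‖∑ n ∈ Finset.Ico a c, f n‖ := by
  rcases le_total b a with hab | hab
  · refine ⟨0, by omega, ?_⟩
    rw [Finset.Ico_eq_empty (by omega), Finset.Ico_eq_empty (by omega)]
    simp
  obtain ⟨c, hc, hmax⟩ := Finset.exists_max_image (Finset.Icc a b)
    (fun c => ‖∑ n ∈ Finset.Ico a c, f n‖) ⟨a, Finset.mem_Icc.2 ⟨le_rfl, hab⟩⟩
  refine ⟨c, (Finset.mem_Icc.1 hc).2, ?_⟩
  have h1 := norm_sum_Ico_mul_sub_le w f a b hab _ hmax
  have h2 : ∑ n ∈ Finset.Ico a b, |w (n + 1) - w n| = w a - w b := by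
    rw [← neg_sub, ← Finset.sum_Ico_sub w hab, ← Finset.sum_neg_distrib]
    exact Finset.sum_congr rfl fun n _ => abs_of_nonpos (sub_nonpos.2 (hw (Nat.le_succ n)))
  rw [h2] at h1
  have h3 := hmax b (Finset.mem_Icc.2 ⟨hab, le_rfl⟩)
  have h4 : ‖(w b : ℂ) * ∑ n ∈ Finset.Ico a b, f n‖ ≤ w b * ‖∑ n ∈ Finset.Ico a c, f n‖ := by
    rw [norm_mul, Complex.norm_real, Real.norm_eq_abs, abs_of_nonneg (h0 b)]
    exact mul_le_mul_of_nonneg_left h3 (h0 b)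
  have h5 := norm_sub_norm_le (∑ n ∈ Finset.Ico a b, (w n : ℂ) * f n)
    ((w b : ℂ) * ∑ n ∈ Finset.Ico a b, f n)
  linarith

lemma sum_Ico_arithmeticFunction_mul (f g : ArithmeticFunction ℝ) (F : ℕ → ℂ) (a b N : ℕ)
    (ha : 1 ≤ a) (hb : b ≤ N + 1) :
    ∑ n ∈ Finset.Ico a b, ((f * g) n : ℂ) * F n =
      ∑ x ∈ Finset.Icc 1 N, ∑ y ∈ Finset.Icc 1 N with a ≤ x * y ∧ x * y < b,
        (f x : ℂ) * g y * F (x * y) := by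
  have h1 : ∀ n ∈ Finset.Ico a b, ((f * g) n : ℂ) * F n =
      ∑ x ∈ Finset.Icc 1 N, ∑ y ∈ Finset.Icc 1 N,
        if x * y = n then (f x : ℂ) * g y * F (x * y) else 0 := by
    intro n hn
    rw [Finset.mem_Ico] at hn
    have e : n.divisorsAntidiagonal =
        {x ∈ Finset.Icc 1 N ×ˢ Finset.Icc 1 N | x.1 * x.2 = n} := by
      ext ⟨x, y⟩
      simp only [Nat.mem_divisorsAntidiagonal, Finset.mem_filter, Finset.mem_product,
        Finset.mem_Icc]
      constructor
      · rintro ⟨h, h0⟩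
        have hx : 0 < x := Nat.pos_of_ne_zero (by rintro rfl; simp at h; omega)
        have hy : 0 < y := Nat.pos_of_ne_zero (by rintro rfl; simp at h; omega)
        have := Nat.le_mul_of_pos_right x hy
        have := Nat.le_mul_of_pos_left y hx
        exact ⟨⟨⟨hx, by omega⟩, hy, by omega⟩, h⟩
      · rintro ⟨_, h⟩
        exact ⟨h, by omega⟩
    rw [ArithmeticFunction.mul_apply, e, ← Finset.sum_product', ← Finset.sum_filter]
    push_cast
    rw [Finset.sum_mul]
    refine Finset.sum_congr rfl fun x hx => ?_
    rw [(Finset.mem_filter.1 hx).2]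
  rw [Finset.sum_congr rfl h1, Finset.sum_comm]
  refine Finset.sum_congr rfl fun x _ => ?_
  rw [Finset.sum_comm, Finset.sum_filter]
  refine Finset.sum_congr rfl fun y _ => ?_
  rw [Finset.sum_ite_eq]
  simp only [Finset.mem_Ico]

lemma card_filter_dvd_Icc_le (n d : ℕ) :
    (#{m ∈ Finset.Icc 1 n | d ∣ m} : ℝ) ≤ n / d := by
  have : #{m ∈ Finset.Icc 1 n | d ∣ m} = n / d := by
    rw [← Nat.Ioc_filter_dvd_card_eq_div n d]
    rfl
  rw [this]
  exact Nat.cast_div_le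

/-- `∑_{m ≤ n} τ(m)² ≤ n (1 + log n)³`. -/
lemma sum_card_divisors_sq_le (n : ℕ) :
    ∑ m ∈ Finset.Icc 1 n, (#m.divisors : ℝ) ^ 2 ≤ n * (1 + Real.log n) ^ 3 := by
  set I := Finset.Icc 1 n with hI
  have h1 : ∀ m ∈ I, (#m.divisors : ℝ) ^ 2 =
      ∑ d ∈ I, ∑ e ∈ I, if d ∣ m ∧ e ∣ m then (1 : ℝ) else 0 := by
    intro m hm
    have hm' := Finset.mem_Icc.1 hm
    have : (#m.divisors : ℝ) = ∑ d ∈ I, if d ∣ m then (1 : ℝ) else 0 := by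
      rw [Finset.sum_boole]
      congr 2
      ext d
      simp only [Nat.mem_divisors, Finset.mem_filter, hI, Finset.mem_Icc]
      constructor
      · rintro ⟨h, _⟩
        exact ⟨⟨Nat.pos_of_dvd_of_pos h hm'.1, (Nat.le_of_dvd hm'.1 h).trans hm'.2⟩, h⟩
      · rintro ⟨_, h⟩
        exact ⟨h, by omega⟩
    rw [this, sq, Finset.sum_mul_sum]
    refine Finset.sum_congr rfl fun d _ => Finset.sum_congr rfl fun e _ => ?_
    by_cases h1 : d ∣ m <;> by_cases h2 : e ∣ m <;> simp [h1, h2]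
  have h2 : ∀ d ∈ I, ∀ e ∈ I, (∑ m ∈ I, if d ∣ m ∧ e ∣ m then (1 : ℝ) else 0) ≤
      ∑ g ∈ I, if g ∣ d ∧ g ∣ e then n * (g : ℝ) * (1 / d) * (1 / e) else 0 := by
    intro d hd e he
    have hd' := Finset.mem_Icc.1 hd
    have he' := Finset.mem_Icc.1 he
    have hd0 : (0 : ℝ) < d := by exact_mod_cast hd'.1
    have he0 : (0 : ℝ) < e := by exact_mod_cast he'.1
    have hg0 : 0 < d.gcd e := Nat.gcd_pos_of_pos_left _ hd'.1
    have hgI : d.gcd e ∈ I := Finset.mem_Icc.2 ⟨hg0,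
      (Nat.le_of_dvd hd'.1 (Nat.gcd_dvd_left _ _)).trans hd'.2⟩
    have hl0 : 0 < d.lcm e := Nat.lcm_pos hd'.1 he'.1
    rw [Finset.sum_boole]
    have e1 : {m ∈ I | d ∣ m ∧ e ∣ m} = {m ∈ I | d.lcm e ∣ m} :=
      Finset.filter_congr fun m _ => Nat.lcm_dvd_iff.symm
    rw [e1]
    refine (card_filter_dvd_Icc_le n _).trans ?_
    have e2 : (n : ℝ) / (d.lcm e : ℕ) = n * (d.gcd e : ℕ) * (1 / d) * (1 / e) := by
      have h := Nat.gcd_mul_lcm d e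
      have h' : ((d.gcd e : ℕ) : ℝ) * (d.lcm e : ℕ) = d * e := by exact_mod_cast h
      have : (0 : ℝ) < (d.lcm e : ℕ) := by exact_mod_cast hl0
      field_simp
      linear_combination -(n : ℝ) * h'
    rw [e2]
    refine le_trans (le_of_eq ?_) (Finset.single_le_sum (f := fun g : ℕ =>
      if g ∣ d ∧ g ∣ e then n * (g : ℝ) * (1 / d) * (1 / e) else 0) (fun g _ => ?_) hgI)
    · rw [if_pos ⟨Nat.gcd_dvd_left _ _, Nat.gcd_dvd_right _ _⟩]
    · split_ifs <;> positivity
  have hL : ∀ g ∈ I, (∑ d ∈ I, if g ∣ d then 1 / (d : ℝ) else 0) ≤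
      1 / (g : ℝ) * (1 + Real.log n) := by
    intro g hg
    have hg' := Finset.mem_Icc.1 hg
    refine le_trans ?_ (mul_le_mul_of_nonneg_left (sum_Icc_one_div_le_one_add_log n)
      (by positivity))
    rw [← Finset.sum_filter, Finset.mul_sum]
    have : {d ∈ I | g ∣ d} ⊆ I.image (g * ·) := by
      intro d hd
      obtain ⟨hd, c, rfl⟩ := Finset.mem_filter.1 hd
      refine Finset.mem_image.2 ⟨c, ?_, rfl⟩
      have := Finset.mem_Icc.1 hd
      refine Finset.mem_Icc.2 ⟨Nat.pos_of_ne_zero ?_, ?_⟩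
      · rintro rfl
        simp at this
      · nlinarith
    refine (Finset.sum_le_sum_of_subset_of_nonneg this fun _ _ _ => by positivity).trans ?_
    refine (Finset.sum_image_le_of_nonneg fun _ _ => by positivity).trans (le_of_eq ?_)
    refine Finset.sum_congr rfl fun d _ => ?_
    push_cast
    rw [one_div_mul_one_div]
  have hlog : 0 ≤ Real.log n := Real.log_natCast_nonneg n
  calc ∑ m ∈ I, (#m.divisors : ℝ) ^ 2
      = ∑ d ∈ I, ∑ e ∈ I, ∑ m ∈ I, (if d ∣ m ∧ e ∣ m then (1 : ℝ) else 0) := by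
        rw [Finset.sum_congr rfl h1, Finset.sum_comm]
        exact Finset.sum_congr rfl fun d _ => Finset.sum_comm
    _ ≤ ∑ d ∈ I, ∑ e ∈ I, ∑ g ∈ I,
          (if g ∣ d ∧ g ∣ e then n * (g : ℝ) * (1 / d) * (1 / e) else 0) :=
        Finset.sum_le_sum fun d hd => Finset.sum_le_sum fun e he => h2 d hd e he
    _ = ∑ g ∈ I, n * g * ((∑ d ∈ I, if g ∣ d then 1 / (d : ℝ) else 0) *
          ∑ e ∈ I, if g ∣ e then 1 / (e : ℝ) else 0) := by
        rw [Finset.sum_congr rfl fun d _ => Finset.sum_comm, Finset.sum_comm]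
        refine Finset.sum_congr rfl fun g _ => ?_
        rw [Finset.sum_mul_sum, Finset.mul_sum]
        refine Finset.sum_congr rfl fun d _ => ?_
        rw [Finset.mul_sum]
        refine Finset.sum_congr rfl fun e _ => ?_
        by_cases h1 : g ∣ d <;> by_cases h2 : g ∣ e <;> simp [h1, h2]
        ring
    _ ≤ ∑ g ∈ I, n * g * ((1 / (g : ℝ) * (1 + Real.log n)) * (1 / (g : ℝ) * (1 + Real.log n))) := by
        refine Finset.sum_le_sum fun g hg => ?_
        have h0 : 0 ≤ ∑ d ∈ I, if g ∣ d then 1 / (d : ℝ) else 0 :=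
          Finset.sum_nonneg fun d _ => by split_ifs <;> positivity
        have := hL g hg
        gcongr
    _ = n * (1 + Real.log n) ^ 2 * ∑ g ∈ I, 1 / (g : ℝ) := by
        rw [Finset.mul_sum]
        refine Finset.sum_congr rfl fun g hg => ?_
        have : (0 : ℝ) < g := by exact_mod_cast (Finset.mem_Icc.1 hg).1
        field_simp
    _ ≤ n * (1 + Real.log n) ^ 2 * (1 + Real.log n) := by
        gcongr
        exact sum_Icc_one_div_le_one_add_log n
    _ = _ := by ring

/-- The restriction of an arithmetic function to `n ≤ V`. -/
def truncLE (V : ℕ) (f : ArithmeticFunction ℝ) : ArithmeticFunction ℝ :=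
  ⟨fun n => if n ≤ V then f n else 0, by simp⟩

lemma truncLE_apply (V : ℕ) (f : ArithmeticFunction ℝ) (n : ℕ) :
    truncLE V f n = if n ≤ V then f n else 0 := rfl

open ArithmeticFunction in
/-- Vaughan's identity. -/
lemma vonMangoldt_eq_vaughan (V : ℕ) :
    (vonMangoldt : ArithmeticFunction ℝ) = truncLE V vonMangoldt +
      truncLE V (moebius : ArithmeticFunction ℝ) * log -
      (truncLE V (moebius : ArithmeticFunction ℝ) * truncLE V vonMangoldt) * zeta +
      (vonMangoldt - truncLE V vonMangoldt) *
        (((moebius : ArithmeticFunction ℝ) - truncLE V (moebius : ArithmeticFunction ℝ)) *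
          zeta) := by
  have h1 := vonMangoldt_mul_zeta
  have h2 : ((moebius : ArithmeticFunction ℝ) * (zeta : ArithmeticFunction ℝ)) = 1 :=
    coe_moebius_mul_coe_zeta
  linear_combination (vonMangoldt - truncLE V vonMangoldt) * h2 * (-1) +
    truncLE V (moebius : ArithmeticFunction ℝ) * h1

lemma typeI_inverse (j : ℕ) (hj : 1 ≤ j) (A : ℕ) : ∃ C : ℕ, ∀ T : ℝ, 2 ≤ T → ∀ N : ℕ,
    T ^ C ≤ N → Real.log N ≤ T → ∀ (c w : ArithmeticFunction ℝ) (D : ℕ), (D : ℝ) ≤ T ^ A →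
      (∀ d, |c d| ≤ T) → (∀ d, D < d → c d = 0) → Monotone w → w (N + 1) ≤ 2 * T →
      ∀ (α : ℝ) (a b : ℕ), 1 ≤ a → b ≤ N + 1 →
        N / T ≤ ‖∑ n ∈ Finset.Ico a b, ((c * w) n : ℂ) * eC (α * (n : ℝ) ^ j)‖ →
        ∃ q : ℕ, 0 < q ∧ (q : ℝ) ≤ T ^ C ∧ dZ (q * α) ≤ T ^ C / (N : ℝ) ^ j := by
  obtain ⟨C₁, hC₁⟩ := weyl_inverse_pow_nat j hj
  refine ⟨8 * C₁ + A * j + A, fun T hT N hN hlog c w D hD hc hcD hw hwN α a b ha hb h => ?_⟩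
  have hT0 : 0 < T := by linarith
  have hNA : T ^ A ≤ N := (pow_le_pow_of_two_le hT (by omega)).trans hN
  have hN1 : (1 : ℝ) ≤ N := (one_le_pow_of_two_le hT _).trans hN
  have hN0 : (0 : ℝ) < N := by linarith
  have hDN : D ≤ N := by exact_mod_cast hD.trans hNA
  set F : ℕ → ℂ := fun n => eC (α * (n : ℝ) ^ j) with hF
  rw [sum_Ico_arithmeticFunction_mul c w F a b N ha hb] at h
  have h1 : ∀ d ∈ Finset.Icc 1 N, ∃ m : ℕ, m ≤ b ⌈/⌉ d ∧
      ‖∑ y ∈ Finset.Icc 1 N with a ≤ d * y ∧ d * y < b, (c d : ℂ) * w y * F (d * y)‖ ≤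
        |c d| * (4 * T * ‖∑ y ∈ Finset.Ico (a ⌈/⌉ d) m, F (d * y)‖) := by
    intro d hd
    have hd0 : 0 < d := (Finset.mem_Icc.1 hd).1
    have e : {y ∈ Finset.Icc 1 N | a ≤ d * y ∧ d * y < b} = Finset.Ico (a ⌈/⌉ d) (b ⌈/⌉ d) := by
      ext y
      rw [Finset.mem_filter, Finset.mem_Icc, Finset.mem_Ico, ceilDiv_le_iff_le_mul hd0,
        ← not_le (a := b ⌈/⌉ d), ceilDiv_le_iff_le_mul hd0]
      constructor
      · rintro ⟨_, h1, h2⟩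
        exact ⟨h1, by omega⟩
      · rintro ⟨h1, h2⟩
        have hy : 0 < y := Nat.pos_of_ne_zero (by rintro rfl; omega)
        have := Nat.le_mul_of_pos_left y hd0
        exact ⟨⟨hy, by omega⟩, h1, by omega⟩
    have hbN : b ⌈/⌉ d ≤ N + 1 := by
      rw [ceilDiv_le_iff_le_mul hd0]
      nlinarith
    obtain ⟨m, hm, h2⟩ := exists_le_norm_sum_Ico_of_monotone w hw (fun y => F (d * y))
      (a ⌈/⌉ d) (b ⌈/⌉ d) (by rw [← w.map_zero]; exact hw (Nat.zero_le _)) (2 * T)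
      ((hw hbN).trans hwN)
    refine ⟨m, hm, ?_⟩
    rw [e]
    simp_rw [mul_assoc]
    rw [← Finset.mul_sum, norm_mul, Complex.norm_real, Real.norm_eq_abs]
    gcongr
    calc _ ≤ _ := h2
      _ = _ := by ring
  choose! m hm hmle using h1
  by_contra hcon
  have hsmall : ∀ d ∈ Finset.Icc 1 D,
      ‖∑ y ∈ Finset.Ico (a ⌈/⌉ d) (m d), F (d * y)‖ ≤ N / d / T ^ 8 := by
    intro d hd
    by_contra hlt
    refine hcon ?_
    have hd1 := Finset.mem_Icc.1 hd
    have hd0 : 0 < d := hd1.1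
    have hdN : d ≤ N := hd1.2.trans hDN
    have hd0' : (0 : ℝ) < d := by exact_mod_cast hd0
    have hdT : (d : ℝ) ≤ T ^ A := le_trans (by exact_mod_cast hd1.2) hD
    have hmd := hm d (Finset.mem_Icc.2 ⟨hd0, hdN⟩)
    obtain ⟨q, hq0, hqT, hqα⟩ := hC₁ (T ^ 8) (two_le_pow hT (by norm_num)) (N / d)
      (by rw [le_div_iff₀ hd0']; simpa using (by exact_mod_cast hdN : (d : ℝ) ≤ N))
      (α * (d : ℝ) ^ j) (a ⌈/⌉ d) (m d) (by
        rw [le_div_iff₀ hd0']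
        have h1 : 1 ≤ a ⌈/⌉ d := by
          by_contra h0
          have := (ceilDiv_le_iff_le_mul hd0).1 (by omega : a ⌈/⌉ d ≤ 0)
          omega
        have h2 : b ⌈/⌉ d ≤ N / d + 1 := by
          rw [ceilDiv_le_iff_le_mul hd0]
          have := Nat.div_add_mod N d
          have := Nat.mod_lt N hd0
          nlinarith
        have h3 : (m d : ℝ) - (a ⌈/⌉ d : ℕ) ≤ (N / d : ℕ) := by
          have : m d ≤ N / d + a ⌈/⌉ d := by omega
          have : (m d : ℝ) ≤ (N / d : ℕ) + (a ⌈/⌉ d : ℕ) := by exact_mod_cast this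
          linarith
        have h4 : ((N / d : ℕ) : ℝ) * d ≤ N := by exact_mod_cast Nat.div_mul_le_self N d
        nlinarith) (by
        refine (not_le.1 hlt).le.trans (le_of_eq ?_)
        congr 1
        refine Finset.sum_congr rfl fun y _ => ?_
        simp only [hF]
        push_cast
        rw [mul_pow, mul_assoc])
    rw [← pow_mul] at hqT hqα
    refine ⟨q * d ^ j, by positivity, ?_, ?_⟩
    · push_cast
      calc (q : ℝ) * d ^ j ≤ T ^ (8 * C₁) * (T ^ A) ^ j := by gcongr
        _ = T ^ (8 * C₁ + A * j) := by rw [← pow_mul, ← pow_add]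
        _ ≤ _ := pow_le_pow_of_two_le hT (by omega)
    · push_cast
      have e : (q : ℝ) * d ^ j * α = q * (α * d ^ j) := by ring
      rw [e]
      refine hqα.trans ?_
      calc T ^ (8 * C₁) / ((N : ℝ) / d) ^ j = T ^ (8 * C₁) * (d : ℝ) ^ j / (N : ℝ) ^ j := by
            rw [div_pow]; field_simp
        _ ≤ T ^ (8 * C₁) * (T ^ A) ^ j / (N : ℝ) ^ j := by gcongr
        _ = T ^ (8 * C₁ + A * j) / (N : ℝ) ^ j := by rw [← pow_mul, ← pow_add]
        _ ≤ _ := by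
          have := pow_le_pow_of_two_le hT (show 8 * C₁ + A * j ≤ 8 * C₁ + A * j + A by omega)
          gcongr
  have hbound : ∀ d ∈ Finset.Icc 1 N,
      ‖∑ y ∈ Finset.Icc 1 N with a ≤ d * y ∧ d * y < b, (c d : ℂ) * w y * F (d * y)‖ ≤
        if d ∈ Finset.Icc 1 D then 4 * N / T ^ 6 * (1 / (d : ℝ)) else 0 := by
    intro d hd
    refine (hmle d hd).trans ?_
    split_ifs with hdD
    · calc |c d| * (4 * T * ‖∑ y ∈ Finset.Ico (a ⌈/⌉ d) (m d), F (d * y)‖)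
          ≤ T * (4 * T * (N / d / T ^ 8)) := by
            gcongr
            · exact hc d
            · exact hsmall d hdD
        _ = _ := by field_simp
    · rw [hcD d (by
        have := (Finset.mem_Icc.1 hd).1
        by_contra h
        exact hdD (Finset.mem_Icc.2 ⟨this, by omega⟩))]
      simp
  have h2 := h.trans ((norm_sum_le _ _).trans (Finset.sum_le_sum hbound))
  rw [← Finset.sum_filter] at h2
  have e : {d ∈ Finset.Icc 1 N | d ∈ Finset.Icc 1 D} = Finset.Icc 1 D := by
    ext d
    simp only [Finset.mem_filter, Finset.mem_Icc]
    omega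
  rw [e, ← Finset.mul_sum] at h2
  have h3 : ∑ d ∈ Finset.Icc 1 D, 1 / (d : ℝ) ≤ 2 * T := by
    refine (sum_Icc_one_div_le_one_add_log D).trans ?_
    rcases Nat.eq_zero_or_pos D with rfl | hD0
    · simp; linarith
    have : Real.log D ≤ Real.log N :=
      Real.log_le_log (by exact_mod_cast hD0) (by exact_mod_cast hDN)
    linarith
  have h4 : (N : ℝ) / T ≤ 4 * N / T ^ 6 * (2 * T) :=
    h2.trans (mul_le_mul_of_nonneg_left h3 (by positivity))
  have h5 : 4 * (N : ℝ) / T ^ 6 * (2 * T) = N / T * (8 / T ^ 4) := by field_simp; norm_num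
  have h6 : 8 / T ^ 4 < 1 := by
    rw [div_lt_one (by positivity)]
    linarith [pow_le_pow_left₀ (by norm_num) hT 4]
  have h7 : 0 < (N : ℝ) / T := by positivity
  nlinarith

lemma typeII_inverse (j : ℕ) (hj : 1 ≤ j) : ∃ C : ℕ, ∀ T : ℝ, 2 ≤ T → ∀ N V : ℕ, 1 ≤ N →
    T ^ C ≤ V → Real.log N ≤ T → ∀ f g : ArithmeticFunction ℝ,
      (∀ n ≤ N, |f n| ≤ T) → (∀ n ≤ V, f n = 0) →
      (∀ n ≤ N, ∑ m ∈ Finset.Icc 1 n, g m ^ 2 ≤ n * (2 * T) ^ 3) → (∀ n ≤ V, g n = 0) →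
      ∀ (α : ℝ) (a b : ℕ), 1 ≤ a → b ≤ N + 1 →
        N / T ≤ ‖∑ n ∈ Finset.Ico a b, ((f * g) n : ℂ) * eC (α * (n : ℝ) ^ j)‖ →
        ∃ q : ℕ, 0 < q ∧ (q : ℝ) ≤ T ^ C ∧ dZ (q * α) ≤ T ^ C / (N : ℝ) ^ j := by
  obtain ⟨C₁, hC₁⟩ := bilinear_inverse j hj
  refine ⟨6 * C₁, fun T hT N V hN hV hlog f g hf hfV hg hgV α a b ha hb h => ?_⟩
  have hT0 : 0 < T := by linarith
  have hN0 : (0 : ℝ) < N := by exact_mod_cast hN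
  set F : ℕ → ℂ := fun n => eC (α * (n : ℝ) ^ j) with hF
  rw [sum_Ico_arithmeticFunction_mul f g F a b N ha hb] at h
  set G : ℕ → ℂ := fun x =>
    ∑ y ∈ Finset.Icc 1 N with a ≤ x * y ∧ x * y < b, (f x : ℂ) * g y * F (x * y) with hG
  set K := Finset.range (Nat.log 2 N + 1) with hK
  have hmaps : ∀ x ∈ Finset.Icc 1 N, Nat.log 2 x ∈ K := fun x hx =>
    Finset.mem_range.2 (Nat.lt_succ_of_le (Nat.log_mono_right (Finset.mem_Icc.1 hx).2))
  have h2 := Finset.sum_fiberwise_of_maps_to hmaps G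
  rw [← h2] at h
  have hKc : (#K : ℝ) ≤ T ^ 3 := by
    rw [hK, Finset.card_range]
    push_cast
    have h3 : ((Nat.log 2 N : ℕ) : ℝ) * Real.log 2 ≤ Real.log N := by
      rw [← Real.log_pow]
      refine Real.log_le_log (by positivity) ?_
      exact_mod_cast Nat.pow_log_le_self 2 (by omega)
    have h4 := Real.log_two_gt_d9
    nlinarith [pow_le_pow_left₀ (by norm_num) hT 2, (Nat.log 2 N).cast_nonneg (α := ℝ)]
  obtain ⟨i, hi, hbig⟩ : ∃ i ∈ K, N / T ^ 4 ≤ ‖∑ x ∈ Finset.Icc 1 N with Nat.log 2 x = i, G x‖ := by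
    by_contra! hcon
    have h3 := (h.trans (norm_sum_le _ _)).trans_lt (Finset.sum_lt_sum_of_nonempty
      ⟨0, Finset.mem_range.2 (by omega)⟩ hcon)
    rw [Finset.sum_const, nsmul_eq_mul] at h3
    have h4 : (#K : ℝ) * (N / T ^ 4) ≤ T ^ 3 * (N / T ^ 4) := by gcongr
    have h5 : T ^ 3 * (N / T ^ 4) = N / T := by field_simp
    linarith
  set X := {x ∈ Finset.Icc 1 N | Nat.log 2 x = i} with hX
  set Y := Finset.Icc 1 (N / 2 ^ i) with hY
  have hXb : ∀ x ∈ X, 2 ^ i ≤ x ∧ x < 2 ^ (i + 1) := by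
    intro x hx
    obtain ⟨hx', hxi⟩ := Finset.mem_filter.1 hx
    rw [Finset.mem_Icc] at hx'
    rw [← hxi]
    exact ⟨Nat.pow_log_le_self 2 (by omega),
      Nat.lt_pow_succ_log_self (by norm_num) x⟩
  have hGY : ∀ x ∈ X, G x =
      ∑ y ∈ Y with a ≤ x * y ∧ x * y < b, (f x : ℂ) * g y * F (x * y) := by
    intro x hx
    simp only [hG]
    congr 1
    ext y
    simp only [hY, Finset.mem_filter, Finset.mem_Icc]
    have h3 := (hXb x hx).1
    have h4 := Nat.div_le_self N (2 ^ i)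
    constructor
    · rintro ⟨⟨h5, h6⟩, h7, h8⟩
      refine ⟨⟨h5, ?_⟩, h7, h8⟩
      rw [Nat.le_div_iff_mul_le (by positivity)]
      nlinarith
    · rintro ⟨⟨h5, h6⟩, h7, h8⟩
      exact ⟨⟨h5, by omega⟩, h7, h8⟩
  rw [Finset.sum_congr rfl hGY] at hbig
  have hpos : 0 < ‖∑ x ∈ X, ∑ y ∈ Y with a ≤ x * y ∧ x * y < b, (f x : ℂ) * g y * F (x * y)‖ :=
    lt_of_lt_of_le (by positivity) hbig
  obtain ⟨x, hx, hxne⟩ := Finset.exists_ne_zero_of_sum_ne_zero (norm_pos_iff.1 hpos)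
  obtain ⟨y, hy, hyne⟩ := Finset.exists_ne_zero_of_sum_ne_zero hxne
  have hxV : V < x := by
    by_contra hle
    rw [hfV x (by omega)] at hyne
    simp at hyne
  have hyV : V < y := by
    by_contra hle
    rw [hgV y (by omega)] at hyne
    simp at hyne
  have hYb : ∀ y ∈ Y, (y : ℝ) ≤ N / 2 ^ i := by
    intro y hy
    have h3 : (y : ℝ) ≤ (N / 2 ^ i : ℕ) := by exact_mod_cast (Finset.mem_Icc.1 hy).2
    refine h3.trans (Nat.cast_div_le.trans (le_of_eq ?_))
    push_cast; rfl
  have hN₁ : (T ^ 6) ^ C₁ ≤ (2 : ℝ) ^ (i + 1) := by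
    rw [← pow_mul]
    have : (x : ℝ) ≤ 2 ^ (i + 1) := by exact_mod_cast (hXb x hx).2.le
    exact hV.trans (le_trans (by exact_mod_cast hxV.le) this)
  have hN₂ : (T ^ 6) ^ C₁ ≤ (N : ℝ) / 2 ^ i := by
    rw [← pow_mul]
    exact hV.trans (le_trans (by exact_mod_cast hyV.le) (hYb y (Finset.mem_filter.1 hy).1))
  have hprod : (2 : ℝ) ^ (i + 1) * (N / 2 ^ i) = 2 * N := by
    rw [pow_succ]; field_simp
  have hT6 : 2 * T ^ 4 ≤ T ^ 6 :=
    (two_mul_pow_le hT 4).trans (pow_le_pow_of_two_le hT (by norm_num))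
  obtain ⟨q, hq0, hqT, hq⟩ := hC₁ (T ^ 6) (two_le_pow hT (by norm_num)) (2 ^ (i + 1)) (N / 2 ^ i)
    hN₁ hN₂ α X Y (fun x => (f x : ℂ)) (fun y => (g y : ℂ)) a b
    (fun x hx => by exact_mod_cast (hXb x hx).2.le) hYb (by
      calc ∑ x ∈ X, ‖(f x : ℂ)‖ ^ 2 ≤ ∑ x ∈ X, T ^ 2 := by
            refine Finset.sum_le_sum fun x hx => ?_
            rw [Complex.norm_real, Real.norm_eq_abs]
            have := hf x (Finset.mem_Icc.1 (Finset.mem_filter.1 hx).1).2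
            gcongr
        _ = T ^ 2 * #X := by rw [Finset.sum_const, nsmul_eq_mul, mul_comm]
        _ ≤ T ^ 6 * 2 ^ (i + 1) := by
            have h3 : #X ≤ 2 ^ (i + 1) := by
              have : X ⊆ Finset.range (2 ^ (i + 1)) := fun x hx =>
                Finset.mem_range.2 (hXb x hx).2
              simpa using Finset.card_le_card this
            have h4 : (#X : ℝ) ≤ 2 ^ (i + 1) := by exact_mod_cast h3
            have h5 : T ^ 2 ≤ T ^ 6 := pow_le_pow_of_two_le hT (by norm_num)
            gcongr) (by
      have h3 := hg (N / 2 ^ i) (Nat.div_le_self _ _)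
      have h4 : ((N / 2 ^ i : ℕ) : ℝ) ≤ (N : ℝ) / 2 ^ i :=
        Nat.cast_div_le.trans (le_of_eq (by push_cast; rfl))
      have h5 : (2 * T) ^ 3 ≤ T ^ 6 := by
        calc (2 * T) ^ 3 ≤ (T * T) ^ 3 := by gcongr
          _ = T ^ 6 := by ring
      calc ∑ y ∈ Y, ‖(g y : ℂ)‖ ^ 2 = ∑ y ∈ Y, g y ^ 2 := by
            refine Finset.sum_congr rfl fun y _ => ?_
            rw [Complex.norm_real, Real.norm_eq_abs, sq_abs]
        _ ≤ _ := h3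
        _ ≤ (N : ℝ) / 2 ^ i * T ^ 6 := by gcongr
        _ = _ := by ring) (by
      rw [hprod]
      calc 2 * (N : ℝ) / T ^ 6 ≤ 2 * (N : ℝ) / (2 * T ^ 4) := by gcongr
        _ = N / T ^ 4 := by field_simp
        _ ≤ _ := hbig
        _ = _ := by
          congr 1
          refine Finset.sum_congr rfl fun x _ => Finset.sum_congr rfl fun y _ => ?_
          simp only [hF]
          push_cast
          rw [mul_pow])
  rw [← pow_mul] at hqT hq
  refine ⟨q, hq0, hqT, hq.trans ?_⟩
  rw [hprod]
  gcongr
  linarith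

lemma arithmeticFunction_sub_apply (f g : ArithmeticFunction ℝ) (n : ℕ) :
    (f - g) n = f n - g n := by
  rw [sub_eq_add_neg, ArithmeticFunction.add_apply, sub_eq_add_neg]
  rfl

open ArithmeticFunction in
/-- Vinogradov's estimate for exponential sums over the von Mangoldt function, inverse form. -/
lemma vonMangoldt_weyl_inverse (j : ℕ) (hj : 1 ≤ j) : ∃ C : ℕ, ∀ T : ℝ, 2 ≤ T → ∀ N : ℕ,
    T ^ C ≤ N → Real.log N ≤ T → ∀ (α : ℝ) (a b : ℕ), 1 ≤ a → b ≤ N + 1 →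
      N / T ≤ ‖∑ n ∈ Finset.Ico a b, (vonMangoldt n : ℂ) * eC (α * (n : ℝ) ^ j)‖ →
      ∃ q : ℕ, 0 < q ∧ (q : ℝ) ≤ T ^ C ∧ dZ (q * α) ≤ T ^ C / (N : ℝ) ^ j := by
  obtain ⟨C₂, hC₂⟩ := typeII_inverse j hj
  obtain ⟨E, hE⟩ : ∃ E, E = 3 * C₂ + 1 := ⟨_, rfl⟩
  obtain ⟨C₁, hC₁⟩ := typeI_inverse j hj (2 * E)
  refine ⟨3 * C₁ + 3 * C₂ + 2 * E + 4, fun T hT N hN hlog α a b ha hb h => ?_⟩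
  have hT0 : 0 < T := by linarith
  have hN1 : (1 : ℝ) ≤ N := (one_le_pow_of_two_le hT _).trans hN
  have hN0 : (0 : ℝ) < N := by linarith
  have hN1' : 1 ≤ N := by exact_mod_cast hN1
  set V := ⌈T ^ (3 * C₂)⌉₊ with hV
  have hVl : (T ^ 3) ^ C₂ ≤ V := by rw [← pow_mul]; exact Nat.le_ceil _
  have hVu : (V : ℝ) ≤ T ^ E := by
    have h1 := Nat.ceil_lt_add_one (pow_pos hT0 (3 * C₂)).le
    have h2 := two_mul_pow_le hT (3 * C₂)
    have h3 := one_le_pow_of_two_le hT (3 * C₂)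
    rw [hE]
    linarith
  have hV1 : 1 ≤ V := Nat.one_le_iff_ne_zero.2 (by
    have := Nat.ceil_pos.2 (pow_pos hT0 (3 * C₂)); omega)
  have hVV : ((V * V : ℕ) : ℝ) ≤ T ^ (2 * E) := by
    push_cast
    calc (V : ℝ) * V ≤ T ^ E * T ^ E := by gcongr
      _ = _ := by rw [← pow_add]; congr 1; ring
  have hVN : V * V ≤ N := by
    exact_mod_cast hVV.trans ((pow_le_pow_of_two_le hT (by omega)).trans hN)
  have hVN' : V ≤ N := by nlinarith
  set F : ℕ → ℂ := fun n => eC (α * (n : ℝ) ^ j) with hF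
  have hlogle : ∀ n ≤ N, Real.log n ≤ T := by
    intro n hn
    rcases Nat.eq_zero_or_pos n with rfl | hn0
    · simp; exact hT0.le
    · exact (Real.log_le_log (by exact_mod_cast hn0) (by exact_mod_cast hn)).trans hlog
  have hΛ : ∀ n ≤ N, |(vonMangoldt n : ℝ)| ≤ T := by
    intro n hn
    rw [abs_of_nonneg vonMangoldt_nonneg]
    exact vonMangoldt_le_log.trans (hlogle n hn)
  set μV := truncLE V (moebius : ArithmeticFunction ℝ) with hμV
  set ΛV := truncLE V vonMangoldt with hΛV
  have hμ' : ∀ d, |(moebius : ArithmeticFunction ℝ) d| ≤ 1 := by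
    intro d
    rw [intCoe_apply]
    exact_mod_cast abs_moebius_le_one
  have hμ : ∀ d, |μV d| ≤ 1 := by
    intro d
    rw [hμV, truncLE_apply]
    split_ifs
    · exact hμ' d
    · simp
  have hT3 : T ≤ T ^ 3 := by simpa using pow_le_pow_of_two_le hT (show 1 ≤ 3 by norm_num)
  have hdecomp : ∑ n ∈ Finset.Ico a b, (vonMangoldt n : ℂ) * F n =
      ∑ n ∈ Finset.Ico a b, (ΛV n : ℂ) * F n +
      ∑ n ∈ Finset.Ico a b, ((μV * log) n : ℂ) * F n -
      ∑ n ∈ Finset.Ico a b, (((μV * ΛV) * zeta) n : ℂ) * F n +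
      ∑ n ∈ Finset.Ico a b, (((vonMangoldt - ΛV) *
        (((moebius : ArithmeticFunction ℝ) - μV) * zeta)) n : ℂ) * F n := by
    rw [← Finset.sum_add_distrib, ← Finset.sum_sub_distrib, ← Finset.sum_add_distrib]
    refine Finset.sum_congr rfl fun n _ => ?_
    have := congrArg (fun f : ArithmeticFunction ℝ => f n) (vonMangoldt_eq_vaughan V)
    simp only [ArithmeticFunction.add_apply, arithmeticFunction_sub_apply] at this
    rw [this]
    push_cast
    ring
  have hsmall : ‖∑ n ∈ Finset.Ico a b, (ΛV n : ℂ) * F n‖ ≤ N / T ^ 3 := by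
    have h1 : ∀ n ∈ Finset.Ico a b, ‖(ΛV n : ℂ) * F n‖ ≤ if n ∈ Finset.Icc 1 V then T else 0 := by
      intro n hn
      rw [norm_mul, norm_eC, mul_one, Complex.norm_real, Real.norm_eq_abs, hΛV, truncLE_apply]
      have := (Finset.mem_Ico.1 hn).1
      by_cases hnV : n ≤ V
      · rw [if_pos hnV, if_pos (Finset.mem_Icc.2 ⟨by omega, hnV⟩)]
        exact hΛ n (by omega)
      · rw [if_neg hnV, abs_zero]
        split_ifs <;> linarith
    refine (norm_sum_le _ _).trans ((Finset.sum_le_sum h1).trans ?_)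
    rw [← Finset.sum_filter, Finset.sum_const, nsmul_eq_mul]
    have h2 : #{n ∈ Finset.Ico a b | n ∈ Finset.Icc 1 V} ≤ V := by
      have : {n ∈ Finset.Ico a b | n ∈ Finset.Icc 1 V} ⊆ Finset.Icc 1 V := fun n hn =>
        (Finset.mem_filter.1 hn).2
      simpa using Finset.card_le_card this
    have h3 : (#{n ∈ Finset.Ico a b | n ∈ Finset.Icc 1 V} : ℝ) ≤ T ^ E :=
      le_trans (by exact_mod_cast h2) hVu
    rw [le_div_iff₀ (by positivity)]
    calc _ ≤ T ^ E * T * T ^ 3 := by gcongr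
      _ = T ^ (E + 4) := by ring
      _ ≤ N := (pow_le_pow_of_two_le hT (by omega)).trans hN
  have hpow1 : (T ^ 3) ^ C₁ ≤ T ^ (3 * C₁ + 3 * C₂ + 2 * E + 4) := by
    rw [← pow_mul]; exact pow_le_pow_of_two_le hT (by omega)
  have hpow2 : (T ^ 3) ^ C₂ ≤ T ^ (3 * C₁ + 3 * C₂ + 2 * E + 4) := by
    rw [← pow_mul]; exact pow_le_pow_of_two_le hT (by omega)
  have hEpow : T ^ (2 * E) ≤ (T ^ 3) ^ (2 * E) := by
    rw [← pow_mul]; exact pow_le_pow_of_two_le hT (by omega)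
  by_contra hcon
  have h1 : ‖∑ n ∈ Finset.Ico a b, ((μV * log) n : ℂ) * F n‖ < N / T ^ 3 := by
    by_contra! hbig
    obtain ⟨q, hq0, hqT, hq⟩ := hC₁ (T ^ 3) (two_le_pow hT (by norm_num)) N (hpow1.trans hN)
      (hlog.trans hT3) μV log V
      (hVu.trans ((pow_le_pow_of_two_le hT (by omega)).trans hEpow))
      (fun d => (hμ d).trans (one_le_pow_of_two_le hT 3))
      (fun d hd => by rw [hμV, truncLE_apply, if_neg (by omega)])
      (by
        intro m n hmn
        rw [log_apply, log_apply]
        rcases Nat.eq_zero_or_pos m with rfl | hm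
        · simpa using Real.log_natCast_nonneg n
        · exact Real.log_le_log (by exact_mod_cast hm) (by exact_mod_cast hmn))
      (by
        rw [log_apply]
        have h2 : Real.log ((N + 1 : ℕ) : ℝ) ≤ Real.log (2 * N) :=
          Real.log_le_log (by positivity) (by push_cast; linarith)
        rw [Real.log_mul (by norm_num) (by positivity)] at h2
        have := Real.log_two_lt_d9
        linarith) α a b ha hb hbig
    exact hcon ⟨q, hq0, hqT.trans hpow1, hq.trans (by gcongr)⟩
  have h2 : ‖∑ n ∈ Finset.Ico a b, (((μV * ΛV) * zeta) n : ℂ) * F n‖ < N / T ^ 3 := by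
    by_contra! hbig
    obtain ⟨q, hq0, hqT, hq⟩ := hC₁ (T ^ 3) (two_le_pow hT (by norm_num)) N (hpow1.trans hN)
      (hlog.trans hT3) (μV * ΛV) (zeta : ArithmeticFunction ℝ) (V * V)
      (hVV.trans hEpow)
      (fun d => by
        by_cases hd : d ≤ V * V
        · have h3 : |(μV * ΛV) d| ≤ Real.log d := by
            rw [mul_apply, ← vonMangoldt_sum, ← Nat.sum_divisorsAntidiagonal'
              (f := fun _ i => vonMangoldt i)]
            refine (Finset.abs_sum_le_sum_abs _ _).trans (Finset.sum_le_sum fun x _ => ?_)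
            rw [abs_mul]
            have h4 : |ΛV x.2| ≤ vonMangoldt x.2 := by
              rw [hΛV, truncLE_apply]
              split_ifs
              · rw [abs_of_nonneg vonMangoldt_nonneg]
              · simp
            calc |μV x.1| * |ΛV x.2| ≤ 1 * vonMangoldt x.2 := by
                  gcongr
                  exact hμ _
              _ = _ := one_mul _
          exact h3.trans ((hlogle d (by omega)).trans hT3)
        · rw [mul_apply, Finset.sum_eq_zero, abs_zero]
          · positivity
          · intro x hx
            have hx' := (Nat.mem_divisorsAntidiagonal.1 hx).1
            rw [hμV, hΛV, truncLE_apply, truncLE_apply]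
            by_cases h1 : x.1 ≤ V <;> by_cases h2 : x.2 ≤ V
            · exact absurd (hx' ▸ Nat.mul_le_mul h1 h2) hd
            all_goals simp [h1, h2])
      (fun d hd => by
        rw [mul_apply, Finset.sum_eq_zero]
        intro x hx
        have hx' := (Nat.mem_divisorsAntidiagonal.1 hx).1
        rw [hμV, hΛV, truncLE_apply, truncLE_apply]
        by_cases h1 : x.1 ≤ V <;> by_cases h2 : x.2 ≤ V
        · have := Nat.mul_le_mul h1 h2
          omega
        all_goals simp [h1, h2])
      (by
        intro m n hmn
        simp only [natCoe_apply, zeta_apply]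
        by_cases hm : m = 0
        · simp [hm]; split_ifs <;> norm_num
        · simp [hm, show n ≠ 0 by omega])
      (by
        rw [natCoe_apply, zeta_apply, if_neg (by omega)]
        have := two_le_pow hT (show 1 ≤ 3 by norm_num)
        push_cast
        linarith) α a b ha hb hbig
    exact hcon ⟨q, hq0, hqT.trans hpow1, hq.trans (by gcongr)⟩
  have h3 : ‖∑ n ∈ Finset.Ico a b, (((vonMangoldt - ΛV) *
        (((moebius : ArithmeticFunction ℝ) - μV) * zeta)) n : ℂ) * F n‖ < N / T ^ 3 := by
    by_contra! hbig
    obtain ⟨q, hq0, hqT, hq⟩ := hC₂ (T ^ 3) (two_le_pow hT (by norm_num)) N V hN1' hVl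
      (hlog.trans hT3) (vonMangoldt - ΛV) (((moebius : ArithmeticFunction ℝ) - μV) * zeta)
      (fun n hn => by
        rw [arithmeticFunction_sub_apply, hΛV, truncLE_apply]
        split_ifs
        · simp; positivity
        · rw [sub_zero]
          exact (hΛ n hn).trans hT3)
      (fun n hn => by rw [arithmeticFunction_sub_apply, hΛV, truncLE_apply, if_pos hn, sub_self])
      (fun n hn => by
        have h4 : ∀ m ∈ Finset.Icc 1 n,
            ((((moebius : ArithmeticFunction ℝ) - μV) * zeta : ArithmeticFunction ℝ) m) ^ 2 ≤
              (#m.divisors : ℝ) ^ 2 := by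
          intro m _
          rw [← sq_abs]
          gcongr
          rw [coe_mul_zeta_apply]
          refine (Finset.abs_sum_le_sum_abs _ _).trans ?_
          rw [Finset.card_eq_sum_ones]
          push_cast
          refine Finset.sum_le_sum fun d _ => ?_
          rw [arithmeticFunction_sub_apply, hμV, truncLE_apply]
          split_ifs
          · simp
          · rw [sub_zero]
            exact hμ' d
        refine (Finset.sum_le_sum h4).trans ((sum_card_divisors_sq_le n).trans ?_)
        have := hlogle n hn
        have := Real.log_natCast_nonneg n
        gcongr
        linarith)
      (fun n hn => by
        rw [coe_mul_zeta_apply, Finset.sum_eq_zero]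
        intro d hd
        have := Nat.divisor_le hd
        rw [arithmeticFunction_sub_apply, hμV, truncLE_apply, if_pos (by omega), sub_self])
      α a b ha hb hbig
    exact hcon ⟨q, hq0, hqT.trans hpow2, hq.trans (by gcongr)⟩
  rw [hdecomp] at h
  have h4 := norm_add_le (∑ n ∈ Finset.Ico a b, (ΛV n : ℂ) * F n +
      ∑ n ∈ Finset.Ico a b, ((μV * log) n : ℂ) * F n -
      ∑ n ∈ Finset.Ico a b, (((μV * ΛV) * zeta) n : ℂ) * F n)
      (∑ n ∈ Finset.Ico a b, (((vonMangoldt - ΛV) *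
        (((moebius : ArithmeticFunction ℝ) - μV) * zeta)) n : ℂ) * F n)
  have h5 := norm_sub_le (∑ n ∈ Finset.Ico a b, (ΛV n : ℂ) * F n +
      ∑ n ∈ Finset.Ico a b, ((μV * log) n : ℂ) * F n)
      (∑ n ∈ Finset.Ico a b, (((μV * ΛV) * zeta) n : ℂ) * F n)
  have h6 := norm_add_le (∑ n ∈ Finset.Ico a b, (ΛV n : ℂ) * F n)
      (∑ n ∈ Finset.Ico a b, ((μV * log) n : ℂ) * F n)
  have h7 : 4 * (N / T ^ 3) ≤ N / T := by
    rw [mul_div_assoc', div_le_div_iff₀ (by positivity) hT0]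
    nlinarith [mul_le_mul_of_nonneg_left (show 4 ≤ T ^ 2 by nlinarith) (by positivity : 0 ≤ N * T)]
  linarith

lemma sum_Ico_vonMangoldt_sub_prime_le (a b N : ℕ) (ha : 1 ≤ a) (hb : b ≤ N + 1) (hN : 1 ≤ N) :
    ∑ n ∈ Finset.Ico a b, (ArithmeticFunction.vonMangoldt n -
      if n.Prime then Real.log n else 0) ≤ 2 * √N * Real.log N := by
  have h := Chebyshev.psi_sub_theta_le (x := N) (by exact_mod_cast hN)
  rw [Chebyshev.psi, Chebyshev.theta, Nat.floor_natCast, Finset.sum_filter,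
    ← Finset.sum_sub_distrib] at h
  refine le_trans (Finset.sum_le_sum_of_subset_of_nonneg ?_ fun n _ _ => ?_) h
  · intro n hn
    rw [Finset.mem_Ico] at hn
    exact Finset.mem_Ioc.2 ⟨by omega, by omega⟩
  · split_ifs with hp
    · rw [ArithmeticFunction.vonMangoldt_apply_prime hp, sub_self]
    · simp

/-- Exponential sums over primes in an interval, inverse form. -/
lemma prime_weyl_inverse (j : ℕ) (hj : 1 ≤ j) : ∃ C : ℕ, ∀ T : ℝ, 2 ≤ T → ∀ N : ℕ,
    T ^ C ≤ N → Real.log N ≤ T → ∀ (α : ℝ) (a b : ℕ), b ≤ N + 1 →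
      N / T ≤ ‖∑ p ∈ Finset.Ico a b with p.Prime, eC (α * (p : ℝ) ^ j)‖ →
      ∃ q : ℕ, 0 < q ∧ (q : ℝ) ≤ T ^ C ∧ dZ (q * α) ≤ T ^ C / (N : ℝ) ^ j := by
  obtain ⟨C, hC⟩ := vonMangoldt_weyl_inverse j hj
  refine ⟨4 * C + 14, fun T hT N hN hlog α a b hb h => ?_⟩
  have hT0 : 0 < T := by linarith
  have hN1 : (1 : ℝ) ≤ N := (one_le_pow_of_two_le hT _).trans hN
  have hN0 : (0 : ℝ) < N := by linarith
  have hN1' : 1 ≤ N := by exact_mod_cast hN1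
  set F : ℕ → ℂ := fun n => eC (α * (n : ℝ) ^ j) with hF
  set a' := max a 2 with ha'
  set w : ℕ → ℝ := fun n => 1 / Real.log (max n 2 : ℕ) with hw
  have hlogpos : ∀ n : ℕ, 0 < Real.log (max n 2 : ℕ) := fun n =>
    Real.log_pos (by exact_mod_cast lt_of_lt_of_le one_lt_two (le_max_right n 2))
  have hwanti : Antitone w := by
    intro m n hmn
    refine one_div_le_one_div_of_le (hlogpos m) (Real.log_le_log ?_ ?_)
    · exact_mod_cast lt_of_lt_of_le two_pos (le_max_right m 2)
    · exact_mod_cast max_le_max_right 2 hmn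
  have hw0 : ∀ n, 0 ≤ w n := fun n => (one_div_pos.2 (hlogpos n)).le
  set f : ℕ → ℂ := fun n => if n.Prime then (Real.log n : ℂ) * F n else 0 with hf
  have e1 : ∑ p ∈ Finset.Ico a b with p.Prime, F p = ∑ n ∈ Finset.Ico a' b, (w n : ℂ) * f n := by
    have e2 : {p ∈ Finset.Ico a b | p.Prime} = {p ∈ Finset.Ico a' b | p.Prime} := by
      ext p
      simp only [Finset.mem_filter, Finset.mem_Ico, ha']
      constructor
      · rintro ⟨h, hp⟩
        have := hp.two_le
        exact ⟨by omega, hp⟩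
      · rintro ⟨h, hp⟩
        exact ⟨by omega, hp⟩
    rw [e2, Finset.sum_filter]
    refine Finset.sum_congr rfl fun n hn => ?_
    simp only [hf, hw]
    split_ifs with hp
    · rw [max_eq_left hp.two_le]
      have h0 : Real.log n ≠ 0 := (Real.log_pos (by exact_mod_cast hp.one_lt)).ne'
      have h0' : (Real.log n : ℂ) ≠ 0 := by exact_mod_cast h0
      push_cast at h0' ⊢
      field_simp
    · simp
  rw [e1] at h
  obtain ⟨c, hc, h1⟩ := exists_le_norm_sum_Ico_of_antitone w hwanti hw0 f a' b
  have hwa : w a' ≤ 2 := by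
    simp only [hw]
    rw [div_le_iff₀ (hlogpos _)]
    have h2 : Real.log 2 ≤ Real.log (max a' 2 : ℕ) :=
      Real.log_le_log (by norm_num) (by exact_mod_cast le_max_right a' 2)
    have := Real.log_two_gt_d9
    linarith
  have h2 : N / T ^ 2 ≤ ‖∑ n ∈ Finset.Ico a' c, f n‖ := by
    have h3 : N / T ≤ 2 * ‖∑ n ∈ Finset.Ico a' c, f n‖ := by
      refine h.trans (h1.trans ?_)
      gcongr
    have h4 : (N : ℝ) / T ^ 2 ≤ N / T / 2 := by
      rw [div_div, sq]
      gcongr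
    linarith
  have h3 : ‖∑ n ∈ Finset.Ico a' c, (ArithmeticFunction.vonMangoldt n : ℂ) * F n -
      ∑ n ∈ Finset.Ico a' c, f n‖ ≤ N / T ^ 3 := by
    rw [← Finset.sum_sub_distrib]
    have h4 : ∀ n ∈ Finset.Ico a' c, ‖(ArithmeticFunction.vonMangoldt n : ℂ) * F n - f n‖ ≤
        ArithmeticFunction.vonMangoldt n - if n.Prime then Real.log n else 0 := by
      intro n _
      simp only [hf]
      split_ifs with hp
      · rw [ArithmeticFunction.vonMangoldt_apply_prime hp, sub_self, sub_self, norm_zero]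
      · rw [sub_zero, sub_zero, norm_mul, norm_eC, mul_one, Complex.norm_real, Real.norm_eq_abs,
          abs_of_nonneg ArithmeticFunction.vonMangoldt_nonneg]
    refine (norm_sum_le _ _).trans ((Finset.sum_le_sum h4).trans
      ((sum_Ico_vonMangoldt_sub_prime_le a' c N (by omega) (by omega) hN1').trans ?_))
    have h5 : T ^ 5 ≤ √N := by
      refine Real.le_sqrt_of_sq_le ?_
      rw [← pow_mul]
      exact (pow_le_pow_of_two_le hT (by omega)).trans hN
    have h6 : √(N : ℝ) * √N = N := Real.mul_self_sqrt hN0.le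
    rw [le_div_iff₀ (by positivity)]
    calc 2 * √(N : ℝ) * Real.log N * T ^ 3 ≤ T * √N * T * T ^ 3 := by gcongr
      _ = √N * T ^ 5 := by ring
      _ ≤ √N * √N := by gcongr
      _ = N := h6
  have h4 : N / T ^ 4 ≤ ‖∑ n ∈ Finset.Ico a' c, (ArithmeticFunction.vonMangoldt n : ℂ) * F n‖ := by
    have h5 := norm_sub_norm_le (∑ n ∈ Finset.Ico a' c, f n)
      (∑ n ∈ Finset.Ico a' c, (ArithmeticFunction.vonMangoldt n : ℂ) * F n)
    rw [norm_sub_rev] at h5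
    have h6 : (N : ℝ) / T ^ 3 ≤ N / T ^ 2 / 2 := by
      rw [div_div, pow_succ]
      gcongr
    have h7 : (N : ℝ) / T ^ 4 ≤ N / T ^ 3 := by
      gcongr
      · linarith
      · norm_num
    linarith
  have hTC : (T ^ 4) ^ C ≤ T ^ (4 * C + 14) := by
    rw [← pow_mul]; exact pow_le_pow_of_two_le hT (by omega)
  have hT4 : T ≤ T ^ 4 := by simpa using pow_le_pow_of_two_le hT (show 1 ≤ 4 by norm_num)
  obtain ⟨q, hq0, hqT, hq⟩ := hC (T ^ 4) (two_le_pow hT (by norm_num)) N (hTC.trans hN)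
    (hlog.trans hT4) α a' c (by omega) (by omega) h4
  exact ⟨q, hq0, hqT.trans hTC, hq.trans (by gcongr)⟩

lemma exists_one_add_log_pow_le (m : ℕ) {ε : ℝ} (hε : 0 < ε) :
    ∃ C : ℝ, 1 ≤ C ∧ ∀ x : ℝ, 1 ≤ x → (1 + Real.log x) ^ m ≤ C * x ^ ε := by
  set d : ℝ := ε / (m + 1) with hd
  have hd0 : 0 < d := by positivity
  refine ⟨(1 + 1 / d) ^ m, one_le_pow₀ (by have : 0 < 1 / d := by positivity
                                           linarith), fun x hx => ?_⟩
  have h1 : Real.log x ≤ x ^ d / d := Real.log_le_rpow_div (by linarith) hd0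
  have h2 : 1 ≤ x ^ d := Real.one_le_rpow hx hd0.le
  have h3 : 1 + Real.log x ≤ (1 + 1 / d) * x ^ d := by
    calc 1 + Real.log x ≤ x ^ d + x ^ d / d := by linarith
      _ = _ := by ring
  have h4 : 0 ≤ Real.log x := Real.log_nonneg hx
  calc (1 + Real.log x) ^ m ≤ ((1 + 1 / d) * x ^ d) ^ m := by gcongr
    _ = (1 + 1 / d) ^ m * x ^ (d * m) := by
      rw [mul_pow, Real.rpow_mul (by linarith), Real.rpow_natCast]
    _ ≤ (1 + 1 / d) ^ m * x ^ ε := by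
      gcongr
      rw [hd, div_mul_eq_mul_div, div_le_iff₀ (by positivity)]
      nlinarith

lemma hasDerivAt_ofReal_log_pow (i : ℕ) {x : ℝ} (hx : x ≠ 0) :
    HasDerivAt (fun y : ℝ => (Real.log y : ℂ) ^ i)
      ((i : ℂ) * (Real.log x : ℂ) ^ (i - 1) * ((x⁻¹ : ℝ) : ℂ)) x := by
  have h : HasDerivAt (fun y : ℝ => Real.log y ^ i) (i * Real.log x ^ (i - 1) * x⁻¹) x :=
    (Real.hasDerivAt_log hx).pow i
  simpa using h.ofReal_comp

/-- An antiderivative of `log x ^ i * x ^ (-s)`. -/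
def logPowPrim (s : ℂ) : ℕ → ℝ → ℂ
  | 0, x => (x : ℂ) ^ (1 - s) / (1 - s)
  | i + 1, x => (Real.log x : ℂ) ^ (i + 1) * ((x : ℂ) ^ (1 - s) / (1 - s))
      - (i + 1 : ℂ) / (1 - s) * logPowPrim s i x

lemma hasDerivAt_logPowPrim {s : ℂ} (hs : 1 - s ≠ 0) (i : ℕ) {x : ℝ} (hx : 0 < x) :
    HasDerivAt (logPowPrim s i) ((Real.log x : ℂ) ^ i * (x : ℂ) ^ (-s)) x := by
  have hx' : (x : ℂ) ≠ 0 := by exact_mod_cast hx.ne'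
  have hb : HasDerivAt (fun y : ℝ => (y : ℂ) ^ (1 - s) / (1 - s)) ((x : ℂ) ^ (-s)) x := by
    have h := (hasDerivAt_ofReal_cpow_const' (x := x) hx.ne' (r := -s) (by
      intro h; apply hs; rw [sub_eq_zero]; linear_combination h))
    have e : -s + 1 = 1 - s := by ring
    rw [e] at h
    exact h
  induction i with
  | zero => simpa [logPowPrim] using hb
  | succ i ih =>
    have hl : HasDerivAt (fun y : ℝ => (Real.log y : ℂ) ^ (i + 1))
        (((i + 1 : ℕ) : ℂ) * (Real.log x : ℂ) ^ i * ((x⁻¹ : ℝ) : ℂ)) x := by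
      simpa using hasDerivAt_ofReal_log_pow (i + 1) hx.ne'
    have h := (hl.mul hb).sub (ih.const_mul ((i + 1 : ℂ) / (1 - s)))
    refine h.congr_deriv ?_
    have e : (x : ℂ) ^ (1 - s) = x * (x : ℂ) ^ (-s) := by
      rw [sub_eq_add_neg, Complex.cpow_add _ _ hx', Complex.cpow_one]
    rw [e]
    push_cast
    field_simp
    ring

lemma norm_logPowPrim_le {s : ℂ} (hs : 1 ≤ ‖1 - s‖) (i : ℕ) {x : ℝ} (hx : 1 ≤ x) :
    ‖logPowPrim s i x‖ ≤ (i + 1).factorial * (1 + Real.log x) ^ i * x ^ (1 - s.re) := by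
  have hl : 0 ≤ Real.log x := Real.log_nonneg hx
  have hx0 : 0 < x := by linarith
  have hb : ‖(x : ℂ) ^ (1 - s) / (1 - s)‖ ≤ x ^ (1 - s.re) := by
    rw [norm_div, Complex.norm_cpow_eq_rpow_re_of_pos hx0]
    simp only [Complex.sub_re, Complex.one_re]
    exact div_le_self (by positivity) hs
  have hp : 0 ≤ x ^ (1 - s.re) := by positivity
  induction i with
  | zero => simpa [logPowPrim] using hb
  | succ i ih =>
    rw [logPowPrim]
    have h1 : ‖(Real.log x : ℂ) ^ (i + 1) * ((x : ℂ) ^ (1 - s) / (1 - s))‖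
        ≤ (1 + Real.log x) ^ (i + 1) * x ^ (1 - s.re) := by
      rw [norm_mul, norm_pow, Complex.norm_real, Real.norm_of_nonneg hl]
      gcongr
      linarith
    have h2 : ‖(i + 1 : ℂ) / (1 - s) * logPowPrim s i x‖
        ≤ (i + 1) * ((i + 1).factorial * (1 + Real.log x) ^ (i + 1) * x ^ (1 - s.re)) := by
      rw [norm_mul, norm_div]
      have e : ‖(i + 1 : ℂ)‖ = (i + 1 : ℝ) := by
        rw [show (i + 1 : ℂ) = ((i + 1 : ℝ) : ℂ) by push_cast; rfl, Complex.norm_real,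
          Real.norm_of_nonneg (by positivity)]
      rw [e]
      have h3 : (i + 1 : ℝ) / ‖1 - s‖ ≤ i + 1 := div_le_self (by positivity) hs
      have h4 : ((i + 1).factorial : ℝ) * (1 + Real.log x) ^ i * x ^ (1 - s.re)
          ≤ (i + 1).factorial * (1 + Real.log x) ^ (i + 1) * x ^ (1 - s.re) := by
        gcongr
        · linarith
        · omega
      exact mul_le_mul h3 (ih.trans h4) (norm_nonneg _) (by positivity)
    refine (norm_sub_le _ _).trans ((add_le_add h1 h2).trans ?_)
    have e : ((i + 1 + 1).factorial : ℝ) = (i + 2) * (i + 1).factorial := by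
      rw [Nat.factorial_succ]; push_cast; ring
    have e1 : (1 : ℝ) ≤ (i + 1).factorial := by exact_mod_cast Nat.factorial_pos _
    have e2 : (0 : ℝ) ≤ (1 + Real.log x) ^ (i + 1) * x ^ (1 - s.re) := by positivity
    rw [e]
    nlinarith [mul_nonneg (sub_nonneg.2 e1) e2]

lemma norm_logPowPrim_diff_sub_le {s : ℂ} (hs : 1 ≤ ‖1 - s‖) (hre : 1 ≤ s.re) (i : ℕ) {n : ℝ}
    (hn : 1 ≤ n) :
    ‖logPowPrim s i (n + 1) - logPowPrim s i n - (Real.log n : ℂ) ^ i * (n : ℂ) ^ (-s)‖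
      ≤ (i + ‖s‖) * (1 + Real.log (n + 1)) ^ i / n ^ 2 := by
  have hs0 : 1 - s ≠ 0 := by
    intro h; rw [h, norm_zero] at hs; linarith
  have hs1 : s ≠ 0 := by
    intro h; rw [h, Complex.zero_re] at hre; linarith
  set B : ℝ := (i + ‖s‖) * (1 + Real.log (n + 1)) ^ i / n ^ 2 with hB
  have hln : 0 ≤ Real.log (n + 1) := Real.log_nonneg (by linarith)
  have hB0 : 0 ≤ B := by positivity
  set g : ℝ → ℂ := fun x => (Real.log x : ℂ) ^ i * (x : ℂ) ^ (-s) with hg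
  set g' : ℝ → ℂ := fun x => (i : ℂ) * (Real.log x : ℂ) ^ (i - 1) * ((x⁻¹ : ℝ) : ℂ) * (x : ℂ) ^ (-s)
    + (Real.log x : ℂ) ^ i * (-s * (x : ℂ) ^ (-s - 1)) with hg'
  have hgd : ∀ x : ℝ, 0 < x → HasDerivAt g (g' x) x := by
    intro x hx
    have hx' : (x : ℂ) ≠ 0 := by exact_mod_cast hx.ne'
    have hl : HasDerivAt (fun y : ℝ => (Real.log y : ℂ) ^ i)
        ((i : ℂ) * (Real.log x : ℂ) ^ (i - 1) * ((x⁻¹ : ℝ) : ℂ)) x := by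
      exact hasDerivAt_ofReal_log_pow i hx.ne'
    have hc : HasDerivAt (fun y : ℝ => (y : ℂ) ^ (-s)) (-s * (x : ℂ) ^ (-s - 1)) x := by
      exact hasDerivAt_ofReal_cpow_const hx.ne' (neg_ne_zero.2 hs1)
    exact hl.mul hc
  have hgb : ∀ x ∈ Set.Icc n (n + 1), ‖g' x‖ ≤ B := by
    rintro x ⟨h1, h2⟩
    have hx1 : 1 ≤ x := hn.trans h1
    have hx0 : 0 < x := by linarith
    have hl0 : 0 ≤ Real.log x := Real.log_nonneg hx1
    have hl1 : Real.log x ≤ Real.log (n + 1) := Real.log_le_log hx0 h2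
    have hinv : x ^ (-s.re - 1) ≤ 1 / n ^ 2 := by
      calc x ^ (-s.re - 1) ≤ x ^ (-2 : ℝ) := Real.rpow_le_rpow_of_exponent_le hx1 (by linarith)
        _ = 1 / x ^ 2 := by
          rw [Real.rpow_neg hx0.le, one_div]; norm_cast
        _ ≤ 1 / n ^ 2 := by gcongr
    have ha : ‖(i : ℂ) * (Real.log x : ℂ) ^ (i - 1) * ((x⁻¹ : ℝ) : ℂ) * (x : ℂ) ^ (-s)‖
        ≤ i * (1 + Real.log (n + 1)) ^ i * (1 / n ^ 2) := by
      rw [norm_mul, norm_mul, norm_mul, norm_pow, Complex.norm_real, Complex.norm_real,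
        Complex.norm_natCast, Real.norm_of_nonneg hl0, Real.norm_of_nonneg (by positivity),
        Complex.norm_cpow_eq_rpow_re_of_pos hx0, mul_assoc, Complex.neg_re]
      have e : x⁻¹ * x ^ (-s.re) = x ^ (-s.re - 1) := by
        rw [Real.rpow_sub hx0, Real.rpow_one]; field_simp
      rw [e]
      have h5 : Real.log x ^ (i - 1) ≤ (1 + Real.log (n + 1)) ^ i := by
        calc Real.log x ^ (i - 1) ≤ (1 + Real.log (n + 1)) ^ (i - 1) := by gcongr; linarith
          _ ≤ _ := pow_le_pow_right₀ (by linarith) (by omega)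
      gcongr
    have hb : ‖(Real.log x : ℂ) ^ i * (-s * (x : ℂ) ^ (-s - 1))‖
        ≤ ‖s‖ * (1 + Real.log (n + 1)) ^ i * (1 / n ^ 2) := by
      rw [norm_mul, norm_mul, norm_pow, Complex.norm_real, Real.norm_of_nonneg hl0, norm_neg,
        Complex.norm_cpow_eq_rpow_re_of_pos hx0, Complex.sub_re, Complex.neg_re, Complex.one_re]
      have h5 : Real.log x ^ i ≤ (1 + Real.log (n + 1)) ^ i := by gcongr; linarith
      calc _ ≤ (1 + Real.log (n + 1)) ^ i * (‖s‖ * (1 / n ^ 2)) := by gcongr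
        _ = _ := by ring
    refine (norm_add_le _ _).trans ((add_le_add ha hb).trans (le_of_eq ?_))
    rw [hB]; ring
  have hgv : ∀ x ∈ Set.Icc n (n + 1), ‖g x - g n‖ ≤ B := by
    intro x hx
    have := (convex_Icc n (n + 1)).norm_image_sub_le_of_norm_hasDerivWithin_le
      (f := g) (f' := g') (C := B) (fun y hy => (hgd y (by linarith [hy.1])).hasDerivWithinAt)
      hgb (Set.left_mem_Icc.2 (by linarith)) hx
    refine this.trans ?_
    have h6 : ‖x - n‖ ≤ 1 := by
      rw [Real.norm_of_nonneg (by linarith [hx.1])]; linarith [hx.2]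
    nlinarith
  have hF := (convex_Icc n (n + 1)).norm_image_sub_le_of_norm_hasDerivWithin_le
      (f := fun x : ℝ => logPowPrim s i x - x * g n) (f' := fun x => g x - g n) (C := B)
      (fun y hy => by
        have h0 : HasDerivAt (fun y : ℝ => (y : ℂ) * g n) (1 * g n) y :=
          (Complex.ofRealCLM.hasDerivAt (x := y)).mul_const (g n)
        rw [one_mul] at h0
        exact ((hasDerivAt_logPowPrim hs0 i (by linarith [hy.1])).sub h0).hasDerivWithinAt)
      hgv (Set.left_mem_Icc.2 (by linarith)) (Set.right_mem_Icc.2 (by linarith))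
  have e : ‖n + 1 - n‖ = 1 := by simp
  rw [e, mul_one] at hF
  refine le_trans (le_of_eq ?_) hF
  congr 1
  push_cast
  ring

lemma sum_Ico_one_div_mul_sqrt_le {N M : ℕ} (hN : 1 ≤ N) (hNM : N ≤ M) :
    ∑ n ∈ Ico N M, 1 / ((n : ℝ) * √n) ≤ 4 * (1 / √N - 1 / √M) := by
  induction M, hNM using Nat.le_induction with
  | base => simp
  | succ M hM ih =>
    rw [sum_Ico_succ_top hM]
    have hM1 : (1 : ℝ) ≤ M := by exact_mod_cast hN.trans hM
    have key : 1 / ((M : ℝ) * √M) ≤ 4 * (1 / √M - 1 / √(M + 1 : ℝ)) := by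
      set a := √(M : ℝ) with ha
      set b := √(M + 1 : ℝ) with hb
      have ha2 : a ^ 2 = M := Real.sq_sqrt (by linarith)
      have hb2 : b ^ 2 = M + 1 := Real.sq_sqrt (by linarith)
      have ha0 : 0 < a := Real.sqrt_pos.2 (by linarith)
      have hb0 : 0 < b := Real.sqrt_pos.2 (by linarith)
      have hab : b ≤ 3 / 2 * a := by
        apply Real.sqrt_le_iff.2
        constructor
        · positivity
        · rw [mul_pow, ha2]; nlinarith
      have e : (b - a) * (b + a) = 1 := by linear_combination hb2 - ha2
      rw [← ha2, div_sub_div _ _ ha0.ne' hb0.ne', mul_div_assoc', div_le_div_iff₀ (by positivity)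
        (by positivity)]
      have h1 : b * (b + a) ≤ 4 * a ^ 2 := by nlinarith
      have h2 : 0 < b + a := by positivity
      have h3 : b ≤ 4 * a ^ 2 * (b - a) := by
        by_contra hcon
        push Not at hcon
        have := mul_lt_mul_of_pos_right hcon h2
        nlinarith
      calc 1 * (a * b) = a * b := one_mul _
        _ ≤ a * (4 * a ^ 2 * (b - a)) := by gcongr
        _ = _ := by ring
    push_cast
    linarith

/-- The arithmetic function `n ↦ log n ^ i`. -/
def logPow (i : ℕ) : ℕ → ℂ := fun n => (Real.log n : ℂ) ^ i

lemma logPow_zero : logPow 0 = 1 := by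
  ext n; simp [logPow]

lemma logMul_logPow (i : ℕ) : LSeries.logMul (logPow i) = logPow (i + 1) := by
  ext n
  simp only [LSeries.logMul, logPow, Complex.natCast_log]
  ring

lemma abscissaOfAbsConv_logPow (i : ℕ) : LSeries.abscissaOfAbsConv (logPow i) = 1 := by
  induction i with
  | zero => rw [logPow_zero]; exact LSeries.abscissaOfAbsConv_one
  | succ i ih => rw [← logMul_logPow, LSeries.abscissaOfAbsConv_logMul, ih]

lemma norm_sum_Ico_logPow_le {s : ℂ} (hs : 1 ≤ ‖1 - s‖) (hre : 1 ≤ s.re) (i : ℕ) {A : ℝ}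
    (hA : ∀ x : ℝ, 1 ≤ x → (1 + Real.log x) ^ i ≤ A * √x) {N M : ℕ} (hN : 1 ≤ N) (hNM : N ≤ M) :
    ‖∑ n ∈ Ico N M, LSeries.term (logPow i) s n‖ ≤ ‖logPowPrim s i M‖ + ‖logPowPrim s i N‖
      + (i + ‖s‖) * (8 * A) / √N := by
  have hA0 : 0 ≤ A := by
    have := hA 1 le_rfl
    simp at this
    linarith
  have h1 : ∑ n ∈ Ico N M, (logPowPrim s i (n + 1 : ℕ) - logPowPrim s i n)
      = logPowPrim s i M - logPowPrim s i N := by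
    exact sum_Ico_sub (fun n : ℕ => logPowPrim s i n) hNM
  have h2 : ∀ n ∈ Ico N M, ‖logPowPrim s i (n + 1 : ℕ) - logPowPrim s i n
      - LSeries.term (logPow i) s n‖ ≤ (i + ‖s‖) * (2 * A) * (1 / ((n : ℝ) * √n)) := by
    intro n hn
    have hn1 : 1 ≤ n := hN.trans (mem_Ico.1 hn).1
    have hn1' : (1 : ℝ) ≤ n := by exact_mod_cast hn1
    have h := norm_logPowPrim_diff_sub_le hs hre i hn1'
    have e : LSeries.term (logPow i) s n = (Real.log n : ℂ) ^ i * (n : ℂ) ^ (-s) := by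
      rw [LSeries.term_of_ne_zero (by omega), logPow, Complex.cpow_neg, div_eq_mul_inv]
    rw [e]
    push_cast at h ⊢
    refine h.trans ?_
    have h3 : (1 + Real.log (n + 1)) ^ i ≤ 2 * A * √n := by
      refine (hA _ (by linarith)).trans ?_
      have : √((n : ℝ) + 1) ≤ 2 * √n := by
        apply Real.sqrt_le_iff.2
        refine ⟨by positivity, ?_⟩
        rw [mul_pow, Real.sq_sqrt (by linarith)]; nlinarith
      nlinarith
    have hsq : √(n : ℝ) ^ 2 = n := Real.sq_sqrt (by linarith)
    have hsp : 0 < √(n : ℝ) := Real.sqrt_pos.2 (by linarith)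
    calc (i + ‖s‖) * (1 + Real.log (n + 1)) ^ i / (n : ℝ) ^ 2
        ≤ (i + ‖s‖) * (2 * A * √n) / (n : ℝ) ^ 2 := by gcongr
      _ = (i + ‖s‖) * (2 * A) * (1 / ((n : ℝ) * √n)) := by
        have : (n : ℝ) ^ 2 = n * √n * √n := by rw [mul_assoc, ← sq, hsq, sq]
        rw [this]
        field_simp
  have h3 := norm_sum_le_of_le _ h2
  rw [sum_sub_distrib, h1, ← mul_sum] at h3
  have h4 : ∑ n ∈ Ico N M, 1 / ((n : ℝ) * √n) ≤ 4 * (1 / √N) := by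
    refine (sum_Ico_one_div_mul_sqrt_le hN hNM).trans ?_
    have : 0 ≤ 1 / √(M : ℝ) := by positivity
    linarith
  have h5 : (i + ‖s‖) * (2 * A) * ∑ n ∈ Ico N M, 1 / ((n : ℝ) * √n)
      ≤ (i + ‖s‖) * (8 * A) / √N := by
    calc _ ≤ (i + ‖s‖) * (2 * A) * (4 * (1 / √N)) := by gcongr
      _ = _ := by ring
  set S := ∑ n ∈ Ico N M, LSeries.term (logPow i) s n
  have h6 : ‖S‖ ≤ ‖logPowPrim s i M - logPowPrim s i N - S‖
      + ‖logPowPrim s i M - logPowPrim s i N‖ := by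
    have := norm_sub_le (logPowPrim s i M - logPowPrim s i N)
      (logPowPrim s i M - logPowPrim s i N - S)
    rw [sub_sub_cancel] at this
    linarith
  have h7 := norm_sub_le (logPowPrim s i M) (logPowPrim s i N)
  linarith

lemma tendsto_logPowPrim {s : ℂ} (hs : 1 ≤ ‖1 - s‖) (hre : 1 < s.re) (i : ℕ) :
    Filter.Tendsto (fun M : ℕ => ‖logPowPrim s i M‖) Filter.atTop (nhds 0) := by
  obtain ⟨C, hC1, hC⟩ := exists_one_add_log_pow_le i (ε := (s.re - 1) / 2) (by linarith)
  have h0 : Filter.Tendsto (fun M : ℕ => ((i + 1).factorial * C) * (M : ℝ) ^ (-((s.re - 1) / 2)))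
      Filter.atTop (nhds 0) := by
    have := ((tendsto_rpow_neg_atTop (y := (s.re - 1) / 2) (by linarith)).comp
      tendsto_natCast_atTop_atTop).const_mul ((i + 1).factorial * C : ℝ)
    simpa using this
  refine squeeze_zero' (Filter.Eventually.of_forall fun _ => norm_nonneg _) ?_ h0
  filter_upwards [Filter.eventually_ge_atTop 1] with M hM
  have hM1 : (1 : ℝ) ≤ M := by exact_mod_cast hM
  refine (norm_logPowPrim_le hs i hM1).trans ?_
  calc ((i + 1).factorial : ℝ) * (1 + Real.log M) ^ i * (M : ℝ) ^ (1 - s.re)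
      ≤ (i + 1).factorial * (C * (M : ℝ) ^ ((s.re - 1) / 2)) * (M : ℝ) ^ (1 - s.re) := by
        gcongr
        exact hC _ hM1
    _ = (i + 1).factorial * C * ((M : ℝ) ^ ((s.re - 1) / 2) * (M : ℝ) ^ (1 - s.re)) := by ring
    _ = _ := by
      rw [← Real.rpow_add (by linarith)]
      congr 2
      ring

lemma norm_LSeries_logPow_le {s : ℂ} (hs : 1 ≤ ‖1 - s‖) (hre : 1 < s.re) (i : ℕ) {A : ℝ}
    (hA : ∀ x : ℝ, 1 ≤ x → (1 + Real.log x) ^ i ≤ A * √x) {N : ℕ} (hN : 1 ≤ N) :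
    ‖LSeries (logPow i) s‖ ≤ (1 + Real.log N) ^ (i + 1) + (i + 1).factorial * (1 + Real.log N) ^ i
      + (i + ‖s‖) * (8 * A) / √N := by
  have hN1 : (1 : ℝ) ≤ N := by exact_mod_cast hN
  have hlN : 0 ≤ Real.log N := Real.log_nonneg hN1
  have hsum : LSeriesSummable (logPow i) s := by
    apply LSeriesSummable_of_abscissaOfAbsConv_lt_re
    rw [abscissaOfAbsConv_logPow]
    exact_mod_cast hre
  have ht := hsum.hasSum.tendsto_sum_nat
  have hfin : ‖∑ n ∈ range N, LSeries.term (logPow i) s n‖ ≤ (1 + Real.log N) ^ (i + 1) := by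
    have hterm : ∀ n ∈ Icc 1 N, ‖LSeries.term (logPow i) s n‖
        ≤ (1 + Real.log N) ^ i * (1 / (n : ℝ)) := by
      intro n hn
      obtain ⟨hn1, hn2⟩ := mem_Icc.1 hn
      have hn1' : (1 : ℝ) ≤ n := by exact_mod_cast hn1
      have hl : 0 ≤ Real.log n := Real.log_nonneg hn1'
      rw [LSeries.term_of_ne_zero (by omega), logPow, norm_div, norm_pow, Complex.norm_real,
        Real.norm_of_nonneg hl, Complex.norm_natCast_cpow_of_pos (by omega), div_eq_mul_one_div]
      have h1 : Real.log n ≤ 1 + Real.log N := by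
        have := Real.log_le_log (by linarith) (show (n : ℝ) ≤ N by exact_mod_cast hn2)
        linarith
      have h2 : (n : ℝ) ≤ (n : ℝ) ^ s.re := by
        calc (n : ℝ) = (n : ℝ) ^ (1 : ℝ) := (Real.rpow_one _).symm
          _ ≤ _ := Real.rpow_le_rpow_of_exponent_le hn1' hre.le
      gcongr
    calc ‖∑ n ∈ range N, LSeries.term (logPow i) s n‖
        ≤ ∑ n ∈ range N, ‖LSeries.term (logPow i) s n‖ := norm_sum_le _ _
      _ ≤ ∑ n ∈ insert 0 (Icc 1 N), ‖LSeries.term (logPow i) s n‖ := by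
        apply sum_le_sum_of_subset_of_nonneg
        · intro n hn
          simp only [mem_range] at hn
          simp only [mem_insert, mem_Icc]
          omega
        · intros; positivity
      _ = ∑ n ∈ Icc 1 N, ‖LSeries.term (logPow i) s n‖ := by
        rw [sum_insert (by simp)]
        simp
      _ ≤ ∑ n ∈ Icc 1 N, (1 + Real.log N) ^ i * (1 / (n : ℝ)) := sum_le_sum hterm
      _ = (1 + Real.log N) ^ i * ∑ n ∈ Icc 1 N, 1 / (n : ℝ) := by rw [mul_sum]
      _ ≤ (1 + Real.log N) ^ i * (1 + Real.log N) := by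
        gcongr
        exact sum_Icc_one_div_le_one_add_log N
      _ = _ := by ring
  have hprim : ‖logPowPrim s i N‖ ≤ (i + 1).factorial * (1 + Real.log N) ^ i := by
    refine (norm_logPowPrim_le hs i hN1).trans ?_
    apply mul_le_of_le_one_right (by positivity)
    exact Real.rpow_le_one_of_one_le_of_nonpos hN1 (by linarith)
  set D : ℝ := (1 + Real.log N) ^ (i + 1) + (i + 1).factorial * (1 + Real.log N) ^ i
      + (i + ‖s‖) * (8 * A) / √N with hD
  have hlim : Filter.Tendsto (fun M : ℕ => D + ‖logPowPrim s i M‖) Filter.atTop (nhds D) := by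
    simpa using (tendsto_logPowPrim hs hre i).const_add D
  refine le_of_tendsto_of_tendsto ht.norm hlim ?_
  filter_upwards [Filter.eventually_ge_atTop N] with M hM
  rw [← sum_range_add_sum_Ico _ hM]
  have := norm_sum_Ico_logPow_le hs hre.le i hA hN hM
  refine (norm_add_le _ _).trans ?_
  rw [hD]
  linarith

/-- Bounds for the derivatives of the zeta function to the right of the line `Re s = 1`. -/
theorem exists_norm_LSeries_logPow_le (i : ℕ) {ε : ℝ} (hε : 0 < ε) :
    ∃ C : ℝ, 1 ≤ C ∧ ∀ s : ℂ, 1 < s.re → s.re ≤ 2 → 1 ≤ |s.im| →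
      ‖LSeries (logPow i) s‖ ≤ C * |s.im| ^ ε := by
  obtain ⟨A, hA1, hA⟩ := exists_one_add_log_pow_le i (ε := 1 / 2) (by norm_num)
  obtain ⟨B, hB1, hB⟩ := exists_one_add_log_pow_le (i + 1) (ε := ε / 2) (by linarith)
  refine ⟨(1 + (i + 1).factorial) * (B * 2 ^ (ε / 2)) + (i + 3) * (8 * A), ?_, ?_⟩
  · have : (1 : ℝ) ≤ (i + 3) * (8 * A) := by nlinarith [(Nat.cast_nonneg i : (0:ℝ) ≤ i)]
    have : (0 : ℝ) ≤ (1 + (i + 1).factorial) * (B * 2 ^ (ε / 2)) := by positivity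
    linarith
  intro s h1 h2 ht
  set t := |s.im| with ht'
  have hs1 : t ≤ ‖1 - s‖ := by
    have := Complex.abs_im_le_norm (1 - s)
    simpa using this
  have hs2 : ‖s‖ ≤ 3 * t := by
    have := Complex.norm_le_abs_re_add_abs_im s
    rw [abs_of_nonneg (by linarith : 0 ≤ s.re)] at this
    linarith
  set N : ℕ := ⌈t ^ 2⌉₊ with hN
  have ht2 : 1 ≤ t ^ 2 := one_le_pow₀ ht
  have hN1 : t ^ 2 ≤ N := Nat.le_ceil _
  have hN2 : (N : ℝ) ≤ 2 * t ^ 2 := by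
    have := Nat.ceil_lt_add_one (by positivity : 0 ≤ t ^ 2)
    linarith
  have hN0 : 1 ≤ N := by
    have : (1 : ℝ) ≤ N := ht2.trans hN1
    exact_mod_cast this
  have hsN : t ≤ √N := Real.le_sqrt_of_sq_le hN1
  have hlN : 0 ≤ Real.log N := Real.log_nonneg (by linarith)
  have hmain := norm_LSeries_logPow_le (ht.trans hs1) h1 i
    (A := A) (fun x hx => by rw [Real.sqrt_eq_rpow]; exact hA x hx) hN0
  have hte : 1 ≤ t ^ ε := Real.one_le_rpow ht hε.le
  have hL : (1 + Real.log N) ^ (i + 1) ≤ B * 2 ^ (ε / 2) * t ^ ε := by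
    refine (hB N (by linarith)).trans ?_
    rw [mul_assoc]
    gcongr
    calc (N : ℝ) ^ (ε / 2) ≤ (2 * t ^ 2) ^ (ε / 2) := by gcongr
      _ = 2 ^ (ε / 2) * t ^ ε := by
        rw [Real.mul_rpow (by norm_num) (by positivity), ← Real.rpow_natCast,
          ← Real.rpow_mul (by linarith)]
        congr 2
        push_cast
        ring
  have hL' : (1 + Real.log N) ^ i ≤ B * 2 ^ (ε / 2) * t ^ ε := by
    refine le_trans ?_ hL
    exact pow_le_pow_right₀ (by linarith) (by omega)
  have hE : (i + ‖s‖) * (8 * A) / √N ≤ (i + 3) * (8 * A) * t ^ ε := by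
    rw [div_le_iff₀ (by linarith)]
    have : (i + ‖s‖ : ℝ) ≤ (i + 3) * t := by nlinarith [(Nat.cast_nonneg i : (0:ℝ) ≤ i)]
    calc (i + ‖s‖) * (8 * A) ≤ (i + 3) * t * (8 * A) := by gcongr
      _ = (i + 3) * (8 * A) * 1 * t := by ring
      _ ≤ (i + 3) * (8 * A) * t ^ ε * √N := by gcongr
  have hf : (0 : ℝ) ≤ (i + 1).factorial := by positivity
  calc _ ≤ _ := hmain
    _ ≤ B * 2 ^ (ε / 2) * t ^ ε + (i + 1).factorial * (B * 2 ^ (ε / 2) * t ^ ε)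
        + (i + 3) * (8 * A) * t ^ ε := by gcongr
    _ = _ := by ring

/-- The arithmetic function `n ↦ log n ^ i * Λ n`. -/
def logPowVonMangoldt (i : ℕ) : ℕ → ℂ :=
  fun n => (Real.log n : ℂ) ^ i * (ArithmeticFunction.vonMangoldt n : ℂ)

lemma logMul_logPowVonMangoldt (i : ℕ) :
    LSeries.logMul (logPowVonMangoldt i) = logPowVonMangoldt (i + 1) := by
  ext n
  simp only [LSeries.logMul, logPowVonMangoldt, Complex.natCast_log]
  ring

lemma abscissaOfAbsConv_logPowVonMangoldt (i : ℕ) :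
    LSeries.abscissaOfAbsConv (logPowVonMangoldt i) ≤ 1 := by
  induction i with
  | zero =>
    apply LSeries.abscissaOfAbsConv_le_of_forall_lt_LSeriesSummable'
    intro y hy
    have := ArithmeticFunction.LSeriesSummable_vonMangoldt (s := (y : ℂ)) (by exact_mod_cast hy)
    convert this using 2
    simp [logPowVonMangoldt]
  | succ i ih => rw [← logMul_logPowVonMangoldt, LSeries.abscissaOfAbsConv_logMul]; exact ih

lemma hasDerivAt_LSeries_logPow (i : ℕ) {s : ℂ} (hs : 1 < s.re) :
    HasDerivAt (LSeries (logPow i)) (-LSeries (logPow (i + 1)) s) s := by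
  rw [← logMul_logPow]
  apply LSeries_hasDerivAt
  rw [abscissaOfAbsConv_logPow]
  exact_mod_cast hs

lemma hasDerivAt_LSeries_logPowVonMangoldt (i : ℕ) {s : ℂ} (hs : 1 < s.re) :
    HasDerivAt (LSeries (logPowVonMangoldt i)) (-LSeries (logPowVonMangoldt (i + 1)) s) s := by
  rw [← logMul_logPowVonMangoldt]
  apply LSeries_hasDerivAt
  exact (abscissaOfAbsConv_logPowVonMangoldt i).trans_lt (by exact_mod_cast hs)

lemma LSeries_logPow_zero_eq {s : ℂ} (hs : 1 < s.re) : LSeries (logPow 0) s = riemannZeta s := by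
  rw [logPow_zero, LSeries_one_eq_riemannZeta hs]

lemma LSeries_logPow_zero_ne_zero {s : ℂ} (hs : 1 < s.re) : LSeries (logPow 0) s ≠ 0 := by
  rw [LSeries_logPow_zero_eq hs]
  exact riemannZeta_ne_zero_of_one_le_re hs.le

lemma eventually_one_lt_re {s : ℂ} (hs : 1 < s.re) : ∀ᶠ z in nhds s, 1 < z.re :=
  (isOpen_lt continuous_const Complex.continuous_re).mem_nhds hs

lemma LSeries_logPowVonMangoldt_relation_zero {s : ℂ} (hs : 1 < s.re) :
    LSeries (logPow 0) s * LSeries (logPowVonMangoldt 0) s = LSeries (logPow 1) s := by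
  have h := ArithmeticFunction.LSeries_vonMangoldt_eq hs
  have e : logPowVonMangoldt 0 = fun n => (ArithmeticFunction.vonMangoldt n : ℂ) := by
    ext n; simp [logPowVonMangoldt]
  rw [e, h, ← logPow_zero, (hasDerivAt_LSeries_logPow 0 hs).deriv]
  field_simp [LSeries_logPow_zero_ne_zero hs]

lemma LSeries_logPowVonMangoldt_relation_one {s : ℂ} (hs : 1 < s.re) :
    LSeries (logPow 1) s * LSeries (logPowVonMangoldt 0) s
      + LSeries (logPow 0) s * LSeries (logPowVonMangoldt 1) s = LSeries (logPow 2) s := by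
  have h1 := (hasDerivAt_LSeries_logPow 0 hs).mul (hasDerivAt_LSeries_logPowVonMangoldt 0 hs)
  have h2 := hasDerivAt_LSeries_logPow 1 hs
  have h3 : (LSeries (logPow 0) * LSeries (logPowVonMangoldt 0)) =ᶠ[nhds s] LSeries (logPow 1) := by
    filter_upwards [eventually_one_lt_re hs] with z hz
    exact LSeries_logPowVonMangoldt_relation_zero hz
  have h4 := (h1.congr_of_eventuallyEq h3.symm).unique h2
  linear_combination -h4

lemma LSeries_logPowVonMangoldt_relation_two {s : ℂ} (hs : 1 < s.re) :
    LSeries (logPow 2) s * LSeries (logPowVonMangoldt 0) s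
      + 2 * (LSeries (logPow 1) s * LSeries (logPowVonMangoldt 1) s)
      + LSeries (logPow 0) s * LSeries (logPowVonMangoldt 2) s = LSeries (logPow 3) s := by
  have h1 := ((hasDerivAt_LSeries_logPow 1 hs).mul (hasDerivAt_LSeries_logPowVonMangoldt 0 hs)).add
    ((hasDerivAt_LSeries_logPow 0 hs).mul (hasDerivAt_LSeries_logPowVonMangoldt 1 hs))
  have h2 := hasDerivAt_LSeries_logPow 2 hs
  have h3 : (LSeries (logPow 1) * LSeries (logPowVonMangoldt 0)
      + LSeries (logPow 0) * LSeries (logPowVonMangoldt 1)) =ᶠ[nhds s] LSeries (logPow 2) := by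
    filter_upwards [eventually_one_lt_re hs] with z hz
    exact LSeries_logPowVonMangoldt_relation_one hz
  have h4 := (h1.congr_of_eventuallyEq h3.symm).unique h2
  linear_combination -h4

/-- The entire function `(s - 1) ζ(s)`. -/
def zetaReg : ℂ → ℂ := DirichletCharacter.LFunctionTrivChar₁ 1

lemma zetaReg_one : zetaReg 1 = 1 := by
  simp [zetaReg, DirichletCharacter.LFunctionTrivChar₁]

lemma zetaReg_of_ne_one {s : ℂ} (hs : s ≠ 1) : zetaReg s = (s - 1) * riemannZeta s := by
  rw [zetaReg, DirichletCharacter.LFunctionTrivChar₁, Function.update_of_ne hs,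
    DirichletCharacter.LFunctionTrivChar, DirichletCharacter.LFunction_modOne_eq]

lemma differentiable_zetaReg : Differentiable ℂ zetaReg :=
  DirichletCharacter.differentiable_LFunctionTrivChar₁ 1

lemma zetaReg_ne_zero {s : ℂ} (hs : 1 ≤ s.re) : zetaReg s ≠ 0 := by
  rcases eq_or_ne s 1 with rfl | h
  · rw [zetaReg_one]; exact one_ne_zero
  · rw [zetaReg_of_ne_one h]
    exact mul_ne_zero (sub_ne_zero.2 h) (riemannZeta_ne_zero_of_one_le_re hs)

lemma ne_one_of_one_lt_re {s : ℂ} (hs : 1 < s.re) : s ≠ 1 := by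
  rintro rfl; simp at hs

/-- The compact rectangle `[1,2] × [-1,1]`. -/
lemma isCompact_rectangle : IsCompact (Set.Icc (1 : ℝ) 2 ×ℂ Set.Icc (-1 : ℝ) 1) :=
  isCompact_Icc.reProdIm isCompact_Icc

lemma exists_norm_zeta_real_le : ∃ C : ℝ, 1 ≤ C ∧ ∀ x : ℝ, 0 < x → x ≤ 1 →
    ‖LSeries (logPow 0) (1 + x)‖ ≤ C / x := by
  obtain ⟨C, hC⟩ := isCompact_rectangle.exists_bound_of_continuousOn
    differentiable_zetaReg.continuous.continuousOn
  refine ⟨max C 1, le_max_right _ _, fun x hx hx1 => ?_⟩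
  have hre : 1 < (1 + (x : ℂ)).re := by simpa using hx
  have h := hC (1 + x) (by
    rw [Complex.mem_reProdIm]
    simp only [Complex.add_re, Complex.one_re, Complex.ofReal_re, Complex.add_im, Complex.one_im,
      Complex.ofReal_im, Set.mem_Icc]
    exact ⟨⟨by linarith, by linarith⟩, by norm_num, by norm_num⟩)
  rw [zetaReg_of_ne_one (ne_one_of_one_lt_re hre), norm_mul, add_sub_cancel_left,
    Complex.norm_real, Real.norm_of_nonneg hx.le] at h
  rw [LSeries_logPow_zero_eq hre, le_div_iff₀ hx, mul_comm]
  exact h.trans (le_max_left _ _)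

lemma exists_norm_LSeries_diff_le_of_abs_im_le_one : ∃ C : ℝ, 0 ≤ C ∧ ∀ s : ℂ, 1 < s.re → s.re ≤ 2 →
    |s.im| ≤ 1 → ‖LSeries (logPowVonMangoldt 2) s - LSeries (logPow 2) s‖ ≤ C := by
  set G : ℂ → ℂ := fun s => -deriv zetaReg s / zetaReg s - dslope zetaReg 1 s with hG
  set U : Set ℂ := {s | zetaReg s ≠ 0} with hU
  have hUo : IsOpen U := isOpen_ne_fun differentiable_zetaReg.continuous continuous_const
  have hGd : DifferentiableOn ℂ G U := by
    apply DifferentiableOn.sub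
    · apply DifferentiableOn.div
      · exact (differentiable_zetaReg.differentiableOn.deriv isOpen_univ).neg.mono
          (Set.subset_univ _)
      · exact differentiable_zetaReg.differentiableOn
      · exact fun x hx => hx
    · exact ((Complex.differentiableOn_dslope Filter.univ_mem).2
        differentiable_zetaReg.differentiableOn).mono (Set.subset_univ _)
  have hG2 : ContinuousOn (deriv (deriv G)) U := ((hGd.deriv hUo).deriv hUo).continuousOn
  have hKU : (Set.Icc (1 : ℝ) 2 ×ℂ Set.Icc (-1 : ℝ) 1) ⊆ U := by
    intro s hs
    rw [Complex.mem_reProdIm] at hs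
    exact zetaReg_ne_zero hs.1.1
  obtain ⟨C, hC⟩ := isCompact_rectangle.exists_bound_of_continuousOn (hG2.mono hKU)
  have h0 : ∀ s : ℂ, 1 < s.re → LSeries (logPowVonMangoldt 0) s - LSeries (logPow 0) s = G s := by
    intro s hs
    have hs1 := ne_one_of_one_lt_re hs
    have hs1' := sub_ne_zero.2 hs1
    have hz := LSeries_logPow_zero_ne_zero hs
    have hev : zetaReg =ᶠ[nhds s] fun z => (z - 1) * LSeries (logPow 0) z := by
      filter_upwards [eventually_one_lt_re hs] with z hz
      rw [zetaReg_of_ne_one (ne_one_of_one_lt_re hz), LSeries_logPow_zero_eq hz]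
    have hd : deriv zetaReg s = LSeries (logPow 0) s - (s - 1) * LSeries (logPow 1) s := by
      rw [hev.deriv_eq]
      have := (((hasDerivAt_id s).sub_const 1).mul (hasDerivAt_LSeries_logPow 0 hs)).deriv
      simp only [id] at this
      refine Eq.trans this ?_
      ring
    have hB := LSeries_logPowVonMangoldt_relation_zero hs
    have hB' : LSeries (logPowVonMangoldt 0) s = LSeries (logPow 1) s / LSeries (logPow 0) s := by
      rw [eq_div_iff hz, mul_comm]; exact hB
    rw [hG, hB']
    simp only
    rw [dslope_of_ne _ hs1, slope_def_field, zetaReg_one, hd, hev.eq_of_nhds]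
    field_simp
    ring
  have hev : ∀ s : ℂ, 1 < s.re → (fun z => LSeries (logPowVonMangoldt 0) z - LSeries (logPow 0) z)
      =ᶠ[nhds s] G := by
    intro s hs
    filter_upwards [eventually_one_lt_re hs] with z hz using h0 z hz
  have h1 : ∀ s : ℂ, 1 < s.re →
      deriv G s = -(LSeries (logPowVonMangoldt 1) s - LSeries (logPow 1) s) := by
    intro s hs
    rw [← (hev s hs).deriv_eq]
    have := ((hasDerivAt_LSeries_logPowVonMangoldt 0 hs).sub (hasDerivAt_LSeries_logPow 0 hs)).deriv
    refine Eq.trans this ?_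
    ring
  have h2 : ∀ s : ℂ, 1 < s.re →
      deriv (deriv G) s = LSeries (logPowVonMangoldt 2) s - LSeries (logPow 2) s := by
    intro s hs
    have hev1 : deriv G =ᶠ[nhds s]
        fun z => -(LSeries (logPowVonMangoldt 1) z - LSeries (logPow 1) z) := by
      filter_upwards [eventually_one_lt_re hs] with z hz using h1 z hz
    rw [hev1.deriv_eq]
    have := ((hasDerivAt_LSeries_logPowVonMangoldt 1 hs).sub
      (hasDerivAt_LSeries_logPow 1 hs)).neg.deriv
    refine Eq.trans this ?_
    ring
  refine ⟨max C 0, le_max_right _ _, fun s hs hs2 ht => ?_⟩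
  rw [← h2 s hs]
  refine (hC s ?_).trans (le_max_left _ _)
  rw [Complex.mem_reProdIm]
  exact ⟨⟨hs.le, hs2⟩, abs_le.1 ht⟩

lemma norm_LSeries_product_ge_one {x : ℝ} (hx : 0 < x) (y : ℝ) :
    1 ≤ ‖LSeries (logPow 0) (1 + x)‖ ^ 3 * ‖LSeries (logPow 0) (1 + x + Complex.I * y)‖ ^ 4
      * ‖LSeries (logPow 0) (1 + x + 2 * Complex.I * y)‖ := by
  have h := DirichletCharacter.norm_LFunction_product_ge_one (N := 1) 1 hx y
  simp only [DirichletCharacter.LFunctionTrivChar, DirichletCharacter.LFunction_modOne_eq,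
    norm_mul, norm_pow] at h
  rw [LSeries_logPow_zero_eq, LSeries_logPow_zero_eq, LSeries_logPow_zero_eq]
  · exact h
  all_goals simp [hx]

set_option maxHeartbeats 400000 in
/-- A quantitative form of the non-vanishing of the zeta function on the line `Re s = 1`. -/
lemma exists_norm_LSeries_logPow_zero_ge : ∃ D : ℝ, 1 ≤ D ∧ ∀ s : ℂ, 1 < s.re → s.re ≤ 2 →
    1 ≤ |s.im| → ∀ u : ℝ, 1 ≤ u → u ^ 16 = |s.im| →
    (∀ i ≤ 3, ‖LSeries (logPow i) s‖ ≤ D * u) ∧ 1 ≤ D * u ^ 4 * ‖LSeries (logPow 0) s‖ := by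
  choose C hC1 hC using fun i : ℕ => exists_norm_LSeries_logPow_le i (ε := 1 / 16) (by norm_num)
  obtain ⟨E, hE1, hE⟩ := exists_norm_zeta_real_le
  set B : ℝ := C 0 + C 1 + C 2 + C 3 with hB
  have hCB : ∀ i ≤ 3, C i ≤ B := by
    intro i hi
    have := hC1 0; have := hC1 1; have := hC1 2; have := hC1 3
    interval_cases i <;> linarith
  have hB1 : 1 ≤ B := (hC1 0).trans (hCB 0 (by norm_num))
  have hbd : ∀ i ≤ 3, ∀ s : ℂ, 1 < s.re → s.re ≤ 2 → 1 ≤ |s.im| → ∀ u : ℝ, 1 ≤ u →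
      u ^ 16 = |s.im| → ‖LSeries (logPow i) s‖ ≤ B * u := by
    intro i hi s h1 h2 h3 u hu hus
    refine (hC i s h1 h2 h3).trans ?_
    have e : |s.im| ^ (1 / 16 : ℝ) = u := by
      rw [← hus, ← Real.rpow_natCast, ← Real.rpow_mul (by linarith)]
      norm_num
    rw [e]
    gcongr
    exact hCB i hi
  set F : ℝ := E ^ 3 * (2 * B) with hF
  have hF1 : 1 ≤ F := by
    have : 1 ≤ E ^ 3 := one_le_pow₀ hE1
    nlinarith
  set κ : ℝ := 1 / (16 * B ^ 4 * F) with hκ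
  have hB4 : 1 ≤ B ^ 4 := one_le_pow₀ hB1
  have hκ0 : 0 < κ := by positivity
  have hκ1 : κ ≤ 1 := by
    rw [hκ, div_le_one (by positivity)]
    nlinarith [mul_le_mul hB4 hF1 (by norm_num) (by positivity)]
  -- the bound at distance `x` from the line
  have hfar : ∀ x : ℝ, 0 < x → x ≤ 1 → ∀ y : ℝ, 1 ≤ |y| → ∀ u : ℝ, 1 ≤ u → u ^ 16 = |y| →
      κ * u⁻¹ ^ 5 ≤ x → 2 * (B * κ) * u⁻¹ ^ 4 ≤ ‖LSeries (logPow 0) (1 + x + Complex.I * y)‖ := by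
    intro x hx hx1 y hy u hu huy hxu
    have hu0 : 0 < u := by linarith
    have h := norm_LSeries_product_ge_one hx y
    have h1 : ‖LSeries (logPow 0) (1 + x + 2 * Complex.I * y)‖ ≤ B * (2 * u) := by
      have him : (1 + (x : ℂ) + 2 * Complex.I * y).im = 2 * y := by simp
      have hb := hC 0 (1 + x + 2 * Complex.I * y) (by simp [hx]) (by simp; linarith) (by
        rw [him, abs_mul, abs_two]; linarith)
      rw [him, abs_mul, abs_two, Real.mul_rpow (by norm_num) (abs_nonneg _)] at hb
      have e : |y| ^ (1 / 16 : ℝ) = u := by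
        rw [← huy, ← Real.rpow_natCast, ← Real.rpow_mul (by linarith)]
        norm_num
      have e2 : (2 : ℝ) ^ (1 / 16 : ℝ) ≤ 2 := by
        calc (2 : ℝ) ^ (1 / 16 : ℝ) ≤ 2 ^ (1 : ℝ) :=
              Real.rpow_le_rpow_of_exponent_le (by norm_num) (by norm_num)
          _ = 2 := Real.rpow_one _
      rw [e] at hb
      refine hb.trans ?_
      gcongr
      exact hCB 0 (by norm_num)
    have h2 : ‖LSeries (logPow 0) (1 + x)‖ ≤ E / (κ * u⁻¹ ^ 5) :=
      (hE x hx hx1).trans (by gcongr)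
    set w := ‖LSeries (logPow 0) (1 + x + Complex.I * y)‖ with hw
    have hw0 : 0 ≤ w := norm_nonneg _
    have h3 : 1 ≤ (E / (κ * u⁻¹ ^ 5)) ^ 3 * w ^ 4 * (B * (2 * u)) := by
      refine h.trans ?_
      gcongr
    have h4 : (2 * (B * κ) * u⁻¹ ^ 4) ^ 4 ≤ w ^ 4 := by
      have e : (2 * (B * κ) * u⁻¹ ^ 4) ^ 4 = κ ^ 3 / F * u⁻¹ ^ 16 := by
        have : κ * (16 * B ^ 4 * F) = 1 := by
          rw [hκ]; exact one_div_mul_cancel (by positivity)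
        rw [div_mul_eq_mul_div, eq_div_iff (by positivity)]
        linear_combination κ ^ 3 * u⁻¹ ^ 16 * this
      rw [e]
      have e2 : (E / (κ * u⁻¹ ^ 5)) ^ 3 * w ^ 4 * (B * (2 * u)) = w ^ 4 * (F / κ ^ 3 * u ^ 16) := by
        rw [hF]
        field_simp
      rw [e2] at h3
      calc κ ^ 3 / F * u⁻¹ ^ 16 = κ ^ 3 / F * u⁻¹ ^ 16 * 1 := by ring
        _ ≤ κ ^ 3 / F * u⁻¹ ^ 16 * (w ^ 4 * (F / κ ^ 3 * u ^ 16)) := by gcongr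
        _ = w ^ 4 := by field_simp
    exact le_of_pow_le_pow_left₀ (by norm_num) hw0 h4
  refine ⟨max B (1 / (B * κ)), hB1.trans (le_max_left _ _), ?_⟩
  intro s h1 h2 h3 u hu hus
  have hu0 : 0 < u := by linarith
  constructor
  · intro i hi
    refine (hbd i hi s h1 h2 h3 u hu hus).trans ?_
    gcongr
    exact le_max_left _ _
  have key : (B * κ) * u⁻¹ ^ 4 ≤ ‖LSeries (logPow 0) s‖ := by
    have hui1 : u⁻¹ ≤ 1 := inv_le_one_of_one_le₀ hu
    have hui0 : 0 < u⁻¹ := by positivity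
    have hs' : s = 1 + ((s.re - 1 : ℝ) : ℂ) + Complex.I * (s.im : ℝ) := by
      apply Complex.ext <;> simp
    by_cases hx : κ * u⁻¹ ^ 5 ≤ s.re - 1
    · have := hfar (s.re - 1) (by linarith) (by linarith) s.im h3 u hu hus hx
      rw [← hs'] at this
      refine le_trans ?_ this
      have : 0 ≤ B * κ * u⁻¹ ^ 4 := by positivity
      linarith
    · push Not at hx
      set x := κ * u⁻¹ ^ 5 with hxd
      have hx0 : 0 < x := by positivity
      have hx1 : x ≤ 1 := by
        have : u⁻¹ ^ 5 ≤ 1 := pow_le_one₀ hui0.le hui1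
        nlinarith
      have h5 := hfar x hx0 hx1 s.im h3 u hu hus le_rfl
      set z : ℂ := 1 + x + Complex.I * s.im with hz
      have hzre : z.re = 1 + x := by simp [hz]
      have hzim : z.im = s.im := by simp [hz]
      have hmv : ‖LSeries (logPow 0) z - LSeries (logPow 0) s‖ ≤ B * u * ‖z - s‖ := by
        have hconv : ∀ a b : ℝ, 0 ≤ a → 0 ≤ b → a + b = 1 →
            1 < a * s.re + b * (1 + x) ∧ a * s.re + b * (1 + x) ≤ 2 := fun a b ha hb hab =>
          (convex_Ioc (1 : ℝ) 2) ⟨h1, h2⟩ ⟨by linarith, by linarith⟩ ha hb hab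
        apply (convex_segment s z).norm_image_sub_le_of_norm_hasDerivWithin_le
          (f := LSeries (logPow 0)) (f' := fun p => -LSeries (logPow 1) p)
        · intro p hp
          obtain ⟨a, b, ha, hb, hab, rfl⟩ := hp
          refine (hasDerivAt_LSeries_logPow 0 ?_).hasDerivWithinAt
          simp only [Complex.add_re, Complex.real_smul, Complex.mul_re, Complex.ofReal_re,
            Complex.ofReal_im, zero_mul, sub_zero, hzre]
          exact (hconv a b ha hb hab).1
        · intro p hp
          obtain ⟨a, b, ha, hb, hab, rfl⟩ := hp
          have him : (a • s + b • z).im = s.im := by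
            simp only [Complex.add_im, Complex.real_smul, Complex.mul_im, Complex.ofReal_re,
              Complex.ofReal_im, zero_mul, add_zero, hzim]
            rw [← add_mul, hab, one_mul]
          have hre : (a • s + b • z).re = a * s.re + b * (1 + x) := by
            simp only [Complex.add_re, Complex.real_smul, Complex.mul_re, Complex.ofReal_re,
              Complex.ofReal_im, zero_mul, sub_zero, hzre]
          rw [norm_neg]
          apply hbd 1 (by norm_num)
          · rw [hre]; exact (hconv a b ha hb hab).1
          · rw [hre]; exact (hconv a b ha hb hab).2
          · rw [him]; exact h3
          · exact hu
          · rw [him]; exact hus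
        · exact left_mem_segment ℝ s z
        · exact right_mem_segment ℝ s z
      have hzs : ‖z - s‖ ≤ x := by
        have e : z - s = ((x - (s.re - 1) : ℝ) : ℂ) := by
          apply Complex.ext
          · simp [hzre]; ring
          · simp [hzim]
        rw [e, Complex.norm_real, Real.norm_of_nonneg (by linarith)]
        linarith
      have h6 : B * u * ‖z - s‖ ≤ B * κ * u⁻¹ ^ 4 := by
        calc B * u * ‖z - s‖ ≤ B * u * x := by gcongr
          _ = B * κ * u⁻¹ ^ 4 := by rw [hxd]; field_simp
      have h7 : ‖LSeries (logPow 0) z‖ ≤ ‖LSeries (logPow 0) z - LSeries (logPow 0) s‖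
          + ‖LSeries (logPow 0) s‖ := by
        have := norm_add_le (LSeries (logPow 0) z - LSeries (logPow 0) s) (LSeries (logPow 0) s)
        rwa [sub_add_cancel] at this
      linarith
  calc (1 : ℝ) = 1 / (B * κ) * u ^ 4 * (B * κ * u⁻¹ ^ 4) := by field_simp
    _ ≤ max B (1 / (B * κ)) * u ^ 4 * ‖LSeries (logPow 0) s‖ := by
      gcongr
      exact le_max_right _ _

/-- The bound for the second derivative of `(deriv ζ) / ζ + ζ` near the line `Re s = 1`
that drives the prime number theorem. -/
theorem exists_norm_LSeries_diff_le : ∃ C : ℝ, 0 ≤ C ∧ ∀ s : ℂ, 1 < s.re → s.re ≤ 2 →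
    ‖LSeries (logPowVonMangoldt 2) s - LSeries (logPow 2) s‖ ≤ C * (1 + |s.im|) := by
  obtain ⟨C, hC0, hC⟩ := exists_norm_LSeries_diff_le_of_abs_im_le_one
  obtain ⟨D, hD1, hD⟩ := exists_norm_LSeries_logPow_zero_ge
  refine ⟨C + 7 * D ^ 6, by positivity, fun s h1 h2 => ?_⟩
  rcases le_total |s.im| 1 with ht | ht
  · refine (hC s h1 h2 ht).trans ?_
    have : 0 ≤ D ^ 6 := by positivity
    nlinarith [abs_nonneg s.im]
  set u : ℝ := |s.im| ^ (1 / 16 : ℝ) with hu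
  have hu1 : 1 ≤ u := Real.one_le_rpow ht (by norm_num)
  have hu16 : u ^ 16 = |s.im| := by
    rw [hu, ← Real.rpow_natCast, ← Real.rpow_mul (abs_nonneg _)]
    norm_num
  obtain ⟨hA, hlow⟩ := hD s h1 h2 ht u hu1 hu16
  have hinv : ∀ v : ℂ, ‖v‖ ≤ D * u ^ 4 * ‖LSeries (logPow 0) s * v‖ := by
    intro v
    rw [norm_mul]
    calc ‖v‖ = 1 * ‖v‖ := (one_mul _).symm
      _ ≤ D * u ^ 4 * ‖LSeries (logPow 0) s‖ * ‖v‖ := by gcongr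
      _ = _ := by ring
  set A1 := LSeries (logPow 1) s
  set A2 := LSeries (logPow 2) s
  set A3 := LSeries (logPow 3) s
  set B0 := LSeries (logPowVonMangoldt 0) s
  set B1 := LSeries (logPowVonMangoldt 1) s
  set B2 := LSeries (logPowVonMangoldt 2) s
  have hA1 : ‖A1‖ ≤ D * u := hA 1 (by norm_num)
  have hA2 : ‖A2‖ ≤ D * u := hA 2 (by norm_num)
  have hA3 : ‖A3‖ ≤ D * u := hA 3 (by norm_num)
  have hB0 : ‖B0‖ ≤ D ^ 2 * u ^ 5 := by
    refine (hinv B0).trans ?_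
    rw [LSeries_logPowVonMangoldt_relation_zero h1]
    calc D * u ^ 4 * ‖A1‖ ≤ D * u ^ 4 * (D * u) := by gcongr
      _ = _ := by ring
  have hB1 : ‖B1‖ ≤ 2 * D ^ 4 * u ^ 10 := by
    refine (hinv B1).trans ?_
    have e : LSeries (logPow 0) s * B1 = A2 - A1 * B0 := by
      linear_combination LSeries_logPowVonMangoldt_relation_one h1
    rw [e]
    have h3 : ‖A2 - A1 * B0‖ ≤ D * u + D * u * (D ^ 2 * u ^ 5) := by
      refine (norm_sub_le _ _).trans ?_
      rw [norm_mul]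
      gcongr
    calc D * u ^ 4 * ‖A2 - A1 * B0‖ ≤ D * u ^ 4 * (D * u + D * u * (D ^ 2 * u ^ 5)) := by gcongr
      _ = D ^ 2 * u ^ 5 + D ^ 4 * u ^ 10 := by ring
      _ ≤ D ^ 4 * u ^ 10 + D ^ 4 * u ^ 10 := by
        gcongr <;> first | assumption | norm_num
      _ = _ := by ring
  have hB2 : ‖B2‖ ≤ 6 * D ^ 6 * u ^ 15 := by
    refine (hinv B2).trans ?_
    have e : LSeries (logPow 0) s * B2 = A3 - A2 * B0 - 2 * (A1 * B1) := by
      linear_combination LSeries_logPowVonMangoldt_relation_two h1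
    rw [e]
    have h3 : ‖A3 - A2 * B0 - 2 * (A1 * B1)‖
        ≤ D * u + D * u * (D ^ 2 * u ^ 5) + 2 * (D * u * (2 * D ^ 4 * u ^ 10)) := by
      refine (norm_sub_le _ _).trans ?_
      have : ‖A3 - A2 * B0‖ ≤ D * u + D * u * (D ^ 2 * u ^ 5) := by
        refine (norm_sub_le _ _).trans ?_
        rw [norm_mul]
        gcongr
      rw [norm_mul, norm_mul, Complex.norm_two]
      gcongr
    calc D * u ^ 4 * ‖A3 - A2 * B0 - 2 * (A1 * B1)‖
        ≤ D * u ^ 4 * (D * u + D * u * (D ^ 2 * u ^ 5) + 2 * (D * u * (2 * D ^ 4 * u ^ 10))) := by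
          gcongr
      _ = D ^ 2 * u ^ 5 + D ^ 4 * u ^ 10 + 4 * D ^ 6 * u ^ 15 := by ring
      _ ≤ D ^ 6 * u ^ 15 + D ^ 6 * u ^ 15 + 4 * D ^ 6 * u ^ 15 := by
        gcongr <;> first | assumption | norm_num
      _ = _ := by ring
  have h15 : u ^ 15 ≤ |s.im| := by
    rw [← hu16]
    exact pow_le_pow_right₀ hu1 (by norm_num)
  have hu15 : D * u ≤ D ^ 6 * u ^ 15 := by
    have e1 : D ^ 1 ≤ D ^ 6 := pow_le_pow_right₀ hD1 (by norm_num)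
    have e2 : u ^ 1 ≤ u ^ 15 := pow_le_pow_right₀ hu1 (by norm_num)
    simp only [pow_one] at e1 e2
    gcongr
  calc ‖B2 - A2‖ ≤ ‖B2‖ + ‖A2‖ := norm_sub_le _ _
    _ ≤ 6 * D ^ 6 * u ^ 15 + D ^ 6 * u ^ 15 := add_le_add hB2 (hA2.trans hu15)
    _ = 7 * D ^ 6 * u ^ 15 := by ring
    _ ≤ 7 * D ^ 6 * |s.im| := by gcongr
    _ ≤ (C + 7 * D ^ 6) * (1 + |s.im|) := by
      have : 0 ≤ 7 * D ^ 6 := by positivity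
      nlinarith [abs_nonneg s.im]

lemma exists_smooth_cutoff : ∃ (f : ℝ → ℝ) (φ : ℝ → ℂ), (∀ x, 0 ≤ f x ∧ f x ≤ 1) ∧
    (∀ x, 1 / 4 ≤ x → x ≤ 3 / 4 → f x = 1) ∧ (∀ x, f x ≠ 0 → 0 < x ∧ x < 1) ∧
    MeasureTheory.Integrable φ ∧ MeasureTheory.Integrable (fun w => |w| * ‖φ w‖) ∧
    ∀ x, (f x : ℂ) = ∫ w, Complex.exp ((2 * Real.pi * (w * x) : ℝ) * Complex.I) * φ w := by
  let b : ContDiffBump (1 / 2 : ℝ) := ⟨1 / 4, 1 / 2, by norm_num, by norm_num⟩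
  have hcd : ContDiff ℝ (⊤ : ℕ∞) (fun x => (b x : ℂ)) :=
    Complex.ofRealCLM.contDiff.comp b.contDiff
  have hcs : HasCompactSupport (fun x => (b x : ℂ)) :=
    b.hasCompactSupport.comp_left (g := fun y : ℝ => (y : ℂ)) (by simp)
  let g : SchwartzMap ℝ ℂ := hcs.toSchwartzMap hcd
  let φ : SchwartzMap ℝ ℂ := FourierTransform.fourier g
  refine ⟨b, φ, fun x => ⟨b.nonneg, b.le_one⟩, ?_, ?_, φ.integrable, ?_, ?_⟩
  · intro x h1 h2
    apply b.one_of_mem_closedBall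
    rw [Real.closedBall_eq_Icc]
    constructor
    · change 1 / 2 - 1 / 4 ≤ x; linarith
    · change x ≤ 1 / 2 + 1 / 4; linarith
  · intro x hx
    have : x ∈ Function.support b := hx
    rw [b.support_eq, Real.ball_eq_Ioo] at this
    obtain ⟨h1, h2⟩ := this
    change 1 / 2 - 1 / 2 < x at h1
    change x < 1 / 2 + 1 / 2 at h2
    exact ⟨by linarith, by linarith⟩
  · simpa using φ.integrable_pow_mul MeasureTheory.volume 1
  · intro x
    have h : FourierTransformInv.fourierInv φ = g := FourierTransform.fourierInv_fourier_eq g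
    have h1 : (b x : ℂ) = g x := rfl
    rw [h1, ← h, SchwartzMap.fourierInv_coe, Real.fourierInv_eq']
    congr 1
    ext w
    rw [smul_eq_mul]
    congr 4
    simp [mul_comm]

lemma term_mul_exp (c : ℕ → ℂ) (σ y : ℝ) (n : ℕ) :
    LSeries.term c σ n * Complex.exp ((y * Real.log n : ℝ) * Complex.I)
      = LSeries.term c (σ - y * Complex.I) n := by
  rcases eq_or_ne n 0 with rfl | hn
  · simp
  have hn' : (n : ℂ) ≠ 0 := by exact_mod_cast hn
  rw [LSeries.term_of_ne_zero hn, LSeries.term_of_ne_zero hn, Complex.cpow_sub _ _ hn']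
  have : (n : ℂ) ^ (y * Complex.I) = Complex.exp ((y * Real.log n : ℝ) * Complex.I) := by
    rw [Complex.cpow_def_of_ne_zero hn', ← Complex.natCast_log]
    congr 1
    push_cast
    ring
  rw [this]
  field_simp

lemma hasSum_term_mul_cutoff {f : ℝ → ℝ} {φ : ℝ → ℂ} (hφ : MeasureTheory.Integrable φ)
    (hf : ∀ x, (f x : ℂ) = ∫ w, Complex.exp ((2 * Real.pi * (w * x) : ℝ) * Complex.I) * φ w)
    (c : ℕ → ℂ) (σ K l : ℝ) (hc : LSeriesSummable c σ) :
    HasSum (fun n : ℕ => LSeries.term c σ n * (f (K * (Real.log n - l)) : ℂ))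
      (∫ w, φ w * Complex.exp ((-(2 * Real.pi * K * l * w) : ℝ) * Complex.I)
        * LSeries c (σ - (2 * Real.pi * K * w : ℝ) * Complex.I)) := by
  set F : ℕ → ℝ → ℂ := fun n w => LSeries.term c σ n *
    (Complex.exp ((2 * Real.pi * (w * (K * (Real.log n - l))) : ℝ) * Complex.I) * φ w) with hF
  have hint : ∀ n, MeasureTheory.Integrable (F n) := by
    intro n
    apply MeasureTheory.Integrable.const_mul
    apply hφ.bdd_mul (c := 1)
    · exact (Continuous.aestronglyMeasurable (by fun_prop))
    · exact Filter.Eventually.of_forall fun w => by rw [Complex.norm_exp_ofReal_mul_I]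
  have hnorm : ∀ n w, ‖F n w‖ = ‖LSeries.term c σ n‖ * ‖φ w‖ := by
    intro n w
    rw [hF, norm_mul, norm_mul, Complex.norm_exp_ofReal_mul_I, one_mul]
  have hsum : Summable fun n => ∫ w, ‖F n w‖ := by
    simp_rw [hnorm, MeasureTheory.integral_const_mul]
    exact (summable_norm_iff.2 hc).mul_right _
  have h := MeasureTheory.hasSum_integral_of_summable_integral_norm hint hsum
  have e1 : (fun n => ∫ w, F n w)
      = fun n : ℕ => LSeries.term c σ n * (f (K * (Real.log n - l)) : ℂ) := by
    ext n
    rw [hf, ← MeasureTheory.integral_const_mul]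
  have e2 : (fun w => ∑' n, F n w) = fun w =>
      φ w * Complex.exp ((-(2 * Real.pi * K * l * w) : ℝ) * Complex.I)
        * LSeries c (σ - (2 * Real.pi * K * w : ℝ) * Complex.I) := by
    ext w
    rw [LSeries, ← tsum_mul_left]
    congr 1
    ext n
    rw [← term_mul_exp, hF]
    simp only
    have : Complex.exp ((2 * Real.pi * (w * (K * (Real.log n - l))) : ℝ) * Complex.I)
        = Complex.exp ((-(2 * Real.pi * K * l * w) : ℝ) * Complex.I)
          * Complex.exp ((2 * Real.pi * K * w * Real.log n : ℝ) * Complex.I) := by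
      rw [← Complex.exp_add]
      congr 1
      push_cast
      ring
    rw [this]
    ring
  rw [e1, e2] at h
  exact h

/-- Smoothed prime number theorem in short intervals. -/
theorem exists_smoothed_vonMangoldt_bound : ∃ (f : ℝ → ℝ) (C : ℝ), (∀ x, 0 ≤ f x ∧ f x ≤ 1) ∧
    (∀ x, 1 / 4 ≤ x → x ≤ 3 / 4 → f x = 1) ∧ (∀ x, f x ≠ 0 → 0 < x ∧ x < 1) ∧ 0 ≤ C ∧
    ∀ K l σ : ℝ, 1 ≤ K → 1 < σ → σ ≤ 2 → ∃ S : ℝ, |S| ≤ C * K ∧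
      HasSum (fun n : ℕ => Real.log n ^ 2 * (ArithmeticFunction.vonMangoldt n - 1)
        / (n : ℝ) ^ σ * f (K * (Real.log n - l))) S := by
  obtain ⟨f, φ, hf01, hf1, hfs, hφ, hφ1, hfi⟩ := exists_smooth_cutoff
  obtain ⟨C, hC0, hC⟩ := exists_norm_LSeries_diff_le
  set I0 : ℝ := ∫ w, ‖φ w‖ with hI0
  set I1 : ℝ := ∫ w, |w| * ‖φ w‖ with hI1
  have hI00 : 0 ≤ I0 := MeasureTheory.integral_nonneg fun w => norm_nonneg _
  have hI10 : 0 ≤ I1 := MeasureTheory.integral_nonneg fun w => by positivity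
  have hpi := Real.pi_pos
  refine ⟨f, C * (I0 + 2 * Real.pi * I1), hf01, hf1, hfs, by positivity, ?_⟩
  intro K l σ hK hσ hσ2
  set c : ℕ → ℂ := logPowVonMangoldt 2 - logPow 2 with hc
  have hs1 : ∀ s : ℂ, 1 < s.re → LSeriesSummable (logPowVonMangoldt 2) s := fun s hs =>
    LSeriesSummable_of_abscissaOfAbsConv_lt_re
      ((abscissaOfAbsConv_logPowVonMangoldt 2).trans_lt (by exact_mod_cast hs))
  have hs2 : ∀ s : ℂ, 1 < s.re → LSeriesSummable (logPow 2) s := fun s hs =>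
    LSeriesSummable_of_abscissaOfAbsConv_lt_re
      ((abscissaOfAbsConv_logPow 2).trans_lt (by exact_mod_cast hs))
  have hre : 1 < (σ : ℂ).re := by simpa using hσ
  have h := hasSum_term_mul_cutoff hφ hfi c σ K l ((hs1 _ hre).sub (hs2 _ hre))
  set Z : ℂ := ∫ w, φ w * Complex.exp ((-(2 * Real.pi * K * l * w) : ℝ) * Complex.I)
        * LSeries c (σ - (2 * Real.pi * K * w : ℝ) * Complex.I) with hZ
  have hZb : ‖Z‖ ≤ C * (I0 + 2 * Real.pi * I1) * K := by
    have hb : ∀ w : ℝ, ‖φ w * Complex.exp ((-(2 * Real.pi * K * l * w) : ℝ) * Complex.I)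
        * LSeries c (σ - (2 * Real.pi * K * w : ℝ) * Complex.I)‖
        ≤ C * K * ‖φ w‖ + C * K * (2 * Real.pi) * (|w| * ‖φ w‖) := by
      intro w
      rw [norm_mul, norm_mul, Complex.norm_exp_ofReal_mul_I, mul_one]
      set s : ℂ := σ - (2 * Real.pi * K * w : ℝ) * Complex.I with hs
      have hsre : s.re = σ := by simp [hs]
      have hsim : s.im = -(2 * Real.pi * K * w) := by simp [hs]
      rw [hc, LSeries_sub (hs1 s (by rw [hsre]; exact hσ)) (hs2 s (by rw [hsre]; exact hσ))]
      have h1 := hC s (by rw [hsre]; exact hσ) (by rw [hsre]; exact hσ2)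
      rw [hsim, abs_neg, abs_mul, abs_of_pos (by positivity : 0 < 2 * Real.pi * K)] at h1
      have h2 : C * (1 + 2 * Real.pi * K * |w|) ≤ C * (K + 2 * Real.pi * K * |w|) := by gcongr
      calc _ ≤ ‖φ w‖ * (C * (K + 2 * Real.pi * K * |w|)) := by
            gcongr
            exact h1.trans h2
        _ = _ := by ring
    have hi : MeasureTheory.Integrable
        (fun w => C * K * ‖φ w‖ + C * K * (2 * Real.pi) * (|w| * ‖φ w‖)) :=
      (hφ.norm.const_mul _).add (hφ1.const_mul _)
    calc ‖Z‖ ≤ ∫ w, (C * K * ‖φ w‖ + C * K * (2 * Real.pi) * (|w| * ‖φ w‖)) :=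
          MeasureTheory.norm_integral_le_of_norm_le hi (Filter.Eventually.of_forall hb)
      _ = C * K * I0 + C * K * (2 * Real.pi) * I1 := by
        rw [MeasureTheory.integral_add (hφ.norm.const_mul _) (hφ1.const_mul _),
          MeasureTheory.integral_const_mul, MeasureTheory.integral_const_mul]
      _ = _ := by ring
  refine ⟨Z.re, (Complex.abs_re_le_norm Z).trans hZb, ?_⟩
  have h2 := Complex.hasSum_re h
  convert h2 using 2 with n
  rcases eq_or_ne n 0 with rfl | hn
  · simp
  rw [LSeries.term_of_ne_zero hn, hc]
  simp only [Pi.sub_apply, logPowVonMangoldt, logPow]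
  have e : (n : ℂ) ^ (σ : ℂ) = (((n : ℝ) ^ σ : ℝ) : ℂ) := by
    rw [Complex.ofReal_cpow (by positivity)]
    simp
  rw [e]
  have e2 : ((Real.log n : ℂ) ^ 2 * (ArithmeticFunction.vonMangoldt n : ℂ) - (Real.log n : ℂ) ^ 2)
      / (((n : ℝ) ^ σ : ℝ) : ℂ) * (f (K * (Real.log n - l)) : ℂ)
      = ((Real.log n ^ 2 * (ArithmeticFunction.vonMangoldt n - 1) / (n : ℝ) ^ σ
        * f (K * (Real.log n - l)) : ℝ) : ℂ) := by
    push_cast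
    ring
  rw [e2, Complex.ofReal_re]

set_option maxHeartbeats 2000000 in
/-- A lower bound for the number of primes in intervals of length `M / (8 * k)`, uniform for `k` up
to a small multiple of `log M`. -/
theorem exists_card_primes_ge : ∃ A : ℝ, 16 ≤ A ∧ ∀ M k : ℝ, A ≤ M → 1 ≤ k → A * k ≤ Real.log M →
    ∀ P : Finset ℕ, (∀ p : ℕ, p.Prime → M ≤ p → (p : ℝ) < M * (1 + 1 / (8 * k)) → p ∈ P) →
      M / (A * k * Real.log M) ≤ #P := by
  obtain ⟨f, C, hf01, hf1, hfs, hC0, hC⟩ := exists_smoothed_vonMangoldt_bound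
  obtain ⟨B, hB1, hB⟩ := exists_one_add_log_pow_le 2 (ε := 1 / 4) (by norm_num)
  set A : ℝ := 60000 + (216 * 256) * C + (13824 * B) ^ 4 with hA
  have hB4 : 0 ≤ (13824 * B) ^ 4 := by positivity
  refine ⟨A, by linarith [mul_nonneg (by norm_num : (0 : ℝ) ≤ 216 * 256) hC0], ?_⟩
  intro M k hM hk hkl P hP
  have hA1 : 60000 ≤ A := by linarith [mul_nonneg (by norm_num : (0 : ℝ) ≤ 216 * 256) hC0]
  have hM0 : 0 < M := by linarith
  set l := Real.log M with hl
  have hexpl : Real.exp l = M := Real.exp_log hM0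
  have hlA : A ≤ l := by nlinarith
  have hl0 : 0 < l := by linarith
  set K : ℝ := 16 * k with hK
  have hK1 : 1 ≤ K := by linarith
  have hK0 : 0 < K := by linarith
  have hKl : K ≤ l := by nlinarith
  have hCK : 216 * C * K ^ 2 ≤ l ^ 2 := by
    have h1 : 216 * 256 * C ≤ A := by linarith
    calc 216 * C * K ^ 2 = 216 * 256 * C * k * k := by rw [hK]; ring
      _ ≤ A * k * (A * k) := by
        have : k ≤ A * k := by nlinarith
        gcongr
      _ ≤ l * l := by gcongr
      _ = l ^ 2 := by ring
  have hlM : 13824 * l ^ 2 ≤ √M := by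
    have h1 : l ^ 2 ≤ B * M ^ (1 / 4 : ℝ) := by
      refine le_trans ?_ (hB M (by linarith))
      gcongr
      linarith
    have h2 : 13824 * B ≤ M ^ (1 / 4 : ℝ) := by
      have h3 : (13824 * B) ^ 4 ≤ M := by
        linarith [mul_nonneg (by norm_num : (0 : ℝ) ≤ 216 * 256) hC0]
      calc 13824 * B = ((13824 * B) ^ 4) ^ (1 / 4 : ℝ) := by
            rw [← Real.rpow_natCast, ← Real.rpow_mul (by positivity)]
            norm_num
        _ ≤ _ := by gcongr
    calc 13824 * l ^ 2 ≤ 13824 * (B * M ^ (1 / 4 : ℝ)) := by gcongr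
      _ = 13824 * B * M ^ (1 / 4 : ℝ) := by ring
      _ ≤ M ^ (1 / 4 : ℝ) * M ^ (1 / 4 : ℝ) := by gcongr
      _ = √M := by rw [← Real.rpow_add hM0, Real.sqrt_eq_rpow]; norm_num
  have hsqM : √M * √M = M := Real.mul_self_sqrt hM0.le
  have hsq1 : 1 ≤ √M := Real.one_le_sqrt.2 (by linarith)
  have h4K : 4 * K ≤ M := by nlinarith
  -- the smoothed count
  obtain ⟨S, hSb, hS⟩ := hC K l (1 + 1 / l) hK1 (by have : 0 < 1 / l := by positivity
                                                    linarith)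
    (by have : 1 / l ≤ 1 := by rw [div_le_one hl0]; linarith
        linarith)
  set σ : ℝ := 1 + 1 / l with hσ
  have hσ1 : 1 < σ := by
    have : 0 < 1 / l := by positivity
    linarith
  set a : ℕ := ⌈M⌉₊ with ha
  set b : ℕ := ⌈M * Real.exp (1 / K)⌉₊ with hb
  have hMa : M ≤ a := Nat.le_ceil _
  have hmem : ∀ n : ℕ, M ≤ n → (n : ℝ) < M * Real.exp (1 / K) → n ∈ Ico a b := by
    intro n h1 h2
    rw [mem_Ico]
    exact ⟨Nat.ceil_le.2 h1, Nat.lt_ceil.2 h2⟩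
  have hmem' : ∀ n ∈ Ico a b, M ≤ n ∧ (n : ℝ) < M * Real.exp (1 / K) := by
    intro n hn
    rw [mem_Ico] at hn
    exact ⟨Nat.ceil_le.1 hn.1, Nat.lt_ceil.1 hn.2⟩
  have hlogle : ∀ n ∈ Ico a b, l ≤ Real.log n ∧ Real.log n ≤ l + 1 / K := by
    intro n hn
    obtain ⟨h1, h2⟩ := hmem' n hn
    refine ⟨Real.log_le_log hM0 h1, ?_⟩
    have := Real.log_le_log (by linarith) h2.le
    rwa [Real.log_mul hM0.ne' (Real.exp_pos _).ne', Real.log_exp] at this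
  have hK1' : 1 / K ≤ 1 := by rw [div_le_one hK0]; exact hK1
  have hSsum : ∑ n ∈ Ico a b, Real.log n ^ 2 * (ArithmeticFunction.vonMangoldt n - 1)
        / (n : ℝ) ^ σ * f (K * (Real.log n - l)) = S := by
    refine (hasSum_sum_of_ne_finset_zero fun n hn => ?_).unique hS
    by_contra hne
    have hfn : f (K * (Real.log n - l)) ≠ 0 := fun h => hne (by rw [h, mul_zero])
    obtain ⟨h1, h2⟩ := hfs _ hfn
    have h3 : 0 < Real.log n - l := by
      by_contra hcon
      push Not at hcon
      nlinarith
    have hn0 : n ≠ 0 := by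
      rintro rfl
      simp at h3
      linarith
    have hn0' : (0 : ℝ) < n := by exact_mod_cast Nat.pos_of_ne_zero hn0
    apply hn
    apply hmem
    · exact (Real.log_le_log_iff hM0 hn0').1 (by linarith)
    · have h4 : Real.log n < l + 1 / K := by
        have : Real.log n - l < 1 / K := by rw [lt_div_iff₀ hK0]; linarith
        linarith
      rw [← Real.exp_log hn0', ← hexpl, ← Real.exp_add]
      exact Real.exp_lt_exp.2 h4
  have hupper : ∑ n ∈ Ico a b, Real.log n ^ 2 * ArithmeticFunction.vonMangoldt n
        / (n : ℝ) ^ σ * f (K * (Real.log n - l))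
      ≤ 4 * l ^ 2 / M * ∑ n ∈ Ico a b, ArithmeticFunction.vonMangoldt n := by
    rw [mul_sum]
    apply sum_le_sum
    intro n hn
    obtain ⟨h1, h2⟩ := hlogle n hn
    obtain ⟨h3, -⟩ := hmem' n hn
    have hL : 0 ≤ ArithmeticFunction.vonMangoldt n := ArithmeticFunction.vonMangoldt_nonneg
    have hpow : M ≤ (n : ℝ) ^ σ := by
      calc M ≤ (n : ℝ) := h3
        _ = (n : ℝ) ^ (1 : ℝ) := (Real.rpow_one _).symm
        _ ≤ _ := Real.rpow_le_rpow_of_exponent_le (by linarith) hσ1.le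
    have hlog : Real.log n ^ 2 ≤ 4 * l ^ 2 := by
      have : Real.log n ≤ 2 * l := by linarith
      nlinarith
    calc Real.log n ^ 2 * ArithmeticFunction.vonMangoldt n / (n : ℝ) ^ σ * f (K * (Real.log n - l))
        ≤ Real.log n ^ 2 * ArithmeticFunction.vonMangoldt n / (n : ℝ) ^ σ * 1 := by
          gcongr
          exact (hf01 _).2
      _ ≤ 4 * l ^ 2 * ArithmeticFunction.vonMangoldt n / M * 1 := by gcongr
      _ = _ := by ring
  set a' : ℕ := ⌈M * Real.exp (1 / (4 * K))⌉₊ with ha'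
  set b' : ℕ := ⌊M * Real.exp (3 / (4 * K))⌋₊ + 1 with hb'
  have hJmem : ∀ n ∈ Ico a' b', M * Real.exp (1 / (4 * K)) ≤ n ∧
      (n : ℝ) ≤ M * Real.exp (3 / (4 * K)) := by
    intro n hn
    rw [mem_Ico] at hn
    exact ⟨Nat.ceil_le.1 hn.1, (Nat.le_floor_iff (by positivity)).1 (by omega)⟩
  have hJsub : Ico a' b' ⊆ Ico a b := by
    intro n hn
    obtain ⟨h1, h2⟩ := hJmem n hn
    apply hmem
    · refine le_trans ?_ h1
      have : 1 ≤ Real.exp (1 / (4 * K)) := Real.one_le_exp (by positivity)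
      nlinarith
    · refine h2.trans_lt ?_
      have h4 : 3 / (4 * K) < 1 / K := by
        rw [div_lt_div_iff₀ (by positivity) (by positivity)]
        linarith
      exact mul_lt_mul_of_pos_left (Real.exp_lt_exp.2 h4) hM0
  have hJcard : M / (4 * K) ≤ #(Ico a' b') := by
    have h1 : (a' : ℝ) < M * Real.exp (1 / (4 * K)) + 1 := Nat.ceil_lt_add_one (by positivity)
    have h2 : M * Real.exp (3 / (4 * K)) < b' := by
      rw [hb']; push_cast; exact Nat.lt_floor_add_one _
    have h3 : (b' : ℝ) - a' ≤ #(Ico a' b') := by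
      rw [Nat.card_Ico]
      have h5 : b' ≤ a' + (b' - a') := by omega
      have h6 : (b' : ℝ) ≤ a' + ((b' - a' : ℕ) : ℝ) := by exact_mod_cast h5
      linarith
    have h4 : Real.exp (1 / (4 * K)) + 1 / (2 * K) ≤ Real.exp (3 / (4 * K)) := by
      have e : 3 / (4 * K) = 1 / (4 * K) + 1 / (2 * K) := by field_simp; norm_num
      rw [e, Real.exp_add]
      have h7 := Real.add_one_le_exp (1 / (2 * K))
      have h8 : 1 ≤ Real.exp (1 / (4 * K)) := Real.one_le_exp (by positivity)
      have h9 : 0 ≤ 1 / (2 * K) := by positivity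
      calc Real.exp (1 / (4 * K)) + 1 / (2 * K)
          ≤ Real.exp (1 / (4 * K)) + Real.exp (1 / (4 * K)) * (1 / (2 * K)) :=
            add_le_add_right (le_mul_of_one_le_left h9 h8) _
        _ = Real.exp (1 / (4 * K)) * (1 / (2 * K) + 1) := by ring
        _ ≤ _ := by gcongr
    have h10 : M * Real.exp (1 / (4 * K)) + M * (1 / (2 * K)) ≤ M * Real.exp (3 / (4 * K)) := by
      rw [← mul_add]; gcongr
    have h11 : 1 ≤ M / (4 * K) := by rw [le_div_iff₀ (by positivity)]; linarith
    have e : M * (1 / (2 * K)) = M / (4 * K) + M / (4 * K) := by field_simp; norm_num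
    linarith
  have hlower : l ^ 2 / (108 * K) ≤ ∑ n ∈ Ico a b, Real.log n ^ 2 / (n : ℝ) ^ σ
      * f (K * (Real.log n - l)) := by
    have h1 : ∀ n ∈ Ico a' b', l ^ 2 / (27 * M) ≤ Real.log n ^ 2 / (n : ℝ) ^ σ
      * f (K * (Real.log n - l)) := by
      intro n hn
      obtain ⟨h2, h3⟩ := hJmem n hn
      obtain ⟨h4, h5⟩ := hlogle n (hJsub hn)
      have hn0 : (0 : ℝ) < n := hM0.trans_le (hmem' n (hJsub hn)).1
      have h6 : 1 / (4 * K) ≤ Real.log n - l := by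
        have := Real.log_le_log (by positivity) h2
        rw [Real.log_mul hM0.ne' (Real.exp_pos _).ne', Real.log_exp] at this
        linarith
      have h7 : Real.log n - l ≤ 3 / (4 * K) := by
        have := Real.log_le_log hn0 h3
        rw [Real.log_mul hM0.ne' (Real.exp_pos _).ne', Real.log_exp] at this
        linarith
      have h8 : f (K * (Real.log n - l)) = 1 := by
        apply hf1
        · calc (1 : ℝ) / 4 = K * (1 / (4 * K)) := by field_simp
            _ ≤ _ := by gcongr
        · calc K * (Real.log n - l) ≤ K * (3 / (4 * K)) := by gcongr
            _ = 3 / 4 := by field_simp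
      have h9 : (n : ℝ) ^ σ ≤ 27 * M := by
        rw [Real.rpow_def_of_pos hn0]
        have h10 : Real.log n * σ ≤ l + 3 := by
          have hl1 : 1 / l ≤ 1 := by rw [div_le_one hl0]; linarith
          have hll : l * (1 / l) = 1 := by field_simp
          rw [hσ]
          nlinarith
        calc Real.exp (Real.log n * σ) ≤ Real.exp (l + 3) := Real.exp_le_exp.2 h10
          _ = M * Real.exp 1 ^ 3 := by
            rw [Real.exp_add, hexpl, ← Real.exp_nat_mul]; norm_num
          _ ≤ M * 3 ^ 3 := by
            gcongr
            exact Real.exp_one_lt_d9.le.trans (by norm_num)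
          _ = _ := by ring
      rw [h8, mul_one]
      gcongr
    calc l ^ 2 / (108 * K) = M / (4 * K) * (l ^ 2 / (27 * M)) := by field_simp; norm_num
      _ ≤ #(Ico a' b') * (l ^ 2 / (27 * M)) := by gcongr
      _ = ∑ n ∈ Ico a' b', l ^ 2 / (27 * M) := by rw [sum_const, nsmul_eq_mul]
      _ ≤ ∑ n ∈ Ico a' b', Real.log n ^ 2 / (n : ℝ) ^ σ * f (K * (Real.log n - l)) :=
        sum_le_sum h1
      _ ≤ _ := by
        apply sum_le_sum_of_subset_of_nonneg hJsub
        intro n _ _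
        have := (hf01 (K * (Real.log n - l))).1
        positivity
  have hdecomp : ∑ n ∈ Ico a b, Real.log n ^ 2 * ArithmeticFunction.vonMangoldt n
        / (n : ℝ) ^ σ * f (K * (Real.log n - l))
      = S + ∑ n ∈ Ico a b, Real.log n ^ 2 / (n : ℝ) ^ σ * f (K * (Real.log n - l)) := by
    rw [← hSsum, ← sum_add_distrib]
    apply sum_congr rfl
    intro n _
    ring
  have hSlow : -(l ^ 2 / (216 * K)) ≤ S := by
    have h1 := (abs_le.1 hSb).1
    have h2 : C * K ≤ l ^ 2 / (216 * K) := by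
      rw [le_div_iff₀ (by positivity)]
      calc C * K * (216 * K) = 216 * C * K ^ 2 := by ring
        _ ≤ _ := hCK
    linarith
  have hLam : M / (864 * K) ≤ ∑ n ∈ Ico a b, ArithmeticFunction.vonMangoldt n := by
    have h1 : l ^ 2 / (216 * K) ≤
        4 * l ^ 2 / M * ∑ n ∈ Ico a b, ArithmeticFunction.vonMangoldt n := by
      refine le_trans ?_ hupper
      rw [hdecomp]
      have e : l ^ 2 / (108 * K) = l ^ 2 / (216 * K) + l ^ 2 / (216 * K) := by field_simp; norm_num
      linarith
    calc M / (864 * K) = M / (4 * l ^ 2) * (l ^ 2 / (216 * K)) := by field_simp; norm_num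
      _ ≤ M / (4 * l ^ 2) * (4 * l ^ 2 / M * ∑ n ∈ Ico a b, ArithmeticFunction.vonMangoldt n) := by
        gcongr
      _ = _ := by field_simp
  have hbM : (b : ℝ) ≤ 4 * M := by
    have h1 : (b : ℝ) < M * Real.exp (1 / K) + 1 := Nat.ceil_lt_add_one (by positivity)
    have h2 : Real.exp (1 / K) ≤ 3 := (Real.exp_le_exp.2 hK1').trans
      (Real.exp_one_lt_d9.le.trans (by norm_num))
    nlinarith
  have ha1 : 1 ≤ a := by
    have : (1 : ℝ) ≤ a := by linarith
    exact_mod_cast this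
  have hMb : M ≤ b := by
    refine le_trans ?_ (Nat.le_ceil _)
    have : 1 ≤ Real.exp (1 / K) := Real.one_le_exp (by positivity)
    nlinarith
  have hb1 : 1 ≤ b := by
    have : (1 : ℝ) ≤ b := by linarith
    exact_mod_cast this
  have hpp := sum_Ico_vonMangoldt_sub_prime_le a b b ha1 (by omega) hb1
  have herr : 2 * √(b : ℝ) * Real.log b ≤ M / (1728 * K) := by
    have h1 : √(b : ℝ) ≤ 2 * √M := by
      apply Real.sqrt_le_iff.2
      refine ⟨by positivity, ?_⟩
      rw [mul_pow, Real.sq_sqrt hM0.le]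
      linarith
    have h2 : Real.log b ≤ 2 * l := by
      calc Real.log b ≤ Real.log (M * M) :=
            Real.log_le_log (by linarith) (by nlinarith)
        _ = 2 * l := by rw [Real.log_mul hM0.ne' hM0.ne']; ring
    rw [le_div_iff₀ (by positivity)]
    calc 2 * √(b : ℝ) * Real.log b * (1728 * K) ≤ 2 * (2 * √M) * (2 * l) * (1728 * l) := by
          gcongr
      _ = √M * (13824 * l ^ 2) := by ring
      _ ≤ √M * √M := by gcongr
      _ = M := hsqM
  have hprime : ∑ n ∈ Ico a b, (if n.Prime then Real.log n else 0) ≤ #P * (2 * l) := by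
    rw [← sum_filter]
    calc ∑ n ∈ Ico a b with n.Prime, Real.log n ≤ ∑ n ∈ Ico a b with n.Prime, 2 * l := by
          apply sum_le_sum
          intro n hn
          have := (hlogle n (mem_filter.1 hn).1).2
          linarith
      _ = #{n ∈ Ico a b | n.Prime} * (2 * l) := by rw [sum_const, nsmul_eq_mul]
      _ ≤ _ := by
        gcongr
        intro n hn
        rw [mem_filter] at hn
        obtain ⟨h1, h2⟩ := hmem' n hn.1
        apply hP n hn.2 h1
        refine h2.trans_le ?_
        gcongr
        have h3 := Real.abs_exp_sub_one_le (x := 1 / K)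
          (by rw [abs_of_pos (by positivity)]; exact hK1')
        rw [abs_of_pos (by positivity : 0 < 1 / K)] at h3
        have h4 := (abs_le.1 h3).2
        have e : 2 * (1 / K) = 1 / (8 * k) := by rw [hK]; field_simp; norm_num
        linarith
  rw [sum_sub_distrib] at hpp
  have hfin : M / (1728 * K) ≤ #P * (2 * l) := by
    have e : M / (864 * K) = M / (1728 * K) + M / (1728 * K) := by field_simp; norm_num
    linarith
  rw [div_le_iff₀ (by positivity)] at hfin ⊢
  have hP0 : (0 : ℝ) ≤ #P := by positivity
  calc M ≤ #P * (2 * l) * (1728 * K) := hfin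
    _ = #P * (55296 * k * l) := by rw [hK]; ring
    _ ≤ #P * (A * k * l) := by gcongr; linarith

section PrimeProducts
open scoped Pointwise

/-- The set of products `∏ i ∈ A, p i` with `p i ∈ P i`. -/
def primeProducts {ι : Type*} (P : ι → Finset ℕ) (A : Finset ι) : Finset ℕ := ∏ i ∈ A, P i

variable {ι : Type*} {P : ι → Finset ℕ} {A B C : Finset ι}

theorem mem_primeProducts {x : ℕ} :
    x ∈ primeProducts P A ↔ ∃ g : ι → ℕ, (∀ i ∈ A, g i ∈ P i) ∧ ∏ i ∈ A, g i = x := by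
  unfold primeProducts
  rw [← mem_coe, Finset.coe_prod, Set.mem_finsetProd]
  constructor
  · rintro ⟨g, hg, h⟩
    exact ⟨g, fun i hi => hg hi, h⟩
  · rintro ⟨g, hg, h⟩
    exact ⟨g, fun {i} hi => hg i hi, h⟩

theorem primeProducts_singleton (i : ι) : primeProducts P {i} = P i := by
  unfold primeProducts
  rw [prod_singleton]

theorem primeProducts_empty : primeProducts P ∅ = {1} := by
  unfold primeProducts
  rw [prod_empty]
  rfl

theorem coprime_of_mem_primeProducts (hP : ∀ i, ∀ p ∈ P i, p.Prime)
    (hd : ∀ i i', i ≠ i' → Disjoint (P i) (P i')) (hAB : Disjoint A B) {x y : ℕ}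
    (hx : x ∈ primeProducts P A) (hy : y ∈ primeProducts P B) : x.Coprime y := by
  obtain ⟨g, hg, rfl⟩ := mem_primeProducts.1 hx
  obtain ⟨g', hg', rfl⟩ := mem_primeProducts.1 hy
  refine Nat.Coprime.prod_left fun i hi => Nat.Coprime.prod_right fun i' hi' => ?_
  rw [Nat.coprime_primes (hP i _ (hg i hi)) (hP i' _ (hg' i' hi'))]
  have hne : i ≠ i' := fun h => disjoint_left.1 hAB hi (h ▸ hi')
  intro h
  exact disjoint_left.1 (hd i i' hne) (hg i hi) (h ▸ hg' i' hi')

theorem sum_primeProducts_union {R : Type*} [AddCommMonoid R] (hP : ∀ i, ∀ p ∈ P i, p.Prime)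
    (hd : ∀ i i', i ≠ i' → Disjoint (P i) (P i')) (hAB : Disjoint A B)
    (hC : ∀ i, i ∈ C ↔ i ∈ A ∨ i ∈ B) (F : ℕ → R) :
    ∑ z ∈ primeProducts P C, F z =
      ∑ x ∈ primeProducts P A, ∑ y ∈ primeProducts P B, F (x * y) := by
  have hCu : C = A ∪ B := by
    ext i
    rw [hC, mem_union]
  have hmul : primeProducts P C = (primeProducts P A ×ˢ primeProducts P B).image
      (fun p => p.1 * p.2) := by
    rw [hCu]
    unfold primeProducts
    rw [prod_union hAB]
    rfl
  rw [hmul, sum_image, sum_product]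
  rintro ⟨x, y⟩ hxy ⟨x', y'⟩ hxy' h
  simp only [coe_product, Set.mem_prod, mem_coe] at hxy hxy' h
  have h1 : x ∣ x' := (coprime_of_mem_primeProducts hP hd hAB hxy.1 hxy'.2).dvd_of_dvd_mul_right
    (Dvd.intro _ h)
  have h2 : x' ∣ x := (coprime_of_mem_primeProducts hP hd hAB hxy'.1 hxy.2).dvd_of_dvd_mul_right
    (Dvd.intro _ h.symm)
  have h3 : x = x' := Nat.dvd_antisymm h1 h2
  have h4 : 0 < x := by
    obtain ⟨g, hg, rfl⟩ := mem_primeProducts.1 hxy.1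
    exact prod_pos fun i hi => (hP i _ (hg i hi)).pos
  subst h3
  rw [Prod.mk.injEq]
  exact ⟨rfl, Nat.eq_of_mul_eq_mul_left h4 h⟩

theorem card_primeProducts (hP : ∀ i, ∀ p ∈ P i, p.Prime)
    (hd : ∀ i i', i ≠ i' → Disjoint (P i) (P i')) (A : Finset ι) :
    #(primeProducts P A) = ∏ i ∈ A, #(P i) := by
  induction A using Finset.induction_on with
  | empty => rw [primeProducts_empty, prod_empty, card_singleton]
  | insert a s ha ih =>
    rw [prod_insert ha, ← ih, card_eq_sum_ones, sum_primeProducts_union hP hd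
      (disjoint_singleton_left.2 ha) (fun i => by rw [mem_insert, mem_singleton]),
      primeProducts_singleton, sum_const, sum_const, smul_eq_mul, smul_eq_mul, mul_one]

theorem primeProducts_bounds {k : ℕ} {M : Fin k → ℕ} {P : Fin k → Finset ℕ}
    (hM : ∀ i, ∀ p ∈ P i, M i ≤ p) (hM' : ∀ i, ∀ p ∈ P i, (p : ℝ) ≤ M i * (1 + 1 / (4 * k)))
    {A : Finset (Fin k)} {x : ℕ} (hx : x ∈ primeProducts P A) :
    ∏ i ∈ A, (M i : ℝ) ≤ x ∧ (x : ℝ) ≤ 2 * ∏ i ∈ A, (M i : ℝ) := by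
  obtain ⟨g, hg, rfl⟩ := mem_primeProducts.1 hx
  push_cast
  constructor
  · exact prod_le_prod (fun i _ => Nat.cast_nonneg _) fun i hi => by
      exact_mod_cast hM i _ (hg i hi)
  · have hpow : ((1 : ℝ) + 1 / (4 * k)) ^ #A ≤ 2 := by
      have h1 : #A ≤ k := (card_le_univ A).trans_eq (Fintype.card_fin k)
      have h0 : (0 : ℝ) ≤ 1 / (4 * k) := by positivity
      calc ((1 : ℝ) + 1 / (4 * k)) ^ #A ≤ (1 + 1 / (4 * k)) ^ k :=
            pow_le_pow_right₀ (by linarith) h1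
        _ ≤ (Real.exp (1 / (4 * k))) ^ k := by
          gcongr
          linarith [Real.add_one_le_exp ((1 : ℝ) / (4 * k))]
        _ = Real.exp (k * (1 / (4 * k))) := (Real.exp_nat_mul _ _).symm
        _ ≤ Real.exp (Real.log 2) := by
          apply Real.exp_le_exp.2
          have : (k : ℝ) * (1 / (4 * k)) ≤ 1 / 4 := by
            rcases Nat.eq_zero_or_pos k with rfl | hk
            · simp
            · have : (0 : ℝ) < k := by exact_mod_cast hk
              field_simp
              rfl
          linarith [Real.log_two_gt_d9]
        _ = 2 := Real.exp_log (by norm_num)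
    calc ∏ i ∈ A, (g i : ℝ) ≤ ∏ i ∈ A, ((1 + 1 / (4 * k)) * (M i : ℝ)) :=
          prod_le_prod (fun i _ => Nat.cast_nonneg _) fun i hi => by
            rw [mul_comm]
            exact hM' i _ (hg i hi)
      _ = (1 + 1 / (4 * k)) ^ #A * ∏ i ∈ A, (M i : ℝ) := by rw [prod_mul_distrib, prod_const]
      _ ≤ _ := by gcongr

end PrimeProducts

lemma card_le_of_cast_le {X : Finset ℕ} {N : ℝ} (hX : ∀ x ∈ X, (x : ℝ) ≤ N) (hN : 0 ≤ N) :
    (#X : ℝ) ≤ N + 1 := by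
  have h : X ⊆ range (⌊N⌋₊ + 1) := fun x hx => by
    rw [mem_range, Nat.lt_add_one_iff, Nat.le_floor_iff hN]
    exact hX x hx
  have h1 := card_le_card h
  rw [card_range] at h1
  have h2 : (#X : ℝ) ≤ ⌊N⌋₊ + 1 := by exact_mod_cast h1
  linarith [Nat.floor_le hN]

/-- The inverse theorem for bilinear sums with bounded coefficients. -/
lemma bilinear_inverse_of_norm_le_one (j : ℕ) (hj : 1 ≤ j) :
    ∃ C : ℕ, ∀ T : ℝ, 2 ≤ T → ∀ N₁ N₂ : ℝ, T ^ C ≤ N₁ → T ^ C ≤ N₂ →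
      ∀ (θ : ℝ) (X Y : Finset ℕ) (f g : ℕ → ℂ),
        (∀ x ∈ X, (x : ℝ) ≤ 2 * N₁) → (∀ y ∈ Y, (y : ℝ) ≤ 2 * N₂) →
        (∀ x, ‖f x‖ ≤ 1) → (∀ y, ‖g y‖ ≤ 1) →
        N₁ * N₂ / T ≤ ‖∑ x ∈ X, ∑ y ∈ Y, f x * g y * eC (θ * ((x : ℝ) ^ j * (y : ℝ) ^ j))‖ →
        ∃ q : ℕ, 0 < q ∧ (q : ℝ) ≤ T ^ C ∧ dZ (q * θ) ≤ T ^ C / (N₁ * N₂) ^ j := by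
  obtain ⟨C, hC⟩ := bilinear_inverse j hj
  refine ⟨3 * C, fun T hT N₁ N₂ hN₁ hN₂ θ X Y f g hX hY hf hg hS => ?_⟩
  have hT0 : 0 < T := by linarith
  have hN₁1 : 1 ≤ N₁ := (one_le_pow_of_two_le hT _).trans hN₁
  have hN₂1 : 1 ≤ N₂ := (one_le_pow_of_two_le hT _).trans hN₂
  have hT3 : 4 * T ≤ T ^ 3 := by
    have h1 := two_mul_pow_le hT 1
    have h2 := two_mul_pow_le hT 2
    norm_num at h1 h2
    linarith
  have hsum : ∀ (Z : Finset ℕ) (N : ℝ) (h : ℕ → ℂ), 1 ≤ N → (∀ z ∈ Z, (z : ℝ) ≤ 2 * N) →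
      (∀ z, ‖h z‖ ≤ 1) → ∑ z ∈ Z, ‖h z‖ ^ 2 ≤ T ^ 3 * (2 * N) := by
    intro Z N h hN hZ hh
    calc ∑ z ∈ Z, ‖h z‖ ^ 2 ≤ ∑ z ∈ Z, (1 : ℝ) :=
          sum_le_sum fun z _ => pow_le_one₀ (norm_nonneg _) (hh z)
      _ = #Z := by rw [sum_const, nsmul_eq_mul, mul_one]
      _ ≤ 2 * N + 1 := card_le_of_cast_le hZ (by linarith)
      _ ≤ T ^ 3 * (2 * N) := by nlinarith
  rw [pow_mul] at hN₁ hN₂ ⊢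
  obtain ⟨q, hq0, hq, hd⟩ := hC (T ^ 3) (two_le_pow hT (by norm_num)) (2 * N₁) (2 * N₂)
    (by linarith) (by linarith) θ X Y f g 0 ((⌊2 * N₁⌋₊ + 1) * (⌊2 * N₂⌋₊ + 1)) hX hY
    (hsum X N₁ f hN₁1 hX hf) (hsum Y N₂ g hN₂1 hY hg) (by
      have hfil : ∀ x ∈ X, (Y.filter fun y => 0 ≤ x * y ∧
          x * y < (⌊2 * N₁⌋₊ + 1) * (⌊2 * N₂⌋₊ + 1)) = Y := by
        intro x hx
        refine filter_true_of_mem fun y hy => ⟨Nat.zero_le _, ?_⟩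
        have h1 : x ≤ ⌊2 * N₁⌋₊ := (Nat.le_floor_iff (by linarith)).2 (hX x hx)
        have h2 : y ≤ ⌊2 * N₂⌋₊ := (Nat.le_floor_iff (by linarith)).2 (hY y hy)
        exact Nat.mul_lt_mul_of_lt_of_le (by omega) (by omega) (by omega)
      rw [sum_congr rfl fun x hx => by rw [hfil x hx]]
      refine le_trans ?_ hS
      rw [div_le_div_iff₀ (by positivity) hT0]
      have : 0 ≤ N₁ * N₂ := by positivity
      calc 2 * N₁ * (2 * N₂) * T = N₁ * N₂ * (4 * T) := by ring
        _ ≤ N₁ * N₂ * T ^ 3 := by gcongr)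
  refine ⟨q, hq0, hq, hd.trans ?_⟩
  gcongr <;> linarith

/-- A long exponential sum over products of primes from intervals is small unless the frequency
is close to a rational with small denominator. -/
lemma exists_denom_of_primeProducts (j : ℕ) (hj : 1 ≤ j) : ∃ C : ℕ, ∀ T : ℝ, 2 ≤ T →
    ∀ (k : ℕ) (M b : Fin k → ℕ) (P : Fin k → Finset ℕ),
      (∀ i, 1 ≤ M i) → (∀ i, Real.log (M i) ≤ T) →
      (∀ i, P i = {p ∈ Ico (M i) (b i) | p.Prime}) → (∀ i, b i ≤ 2 * M i) →
      (∀ i, ∀ p ∈ P i, (p : ℝ) ≤ M i * (1 + 1 / (4 * k))) →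
      (∀ i i', i ≠ i' → Disjoint (P i) (P i')) → ∀ θ : ℝ,
      (∏ i, (M i : ℝ)) / T ≤ ‖∑ z ∈ primeProducts P univ, eC (θ * (z : ℝ) ^ j)‖ →
      ∃ q : ℕ, 0 < q ∧ (q : ℝ) ≤ T ^ C ∧ dZ (q * θ) ≤ T ^ C / (∏ i, (M i : ℝ)) ^ j := by
  obtain ⟨C₁, hC₁⟩ := bilinear_inverse_of_norm_le_one j hj
  obtain ⟨C₂, hC₂⟩ := prime_weyl_inverse j hj
  set C₀ := C₁ + 2 * C₂ + 1 with hC₀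
  refine ⟨C₁ + 2 * C₂ + 3 * (C₀ + 1) * j, fun T hT k M b P hM hlog hPdef hb hPle hd θ hS => ?_⟩
  have hT0 : 0 < T := by linarith
  have hPp : ∀ i, ∀ p ∈ P i, p.Prime := by
    intro i p hp
    rw [hPdef, mem_filter] at hp
    exact hp.2
  have hPge : ∀ i, ∀ p ∈ P i, M i ≤ p := by
    intro i p hp
    rw [hPdef, mem_filter, mem_Ico] at hp
    exact hp.1.1
  have hPcard : ∀ i, #(P i) ≤ M i := by
    intro i
    rw [hPdef]
    refine (card_filter_le _ _).trans ?_
    rw [Nat.card_Ico]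
    have := hb i
    omega
  set D : ℝ := ∏ i, (M i : ℝ) with hDdef
  set K : ℝ := T ^ C₀ with hK
  have hK2 : 2 ≤ K := two_le_pow hT (by omega)
  have hM1 : ∀ i, (1 : ℝ) ≤ M i := fun i => by exact_mod_cast hM i
  have hprod1 : ∀ A : Finset (Fin k), 1 ≤ ∏ i ∈ A, (M i : ℝ) := fun A =>
    Finset.one_le_prod fun i _ => hM1 i
  have hD1 : 1 ≤ D := hprod1 univ
  have hsplit : ∀ A : Finset (Fin k), (∏ i ∈ A, (M i : ℝ)) * ∏ i ∈ Aᶜ, (M i : ℝ) = D :=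
    fun A => prod_mul_prod_compl A _
  have hsumsplit : ∀ A : Finset (Fin k), ∑ z ∈ primeProducts P univ, eC (θ * (z : ℝ) ^ j) =
      ∑ x ∈ primeProducts P A, ∑ y ∈ primeProducts P Aᶜ,
        eC (θ * ((x : ℝ) ^ j * (y : ℝ) ^ j)) := by
    intro A
    rw [sum_primeProducts_union hPp hd (A := A) (B := Aᶜ) disjoint_compl_right
      (fun i => by simp [em])]
    refine sum_congr rfl fun x _ => sum_congr rfl fun y _ => ?_
    push_cast
    rw [mul_pow]
  have hgood : ∀ A : Finset (Fin k), K ≤ ∏ i ∈ A, (M i : ℝ) → K ≤ ∏ i ∈ Aᶜ, (M i : ℝ) →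
      ∃ q : ℕ, 0 < q ∧ (q : ℝ) ≤ T ^ (C₁ + 2 * C₂ + 3 * (C₀ + 1) * j) ∧
        dZ (q * θ) ≤ T ^ (C₁ + 2 * C₂ + 3 * (C₀ + 1) * j) / D ^ j := by
    intro A h1 h2
    have hKC : T ^ C₁ ≤ K := pow_le_pow_of_two_le hT (by omega)
    obtain ⟨q, hq0, hq, hqd⟩ := hC₁ T hT _ _ (hKC.trans h1) (hKC.trans h2) θ
      (primeProducts P A) (primeProducts P Aᶜ) (fun _ => 1) (fun _ => 1)
      (fun x hx => (primeProducts_bounds hPge hPle hx).2)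
      (fun y hy => (primeProducts_bounds hPge hPle hy).2) (by simp) (by simp) (by
        rw [hsplit]
        simp only [one_mul]
        rw [← hsumsplit]
        exact hS)
    rw [hsplit] at hqd
    have hCC : T ^ C₁ ≤ T ^ (C₁ + 2 * C₂ + 3 * (C₀ + 1) * j) :=
      pow_le_pow_of_two_le hT (by omega)
    refine ⟨q, hq0, hq.trans hCC, hqd.trans ?_⟩
    gcongr
  rcases lt_or_ge D (K ^ 3) with hDK | hDK
  · refine ⟨1, one_pos, ?_, ?_⟩
    · simpa using one_le_pow_of_two_le hT _
    · refine (dZ_le_one _).trans ?_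
      rw [one_le_div (by positivity)]
      calc D ^ j ≤ (K ^ 3) ^ j := by gcongr
        _ = T ^ (C₀ * 3 * j) := by rw [hK, ← pow_mul, ← pow_mul, mul_assoc]
        _ ≤ _ := by
          apply pow_le_pow_of_two_le hT
          calc C₀ * 3 * j = 3 * C₀ * j := by ring
            _ ≤ 3 * (C₀ + 1) * j := by gcongr; omega
            _ ≤ _ := Nat.le_add_left _ _
  obtain ⟨A, hA, hAmin⟩ := Finset.exists_min_image
    (univ.filter fun A : Finset (Fin k) => K ≤ ∏ i ∈ A, (M i : ℝ)) (fun A => #A)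
    ⟨univ, by
      rw [mem_filter]
      refine ⟨mem_univ _, le_trans ?_ hDK⟩
      exact le_self_pow₀ (by linarith) (by norm_num)⟩
  rw [mem_filter] at hA
  rcases le_or_gt K (∏ i ∈ Aᶜ, (M i : ℝ)) with h | hAc
  · exact hgood A hA.2 h
  obtain ⟨a, ha⟩ : A.Nonempty := by
    rw [nonempty_iff_ne_empty]
    rintro rfl
    have := hA.2
    rw [prod_empty] at this
    linarith
  have herase : ∏ i ∈ A.erase a, (M i : ℝ) < K := by
    by_contra hcon
    have := hAmin (A.erase a) (mem_filter.2 ⟨mem_univ _, not_lt.1 hcon⟩)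
    exact absurd this (not_le.2 (card_erase_lt_of_mem ha))
  have hMa : K < M a := by
    by_contra hcon
    push Not at hcon
    have h1 : ∏ i ∈ A, (M i : ℝ) ≤ K * K := by
      rw [← mul_prod_erase A _ ha]
      exact mul_le_mul hcon herase.le (by linarith [hprod1 (A.erase a)]) (by linarith)
    have h2 := hsplit A
    have h3 : D < K * K * K := by
      rw [← h2]
      exact mul_lt_mul' h1 hAc (by linarith [hprod1 Aᶜ]) (by positivity)
    have h4 : K ^ 3 = K * K * K := by ring
    linarith
  rcases le_or_gt K (∏ i ∈ ({a} : Finset (Fin k))ᶜ, (M i : ℝ)) with h | hrest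
  · exact hgood {a} (by rw [prod_singleton]; exact hMa.le) h
  have hDa : (M a : ℝ) * ∏ i ∈ ({a} : Finset (Fin k))ᶜ, (M i : ℝ) = D := by
    rw [← hsplit {a}, prod_singleton]
  set W := primeProducts P ({a} : Finset (Fin k))ᶜ with hW
  set m : ℝ := ∏ i ∈ ({a} : Finset (Fin k))ᶜ, (M i : ℝ) with hm
  have hm1 : 1 ≤ m := hprod1 _
  have hWcard : (#W : ℝ) ≤ m := by
    rw [hW, card_primeProducts hPp hd, hm]
    push_cast
    exact prod_le_prod (fun i _ => Nat.cast_nonneg _) fun i _ => by exact_mod_cast hPcard i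
  obtain ⟨y, hyW, hy⟩ : ∃ y ∈ W, M a / T ≤ ‖∑ p ∈ P a, eC (θ * (y : ℝ) ^ j * (p : ℝ) ^ j)‖ := by
    by_contra! hcon
    have hne : W.Nonempty := by
      rw [nonempty_iff_ne_empty]
      intro h0
      rw [hsumsplit {a}, ← hW, h0] at hS
      simp at hS
      have : 0 < D / T := by positivity
      linarith
    have h1 : ‖∑ z ∈ primeProducts P univ, eC (θ * (z : ℝ) ^ j)‖ < D / T := by
      rw [hsumsplit {a}, primeProducts_singleton, sum_comm]
      calc ‖∑ y ∈ W, ∑ x ∈ P a, eC (θ * ((x : ℝ) ^ j * (y : ℝ) ^ j))‖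
          ≤ ∑ y ∈ W, ‖∑ x ∈ P a, eC (θ * ((x : ℝ) ^ j * (y : ℝ) ^ j))‖ := norm_sum_le _ _
        _ = ∑ y ∈ W, ‖∑ x ∈ P a, eC (θ * (y : ℝ) ^ j * (x : ℝ) ^ j)‖ := by
          refine sum_congr rfl fun y _ => ?_
          congr 1
          refine sum_congr rfl fun x _ => ?_
          congr 1
          ring
        _ < ∑ y ∈ W, M a / T := sum_lt_sum_of_nonempty hne hcon
        _ = #W * (M a / T) := by rw [sum_const, nsmul_eq_mul]
        _ ≤ m * (M a / T) := by gcongr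
        _ = D / T := by rw [← hDa]; ring
    linarith
  obtain ⟨hy1, hy2⟩ := primeProducts_bounds hPge hPle hyW
  have hy0 : (0 : ℝ) < y := by linarith
  have hTT : 2 * T ≤ T ^ 2 := by
    have := two_mul_pow_le hT 1
    norm_num at this
    exact this
  obtain ⟨q, hq0, hq, hqd⟩ := hC₂ (T ^ 2) (two_le_pow hT (by norm_num)) (2 * M a) (by
      push_cast
      rw [← pow_mul]
      have : T ^ (2 * C₂) ≤ K := pow_le_pow_of_two_le hT (by omega)
      linarith) (by
      push_cast
      rw [Real.log_mul (by norm_num) (by linarith [hM1 a])]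
      have := hlog a
      linarith [Real.log_two_lt_d9]) (θ * (y : ℝ) ^ j) (M a) (b a) (by have := hb a; omega) (by
      rw [hPdef] at hy
      refine le_trans ?_ hy
      push_cast
      rw [div_le_div_iff₀ (by positivity) hT0]
      calc 2 * (M a : ℝ) * T = M a * (2 * T) := by ring
        _ ≤ M a * T ^ 2 := by gcongr)
  rw [← pow_mul] at hq hqd
  refine ⟨q * y ^ j, Nat.mul_pos hq0 (pow_pos (by exact_mod_cast hy0) _), ?_, ?_⟩
  · push_cast
    have h1 : (y : ℝ) ≤ T ^ (C₀ + 1) := by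
      have := two_mul_pow_le hT C₀
      linarith
    calc (q : ℝ) * (y : ℝ) ^ j ≤ T ^ (2 * C₂) * (T ^ (C₀ + 1)) ^ j := by gcongr
      _ = T ^ (2 * C₂ + (C₀ + 1) * j) := by rw [← pow_mul, pow_add]
      _ ≤ _ := by
        apply pow_le_pow_of_two_le hT
        have : (C₀ + 1) * j ≤ 3 * (C₀ + 1) * j := by gcongr; omega
        omega
  · push_cast
    have e : (q : ℝ) * (y : ℝ) ^ j * θ = q * (θ * (y : ℝ) ^ j) := by ring
    rw [e]
    refine hqd.trans ?_
    push_cast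
    have hMa0 : (0 : ℝ) < M a := by linarith
    calc T ^ (2 * C₂) / (2 * (M a : ℝ)) ^ j ≤ T ^ (2 * C₂) / (M a : ℝ) ^ j := by
          gcongr
          linarith
      _ = T ^ (2 * C₂) * m ^ j / D ^ j := by
          rw [← hDa, mul_pow]
          field_simp
      _ ≤ T ^ (2 * C₂) * K ^ j / D ^ j := by gcongr
      _ = T ^ (2 * C₂ + C₀ * j) / D ^ j := by rw [hK, ← pow_mul, ← pow_add]
      _ ≤ _ := by
        gcongr 1
        apply pow_le_pow_of_two_le hT
        have : C₀ * j ≤ 3 * (C₀ + 1) * j := by gcongr; omega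
        omega

/-- The exponential sum `p ↦ ∑ c x e(α x^j p^j)` is almost `q`-periodic if `q α` is close to an
integer. -/
lemma norm_sum_eC_le_norm_sum_eC_add (j : ℕ) {T : ℝ} (hT : 2 ≤ T) {M M' : ℝ} (hM : 0 < M)
    (hM' : 0 < M') {q : ℕ} {α : ℝ} (hα : dZ (q * α) ≤ T / (M * M') ^ j) {X : Finset ℕ}
    {c : ℕ → ℂ} {N : ℝ} (hX : ∀ x ∈ X, (x : ℝ) ≤ 2 * M') (hc : ∀ x, ‖c x‖ ≤ 1) (hN : #X ≤ N)
    {n p i : ℕ} (hp : n + q * i = p) (hpM : (p : ℝ) ≤ 2 * M) (hi : i ≤ M / T ^ (3 * j + 6)) :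
    ‖∑ x ∈ X, c x * eC (α * ((x : ℝ) ^ j * (p : ℝ) ^ j))‖ ≤
      ‖∑ x ∈ X, c x * eC (α * ((x : ℝ) ^ j * (n : ℝ) ^ j))‖ + 1 / (2 * T) * N := by
  have hT0 : 0 < T := by linarith
  rcases Nat.eq_zero_or_pos j with rfl | hj
  · simp only [pow_zero, mul_one]
    have : 0 ≤ N := (Nat.cast_nonneg _).trans hN
    have : 0 ≤ 1 / (2 * T) * N := by positivity
    linarith
  have hnp : (n : ℝ) ≤ p := by
    rw [← hp]
    push_cast
    have : (0 : ℝ) ≤ q * i := by positivity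
    linarith
  set m : ℕ := ∑ l ∈ range j, p ^ l * n ^ (j - 1 - l) with hm
  have hpn : (p : ℝ) ^ j - (n : ℝ) ^ j = m * (q * i) := by
    rw [← (Commute.all (p : ℝ) (n : ℝ)).geom_sum₂_mul j, hm]
    have : (p : ℝ) - n = q * i := by rw [← hp]; push_cast; ring
    rw [this]
    push_cast
    rfl
  have hmle : (m : ℝ) ≤ j * (2 * M) ^ (j - 1) := by
    rw [hm]
    push_cast
    calc ∑ l ∈ range j, (p : ℝ) ^ l * (n : ℝ) ^ (j - 1 - l)
        ≤ ∑ l ∈ range j, (2 * M) ^ (j - 1) := by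
          apply sum_le_sum
          intro l hl
          rw [mem_range] at hl
          calc (p : ℝ) ^ l * (n : ℝ) ^ (j - 1 - l) ≤ (2 * M) ^ l * (2 * M) ^ (j - 1 - l) := by
                gcongr
                exact hnp.trans hpM
            _ = (2 * M) ^ (j - 1) := by rw [← pow_add]; congr 1; omega
      _ = _ := by rw [sum_const, card_range, nsmul_eq_mul]
  have hterm : ∀ x ∈ X, ‖c x * eC (α * ((x : ℝ) ^ j * (p : ℝ) ^ j)) -
      c x * eC (α * ((x : ℝ) ^ j * (n : ℝ) ^ j))‖ ≤ 1 / (2 * T) := by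
    intro x hx
    have e : α * ((x : ℝ) ^ j * (p : ℝ) ^ j) = α * ((x : ℝ) ^ j * (n : ℝ) ^ j) +
        ((x ^ j * i * m : ℕ) : ℝ) * (q * α) := by
      have h1 : (p : ℝ) ^ j = (n : ℝ) ^ j + m * (q * i) := by linarith
      rw [h1]
      push_cast
      ring
    have e2 : c x * eC (α * ((x : ℝ) ^ j * (p : ℝ) ^ j)) -
        c x * eC (α * ((x : ℝ) ^ j * (n : ℝ) ^ j)) =
        c x * eC (α * ((x : ℝ) ^ j * (n : ℝ) ^ j)) *
          (eC (((x ^ j * i * m : ℕ) : ℝ) * (q * α)) - 1) := by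
      rw [e, eC_add]
      ring
    rw [e2, norm_mul, norm_mul, norm_eC, mul_one]
    have hd : dZ (((x ^ j * i * m : ℕ) : ℝ) * (q * α)) ≤
        (2 * M') ^ j * (M / T ^ (3 * j + 6)) * (j * (2 * M) ^ (j - 1)) * (T / (M * M') ^ j) := by
      refine (dZ_nat_mul_le _ _).trans ?_
      push_cast
      gcongr
      · exact dZ_nonneg _
      · exact hX x hx
    have hj2 : (2 : ℝ) ^ (2 * j) ≤ T ^ (2 * j) := by gcongr
    have hjT : (j : ℝ) ≤ T ^ j := natCast_le_pow hT j
    have h16 : (14 : ℝ) ≤ T ^ 4 := by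
      have : (2 : ℝ) ^ 4 ≤ T ^ 4 := by gcongr
      linarith
    have hval : (2 * M') ^ j * (M / T ^ (3 * j + 6)) * (j * (2 * M) ^ (j - 1)) *
        (T / (M * M') ^ j) * 14 ≤ 1 / T := by
      have e3 : (2 * M') ^ j * (M / T ^ (3 * j + 6)) * (j * (2 * M) ^ (j - 1)) *
        (T / (M * M') ^ j) = 2 ^ (2 * j - 1) * j * (T / T ^ (3 * j + 6)) := by
        have h2 : M ^ j = M ^ (j - 1) * M := by rw [← pow_succ]; congr 1; omega
        have h3 : (2 : ℝ) ^ (2 * j - 1) = 2 ^ j * 2 ^ (j - 1) := by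
          rw [← pow_add]; congr 1; omega
        rw [h3, mul_pow, mul_pow, mul_pow, h2]
        field_simp
      rw [e3]
      have h4 : T ^ (3 * j + 6) = T ^ (2 * j) * T ^ j * T ^ 4 * T * T := by ring
      calc (2 : ℝ) ^ (2 * j - 1) * j * (T / T ^ (3 * j + 6)) * 14
          ≤ T ^ (2 * j) * T ^ j * (T / T ^ (3 * j + 6)) * T ^ 4 := by
            gcongr
            refine le_trans ?_ hj2
            exact pow_le_pow_right₀ (by norm_num) (by omega)
        _ = 1 / T := by
            rw [h4]
            field_simp
    calc ‖c x‖ * ‖eC (((x ^ j * i * m : ℕ) : ℝ) * (q * α)) - 1‖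
        ≤ 1 * (7 * dZ (((x ^ j * i * m : ℕ) : ℝ) * (q * α))) := by
          gcongr
          · exact hc x
          · exact norm_eC_sub_one_le_dZ _
      _ ≤ 1 / T / 2 := by linarith
      _ = _ := by field_simp
  have hsub : ‖∑ x ∈ X, c x * eC (α * ((x : ℝ) ^ j * (p : ℝ) ^ j)) -
      ∑ x ∈ X, c x * eC (α * ((x : ℝ) ^ j * (n : ℝ) ^ j))‖ ≤ 1 / (2 * T) * N := by
    rw [← sum_sub_distrib]
    calc _ ≤ ∑ x ∈ X, (1 / (2 * T)) := norm_sum_le_of_le _ hterm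
      _ = 1 / (2 * T) * #X := by rw [sum_const, nsmul_eq_mul, mul_comm]
      _ ≤ _ := by gcongr
  linarith [norm_le_norm_add_norm_sub' (∑ x ∈ X, c x * eC (α * ((x : ℝ) ^ j * (p : ℝ) ^ j)))
    (∑ x ∈ X, c x * eC (α * ((x : ℝ) ^ j * (n : ℝ) ^ j)))]

/-- The Brun–Titchmarsh inequality for short progressions, in the form used below. -/
lemma card_primes_progression_mul_log_le {y : ℝ} {M : ℕ} (hy4 : 4 ≤ y) (hyM : y ^ 16 = M)
    {H : ℕ} (hH : y ^ 8 ≤ H) (n q : ℕ) (hq : 1 ≤ q) :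
    (#{i ∈ range H | ∃ p : ℕ, p.Prime ∧ M ≤ p ∧ n + q * i = p} : ℝ) * Real.log M ≤
      65 * (1 + Real.log q) * H := by
  set R := ⌊y⌋₊ with hR
  have hy0 : 0 < y := by linarith
  have hRy : (R : ℝ) ≤ y := Nat.floor_le hy0.le
  have hyR : y < R + 1 := Nat.lt_floor_add_one y
  have hR2 : (2 : ℝ) ≤ R := by linarith
  have hR2' : 2 ≤ R := by exact_mod_cast hR2
  have hlogM : Real.log M = 16 * Real.log y := by
    rw [← hyM, Real.log_pow]
    norm_num
  have hlogy : Real.log y ≤ 2 * Real.log R := by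
    have : Real.log y ≤ Real.log ((R : ℝ) ^ 2) := Real.log_le_log hy0 (by nlinarith)
    rw [Real.log_pow] at this
    exact_mod_cast this
  have hlogR : 0 < Real.log R := Real.log_pos (by linarith)
  have hlogy0 : 0 ≤ Real.log y := Real.log_nonneg (by linarith)
  have hlogq : 0 ≤ Real.log q := Real.log_natCast_nonneg q
  have hRM : R < M := by
    have h1 : y < y ^ 16 := lt_self_pow₀ (by linarith) (by norm_num)
    have h2 : (R : ℝ) < M := by rw [← hyM]; linarith
    exact_mod_cast h2
  have hcard : (#{i ∈ range H | ∃ p : ℕ, p.Prime ∧ M ≤ p ∧ n + q * i = p} : ℝ) ≤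
      2 * (1 + Real.log q) * H / Real.log R + (R : ℝ) ^ 4 := by
    refine le_trans ?_ (card_primes_progression_le n q R H hq hR2')
    exact_mod_cast card_le_card (monotone_filter_right _ fun i _ => by
      rintro ⟨p, h1, h2, h3⟩
      exact ⟨p, h1, by omega, h3⟩)
  have hmain : 2 * (1 + Real.log q) * H / Real.log R * Real.log M ≤ 64 * (1 + Real.log q) * H := by
    rw [div_mul_eq_mul_div, div_le_iff₀ hlogR, hlogM]
    calc 2 * (1 + Real.log q) * H * (16 * Real.log y)
        ≤ 2 * (1 + Real.log q) * H * (16 * (2 * Real.log R)) := by gcongr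
      _ = _ := by ring
  have herr : (R : ℝ) ^ 4 * Real.log M ≤ H := by
    refine le_trans ?_ hH
    calc (R : ℝ) ^ 4 * Real.log M ≤ y ^ 4 * (16 * y) := by
          rw [hlogM]
          gcongr
          linarith [Real.log_le_sub_one_of_pos hy0]
      _ = y ^ 5 * 4 ^ 2 := by ring
      _ ≤ y ^ 5 * y ^ 2 := by gcongr
      _ = y ^ 7 := by ring
      _ ≤ y ^ 8 := pow_le_pow_right₀ (by linarith) (by norm_num)
  have hH0 : 0 ≤ Real.log q * H := by positivity
  calc _ ≤ (2 * (1 + Real.log q) * H / Real.log R + (R : ℝ) ^ 4) * Real.log M := by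
        gcongr
    _ ≤ _ := by linarith

/-- Passing from primes to all integers in an exponential sum whose frequency is close to a
rational with small denominator. -/
lemma sum_norm_primes_le (j : ℕ) : ∃ C : ℕ, ∀ T : ℝ, 2 ≤ T → ∀ M : ℕ, T ^ C ≤ M →
    ∀ M' : ℝ, 0 < M' → ∀ q : ℕ, 1 ≤ q → (q : ℝ) ≤ T → ∀ α : ℝ,
      dZ (q * α) ≤ T / (M * M') ^ j → ∀ (X : Finset ℕ) (c : ℕ → ℂ) (N ε : ℝ),
      (∀ x ∈ X, (x : ℝ) ≤ 2 * M') → (∀ x, ‖c x‖ ≤ 1) → #X ≤ N → 1 / T ≤ ε → ∀ P : Finset ℕ,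
      (∀ p ∈ P, p.Prime ∧ M ≤ p ∧ p ≤ 2 * M) →
      ε * N * #P ≤ ∑ p ∈ P, ‖∑ x ∈ X, c x * eC (α * ((x : ℝ) ^ j * (p : ℝ) ^ j))‖ →
      ε * N * #P * Real.log M ≤ 130 * (1 + Real.log q) *
        ∑ n ∈ range (2 * M + 1), ‖∑ x ∈ X, c x * eC (α * ((x : ℝ) ^ j * (n : ℝ) ^ j))‖ := by
  refine ⟨2 * (3 * j + 6) + 32, ?_⟩
  intro T hT M hM M' hM' q hq1 hqT α hα X c N ε hX hc hN hε P hP hsum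
  have hT0 : 0 < T := by linarith
  have hM1 : (1 : ℝ) ≤ M := (one_le_pow_of_two_le hT _).trans hM
  have hM0 : (0 : ℝ) < M := by linarith
  have hN0 : 0 ≤ N := (Nat.cast_nonneg _).trans hN
  set F : ℕ → ℝ := fun n => ‖∑ x ∈ X, c x * eC (α * ((x : ℝ) ^ j * (n : ℝ) ^ j))‖ with hF
  have hF0 : ∀ n, 0 ≤ F n := fun n => norm_nonneg _
  set C' := 3 * j + 6 with hC'
  set y : ℝ := (M : ℝ) ^ (1 / 16 : ℝ) with hy
  have hy0 : 0 < y := by positivity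
  have hy16 : y ^ 16 = M := by
    rw [hy, ← Real.rpow_natCast, ← Real.rpow_mul hM0.le]
    norm_num
  have hy4 : 4 ≤ y := by
    rw [← pow_le_pow_iff_left₀ (by norm_num) hy0.le (by norm_num : (16 : ℕ) ≠ 0), hy16]
    refine le_trans ?_ hM
    calc (4 : ℝ) ^ 16 = 2 ^ 32 := by norm_num
      _ ≤ T ^ 32 := by gcongr
      _ ≤ _ := pow_le_pow_of_two_le hT (by omega)
  have hy8 : 2 * T ^ C' ≤ y ^ 8 := by
    rw [← pow_le_pow_iff_left₀ (by positivity) (by positivity) (two_ne_zero), ← pow_mul, hy16]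
    refine le_trans ?_ hM
    calc (2 * T ^ C') ^ 2 ≤ (T ^ (C' + 1)) ^ 2 := by
          gcongr
          exact two_mul_pow_le hT C'
      _ = T ^ (2 * C' + 2) := by rw [← pow_mul]; congr 1; ring
      _ ≤ _ := pow_le_pow_of_two_le hT (by omega)
  set H : ℕ := ⌊(M : ℝ) / T ^ C'⌋₊ with hH
  have hHle : (H : ℝ) ≤ M / T ^ C' := Nat.floor_le (by positivity)
  have hHge : y ^ 8 ≤ H := by
    have h1 : (M : ℝ) / T ^ C' < H + 1 := Nat.lt_floor_add_one _
    have h2 : 2 * y ^ 8 ≤ M / T ^ C' := by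
      rw [le_div_iff₀ (by positivity), ← hy16]
      calc 2 * y ^ 8 * T ^ C' = y ^ 8 * (2 * T ^ C') := by ring
        _ ≤ y ^ 8 * y ^ 8 := by gcongr
        _ = y ^ 16 := by ring
    have h3 : 1 ≤ y ^ 8 := one_le_pow₀ (by linarith)
    linarith
  have hH0 : (0 : ℝ) < H := lt_of_lt_of_le (by positivity) hHge
  have hqH : ∀ i ∈ range H, ∀ p ∈ P, p - q * i + q * i = p := by
    intro i hi p hp
    rw [mem_range] at hi
    apply Nat.sub_add_cancel
    have h1 : ((q * i : ℕ) : ℝ) ≤ p := by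
      have hp1 : (M : ℝ) ≤ p := by exact_mod_cast (hP p hp).2.1
      have hi' : (i : ℝ) ≤ H := by exact_mod_cast hi.le
      push_cast
      calc (q : ℝ) * i ≤ T * (M / T ^ C') := by
            gcongr
            exact hi'.trans hHle
        _ = M * (T / T ^ C') := by ring
        _ ≤ M * 1 := by
            gcongr
            rw [div_le_one (by positivity)]
            exact le_self_pow₀ (by linarith) (by omega)
        _ ≤ p := by linarith
    exact_mod_cast h1
  have hshift : ∀ p ∈ P, ∀ i ∈ range H, F p ≤ F (p - q * i) + 1 / (2 * T) * N := by
    intro p hp i hi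
    refine norm_sum_eC_le_norm_sum_eC_add j hT hM0 hM' hα hX hc hN (hqH i hi p hp) ?_ ?_
    · exact_mod_cast (hP p hp).2.2
    · rw [mem_range] at hi
      have hi' : (i : ℝ) ≤ H := by exact_mod_cast hi.le
      exact hi'.trans hHle
  have hdouble : H * (ε / 2 * N * #P) ≤ ∑ p ∈ P, ∑ i ∈ range H, F (p - q * i) := by
    have h1 : ∑ p ∈ P, ∑ i ∈ range H, F p ≤
        ∑ p ∈ P, ∑ i ∈ range H, (F (p - q * i) + 1 / (2 * T) * N) :=
      sum_le_sum fun p hp => sum_le_sum fun i hi => hshift p hp i hi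
    simp only [sum_add_distrib, sum_const, card_range, nsmul_eq_mul] at h1
    rw [← mul_sum] at h1
    have h2 : 1 / (2 * T) ≤ ε / 2 := by
      calc 1 / (2 * T) = 1 / T / 2 := by field_simp
        _ ≤ _ := by gcongr
    have h3 : (#P : ℝ) * (H * (1 / (2 * T) * N)) ≤ #P * (H * (ε / 2 * N)) := by gcongr
    have h4 : (H : ℝ) * (ε * N * #P) ≤ H * ∑ p ∈ P, F p := by gcongr
    linarith
  have hfiber : ∑ p ∈ P, ∑ i ∈ range H, F (p - q * i) = ∑ n ∈ range (2 * M + 1),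
      #{z ∈ P ×ˢ range H | z.1 - q * z.2 = n} * F n := by
    rw [← sum_product', ← sum_fiberwise_of_maps_to (t := range (2 * M + 1))
      (g := fun z : ℕ × ℕ => z.1 - q * z.2)]
    · refine sum_congr rfl fun n _ => ?_
      rw [← nsmul_eq_mul, ← sum_const]
      refine sum_congr rfl fun z hz => ?_
      rw [(mem_filter.1 hz).2]
    · intro z hz
      have := (hP z.1 (mem_product.1 hz).1).2.2
      rw [mem_range]
      omega
  have hcount : ∀ n, (#{z ∈ P ×ˢ range H | z.1 - q * z.2 = n} : ℝ) * Real.log M ≤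
      65 * (1 + Real.log q) * H := by
    intro n
    refine le_trans ?_ (card_primes_progression_mul_log_le hy4 hy16 hHge n q hq1)
    have hle : #{z ∈ P ×ˢ range H | z.1 - q * z.2 = n} ≤
        #{i ∈ range H | ∃ p : ℕ, p.Prime ∧ M ≤ p ∧ n + q * i = p} := by
      refine card_le_card_of_injOn (fun z => z.2) ?_ ?_
      · intro z hz
        rw [mem_coe, mem_filter, mem_product] at hz
        rw [mem_coe, mem_filter]
        refine ⟨hz.1.2, z.1, (hP _ hz.1.1).1, (hP _ hz.1.1).2.1, ?_⟩
        rw [← hz.2]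
        exact hqH _ hz.1.2 _ hz.1.1
      · intro z hz z' hz' h
        rw [mem_coe, mem_filter, mem_product] at hz hz'
        have h1 := hqH _ hz.1.2 _ hz.1.1
        have h2 := hqH _ hz'.1.2 _ hz'.1.1
        simp only at h
        rw [hz.2, h] at h1
        rw [hz'.2] at h2
        exact Prod.ext (h1.symm.trans h2) h
    have : (#{z ∈ P ×ˢ range H | z.1 - q * z.2 = n} : ℝ) ≤
        #{i ∈ range H | ∃ p : ℕ, p.Prime ∧ M ≤ p ∧ n + q * i = p} := by exact_mod_cast hle
    gcongr
  have hlogM : 0 ≤ Real.log M := Real.log_nonneg hM1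
  have hfinal : H * (ε * N * #P * Real.log M) ≤
      H * (130 * (1 + Real.log q) * ∑ n ∈ range (2 * M + 1), F n) := by
    calc H * (ε * N * #P * Real.log M) = 2 * (H * (ε / 2 * N * #P) * Real.log M) := by ring
      _ ≤ 2 * ((∑ n ∈ range (2 * M + 1), #{z ∈ P ×ˢ range H | z.1 - q * z.2 = n} * F n) *
            Real.log M) := by
          rw [← hfiber]
          gcongr
      _ = 2 * ∑ n ∈ range (2 * M + 1),
            (#{z ∈ P ×ˢ range H | z.1 - q * z.2 = n} : ℝ) * Real.log M * F n := by
          rw [sum_mul]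
          congr 1
          refine sum_congr rfl fun n _ => ?_
          ring
      _ ≤ 2 * ∑ n ∈ range (2 * M + 1), 65 * (1 + Real.log q) * H * F n := by
          refine mul_le_mul_of_nonneg_left (sum_le_sum fun n _ => ?_) zero_le_two
          exact mul_le_mul_of_nonneg_right (hcount n) (hF0 n)
      _ = _ := by
          rw [← mul_sum]
          ring
  exact le_of_mul_le_mul_left hfinal hH0

lemma exists_norm_le_one_mul_eq (z : ℂ) : ∃ c : ℂ, ‖c‖ ≤ 1 ∧ c * z = ‖z‖ := by
  rcases eq_or_ne z 0 with rfl | hz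
  · exact ⟨0, by simp, by simp⟩
  · have hz' : (‖z‖ : ℂ) ≠ 0 := by exact_mod_cast norm_ne_zero_iff.2 hz
    refine ⟨(starRingEnd ℂ) z / ‖z‖, ?_, ?_⟩
    · rw [norm_div, RCLike.norm_conj, Complex.norm_real, norm_norm,
        div_self (norm_ne_zero_iff.2 hz)]
    · rw [div_mul_eq_mul_div, Complex.conj_mul', sq, mul_div_assoc, div_self hz', mul_one]

/-- Swapping the two sums in a sum of absolute values of exponential sums. -/
lemma exists_sum_norm_le_sum_norm (j : ℕ) (α : ℝ) (X Y : Finset ℕ) (c : ℕ → ℂ) :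
    ∃ d : ℕ → ℂ, (∀ y, ‖d y‖ ≤ 1) ∧
      (∑ y ∈ Y, ‖∑ x ∈ X, c x * eC (α * ((x : ℝ) ^ j * (y : ℝ) ^ j))‖ : ℝ) =
        ‖∑ x ∈ X, ∑ y ∈ Y, c x * d y * eC (α * ((x : ℝ) ^ j * (y : ℝ) ^ j))‖ := by
  choose d hd1 hd using fun y : ℕ =>
    exists_norm_le_one_mul_eq (∑ x ∈ X, c x * eC (α * ((x : ℝ) ^ j * (y : ℝ) ^ j)))
  refine ⟨d, hd1, ?_⟩
  have h : ∑ x ∈ X, ∑ y ∈ Y, c x * d y * eC (α * ((x : ℝ) ^ j * (y : ℝ) ^ j)) =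
      ((∑ y ∈ Y, ‖∑ x ∈ X, c x * eC (α * ((x : ℝ) ^ j * (y : ℝ) ^ j))‖ : ℝ) : ℂ) := by
    rw [sum_comm]
    push_cast
    refine sum_congr rfl fun y _ => ?_
    rw [← hd, mul_sum]
    refine sum_congr rfl fun x _ => ?_
    ring
  rw [h, Complex.norm_real, Real.norm_of_nonneg (sum_nonneg fun _ _ => norm_nonneg _)]

/-- If the frequency is already known to be close to a rational with a small denominator `q`, then
the exponential sum over products of two primes can be inverted with a loss that depends on
`log q` only. -/
lemma exists_denom_of_prime_pairs (j : ℕ) (hj : 1 ≤ j) : ∃ C : ℕ, ∀ T : ℝ, 2 ≤ T →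
    ∀ M₁ M₂ : ℕ, T ^ C ≤ M₁ → T ^ C ≤ M₂ → ∀ q : ℕ, 1 ≤ q → (q : ℝ) ≤ T → ∀ α : ℝ,
      dZ (q * α) ≤ T / (M₁ * M₂ : ℝ) ^ j → ∀ P₁ P₂ : Finset ℕ,
      (∀ p ∈ P₁, p.Prime ∧ M₁ ≤ p ∧ p ≤ 2 * M₁) → (∀ p ∈ P₂, p.Prime ∧ M₂ ≤ p ∧ p ≤ 2 * M₂) →
      ∀ B : ℝ, 1 ≤ B → M₁ ≤ B * (#P₁ * Real.log M₁) → M₂ ≤ B * (#P₂ * Real.log M₂) →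
      ∀ δ : ℝ, 0 < δ → δ ≤ 1 → (130 * (1 + Real.log q) * B) ^ 2 / δ ≤ T →
      δ * (#P₁ * #P₂) ≤ ‖∑ p ∈ P₁, ∑ r ∈ P₂, eC (α * ((p : ℝ) ^ j * (r : ℝ) ^ j))‖ →
      ∃ q' : ℕ, 0 < q' ∧ (q' : ℝ) ≤ ((130 * (1 + Real.log q) * B) ^ 2 / δ) ^ C ∧
        dZ (q' * α) ≤ ((130 * (1 + Real.log q) * B) ^ 2 / δ) ^ C / (M₁ * M₂ : ℝ) ^ j := by
  obtain ⟨C₁, hC₁⟩ := sum_norm_primes_le j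
  obtain ⟨C₂, hC₂⟩ := bilinear_inverse_of_norm_le_one j hj
  refine ⟨C₁ + C₂, ?_⟩
  intro T hT M₁ M₂ hM₁ hM₂ q hq1 hqT α hα P₁ P₂ hP₁ hP₂ B hB hd₁ hd₂ δ hδ hδ1 hV hS
  have hT0 : 0 < T := by linarith
  have hM₁1 : (1 : ℝ) ≤ M₁ := (one_le_pow_of_two_le hT _).trans hM₁
  have hM₂1 : (1 : ℝ) ≤ M₂ := (one_le_pow_of_two_le hT _).trans hM₂
  set E : ℝ := 130 * (1 + Real.log q) * B with hE
  have hlq : 0 ≤ Real.log q := Real.log_natCast_nonneg q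
  have hE130 : 130 ≤ E := by
    calc (130 : ℝ) = 130 * (1 + 0) * 1 := by norm_num
      _ ≤ E := by rw [hE]; gcongr
  have hE0 : 0 < E := by linarith
  set V : ℝ := E ^ 2 / δ with hVdef
  have hVE : E ^ 2 ≤ V := by
    rw [hVdef, le_div_iff₀ hδ]
    exact mul_le_of_le_one_right (by positivity) hδ1
  have hV2 : 2 ≤ V := by nlinarith
  have hC₁T : T ^ C₁ ≤ T ^ (C₁ + C₂) := pow_le_pow_of_two_le hT (by omega)
  have hC₂T : V ^ C₂ ≤ T ^ (C₁ + C₂) :=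
    (pow_le_pow_left₀ (by linarith) hV _).trans (pow_le_pow_of_two_le hT (by omega))
  have hεT : 1 / T ≤ δ / (3 * E) := by
    rw [div_le_div_iff₀ hT0 (by positivity)]
    rw [hVdef, div_le_iff₀ hδ] at hV
    nlinarith
  have hεT' : 1 / T ≤ δ := by
    refine hεT.trans (div_le_self hδ.le (by linarith))
  -- the first variable
  have h1 := hC₁ T hT M₁ (hC₁T.trans hM₁) M₂ (by linarith) q hq1 hqT α hα P₂ (fun _ => 1) #P₂ δ
    (fun x hx => by exact_mod_cast (hP₂ x hx).2.2) (by simp) le_rfl hεT' P₁ hP₁ (by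
      simp only [one_mul]
      calc δ * #P₂ * #P₁ = δ * (#P₁ * #P₂) := by ring
        _ ≤ _ := hS
        _ ≤ _ := norm_sum_le _ _
        _ = _ := by
          refine sum_congr rfl fun p _ => ?_
          congr 1
          refine sum_congr rfl fun r _ => ?_
          rw [mul_comm ((p : ℝ) ^ j)])
  obtain ⟨c, hc1, hc⟩ := exists_sum_norm_le_sum_norm j α P₂ (range (2 * M₁ + 1)) (fun _ => 1)
  rw [hc] at h1
  have hstep₁ : δ / E * #P₂ * M₁ ≤
      ∑ r ∈ P₂, ‖∑ n ∈ range (2 * M₁ + 1), c n * eC (α * ((n : ℝ) ^ j * (r : ℝ) ^ j))‖ := by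
    have h2 : ‖∑ x ∈ P₂, ∑ y ∈ range (2 * M₁ + 1),
        1 * c y * eC (α * ((x : ℝ) ^ j * (y : ℝ) ^ j))‖ ≤
        ∑ r ∈ P₂, ‖∑ n ∈ range (2 * M₁ + 1), c n * eC (α * ((n : ℝ) ^ j * (r : ℝ) ^ j))‖ := by
      refine (norm_sum_le _ _).trans (le_of_eq ?_)
      refine sum_congr rfl fun r _ => ?_
      congr 1
      refine sum_congr rfl fun n _ => ?_
      rw [one_mul, mul_comm ((r : ℝ) ^ j)]
    refine le_trans ?_ h2
    rw [div_mul_eq_mul_div, div_mul_eq_mul_div, div_le_iff₀ hE0]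
    calc δ * #P₂ * M₁ ≤ δ * #P₂ * (B * (#P₁ * Real.log M₁)) := by gcongr
      _ = B * (δ * #P₂ * #P₁ * Real.log M₁) := by ring
      _ ≤ B * (130 * (1 + Real.log q) * _) := by gcongr
      _ = _ := by rw [hE]; ring
  -- the second variable
  have h2 := hC₁ T hT M₂ (hC₁T.trans hM₂) M₁ (by linarith) q hq1 hqT α
    (by rw [mul_comm (M₂ : ℝ)]; exact hα) (range (2 * M₁ + 1)) c (3 * M₁) (δ / (3 * E))
    (fun x hx => by
      rw [mem_range] at hx
      have : x ≤ 2 * M₁ := by omega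
      exact_mod_cast this) hc1 (by rw [card_range]; push_cast; linarith) hεT P₂ hP₂ (by
      refine le_trans (le_of_eq ?_) hstep₁
      field_simp)
  obtain ⟨d, hd1, hd⟩ := exists_sum_norm_le_sum_norm j α (range (2 * M₁ + 1))
    (range (2 * M₂ + 1)) c
  rw [hd] at h2
  obtain ⟨q', hq'0, hq', hq'd⟩ := hC₂ V hV2 M₁ M₂ (hC₂T.trans hM₁) (hC₂T.trans hM₂) α
    (range (2 * M₁ + 1)) (range (2 * M₂ + 1)) c d
    (fun x hx => by
      rw [mem_range] at hx
      have : x ≤ 2 * M₁ := by omega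
      exact_mod_cast this)
    (fun x hx => by
      rw [mem_range] at hx
      have : x ≤ 2 * M₂ := by omega
      exact_mod_cast this) hc1 hd1 (by
      rw [hVdef, div_div_eq_mul_div, div_le_iff₀ (by positivity)]
      have e : δ / (3 * E) * (3 * M₁) * #P₂ * Real.log M₂ = δ * M₁ * (#P₂ * Real.log M₂) / E := by
        field_simp
      rw [e, div_le_iff₀ hE0] at h2
      calc (M₁ : ℝ) * M₂ * δ = δ * M₁ * M₂ := by ring
        _ ≤ δ * M₁ * (B * (#P₂ * Real.log M₂)) := by gcongr
        _ = B * (δ * M₁ * (#P₂ * Real.log M₂)) := by ring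
        _ ≤ B * (130 * (1 + Real.log q) * _ * E) := by gcongr
        _ = _ := by rw [hE]; ring)
  have hVV : V ^ C₂ ≤ V ^ (C₁ + C₂) := pow_le_pow_of_two_le hV2 (by omega)
  refine ⟨q', hq'0, hq'.trans hVV, hq'd.trans ?_⟩
  gcongr

lemma le_norm_sum_primeProducts_of_le_avg {k j : ℕ} (hj : 1 ≤ j) {P : Fin k → Finset ℕ} {δ θ : ℝ}
    (hδ : 0 < δ)
    (h : δ ≤ ‖avgC ((Fintype.piFinset P).image (fun g => ∏ i, (g i : ℤ) ^ j))
      (fun s => eC (θ * (s : ℝ)))‖) :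
    (primeProducts P univ).Nonempty ∧
      δ * #(primeProducts P univ) ≤ ‖∑ z ∈ primeProducts P univ, eC (θ * (z : ℝ) ^ j)‖ := by
  have himage : (Fintype.piFinset P).image (fun g => ∏ i, (g i : ℤ) ^ j) =
      (primeProducts P univ).image (fun z : ℕ => (z : ℤ) ^ j) := by
    ext s
    simp only [mem_image, Fintype.mem_piFinset, mem_primeProducts, mem_univ, forall_const]
    constructor
    · rintro ⟨g, hg, rfl⟩
      refine ⟨∏ i, g i, ⟨g, hg, rfl⟩, ?_⟩
      push_cast
      rw [prod_pow]
    · rintro ⟨_, ⟨g, hg, rfl⟩, rfl⟩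
      refine ⟨g, hg, ?_⟩
      push_cast
      rw [prod_pow]
  have hinj : Function.Injective (fun z : ℕ => (z : ℤ) ^ j) := by
    intro z z' hz
    simp only at hz
    have h1 : z ^ j = z' ^ j := by exact_mod_cast hz
    exact Nat.pow_left_injective (by omega) h1
  rw [himage, avgC, card_image_of_injective _ hinj, sum_image fun z _ z' _ hz => hinj hz,
    norm_div, Complex.norm_natCast] at h
  have hcard : (0 : ℝ) < #(primeProducts P univ) := by
    by_contra hcon
    have h0 : (#(primeProducts P univ) : ℝ) = 0 :=
      le_antisymm (not_lt.1 hcon) (Nat.cast_nonneg _)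
    rw [h0, div_zero] at h
    linarith
  refine ⟨card_pos.1 (by exact_mod_cast hcard), ?_⟩
  rw [le_div_iff₀ hcard] at h
  refine h.trans (le_of_eq ?_)
  congr 1
  refine sum_congr rfl fun z _ => ?_
  push_cast
  rfl

/-- Fixing all but two of the primes in an exponential sum over products of primes. -/
lemma exists_fixed_of_le_norm_sum_primeProducts {k j : ℕ} {P : Fin k → Finset ℕ} {δ θ : ℝ}
    (hP : ∀ i, ∀ p ∈ P i, p.Prime) (hd : ∀ i i', i ≠ i' → Disjoint (P i) (P i'))
    {a b : Fin k} (hab : a ≠ b) (hne : (primeProducts P univ).Nonempty)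
    (h : δ * #(primeProducts P univ) ≤ ‖∑ z ∈ primeProducts P univ, eC (θ * (z : ℝ) ^ j)‖) :
    ∃ w ∈ primeProducts P (univ.filter fun i => i ≠ a ∧ i ≠ b),
      δ * (#(P a) * #(P b)) ≤
        ‖∑ p ∈ P a, ∑ r ∈ P b, eC ((w : ℝ) ^ j * θ * ((p : ℝ) ^ j * (r : ℝ) ^ j))‖ := by
  set E : Finset (Fin k) := univ.filter fun i => i ≠ a ∧ i ≠ b with hE
  set E' : Finset (Fin k) := univ.filter fun i => i ≠ a with hE'
  have h1 : Disjoint ({a} : Finset (Fin k)) E' := by simp [hE']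
  have h2 : ∀ i, i ∈ (univ : Finset (Fin k)) ↔ i ∈ ({a} : Finset (Fin k)) ∨ i ∈ E' := by
    intro i
    simp [hE', em]
  have h3 : Disjoint ({b} : Finset (Fin k)) E := by simp [hE]
  have h4 : ∀ i, i ∈ E' ↔ i ∈ ({b} : Finset (Fin k)) ∨ i ∈ E := by
    intro i
    simp only [hE', hE, mem_filter, mem_univ, true_and, mem_singleton]
    constructor
    · intro hi
      by_cases hib : i = b
      · exact Or.inl hib
      · exact Or.inr ⟨hi, hib⟩
    · rintro (rfl | hi)
      · exact hab.symm
      · exact hi.1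
  have hcard : #(primeProducts P univ) = #(P a) * (#(P b) * #(primeProducts P E)) := by
    have e : ∀ s : Finset ℕ, #s = ∑ x ∈ s, 1 := fun s => by simp
    rw [e (primeProducts P univ), sum_primeProducts_union hP hd h1 h2, primeProducts_singleton]
    simp only [sum_primeProducts_union hP hd h3 h4, primeProducts_singleton, sum_const,
      smul_eq_mul, mul_one]
  have hsum : ∑ z ∈ primeProducts P univ, eC (θ * (z : ℝ) ^ j) = ∑ w ∈ primeProducts P E,
      ∑ p ∈ P a, ∑ r ∈ P b, eC ((w : ℝ) ^ j * θ * ((p : ℝ) ^ j * (r : ℝ) ^ j)) := by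
    rw [sum_primeProducts_union hP hd h1 h2, primeProducts_singleton]
    simp only [sum_primeProducts_union hP hd h3 h4, primeProducts_singleton]
    rw [sum_comm (s := primeProducts P E)]
    refine sum_congr rfl fun p _ => ?_
    rw [sum_comm]
    refine sum_congr rfl fun w _ => sum_congr rfl fun r _ => ?_
    congr 1
    push_cast
    ring
  have hneE : (primeProducts P E).Nonempty := by
    have := card_pos.2 hne
    rw [hcard] at this
    exact card_pos.1 (pos_of_mul_pos_right (pos_of_mul_pos_right this (Nat.zero_le _))
      (Nat.zero_le _))
  by_contra! hcon
  have hlt : ‖∑ z ∈ primeProducts P univ, eC (θ * (z : ℝ) ^ j)‖ <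
      δ * #(primeProducts P univ) := by
    rw [hsum, hcard]
    calc _ ≤ ∑ w ∈ primeProducts P E,
          ‖∑ p ∈ P a, ∑ r ∈ P b, eC ((w : ℝ) ^ j * θ * ((p : ℝ) ^ j * (r : ℝ) ^ j))‖ :=
          norm_sum_le _ _
      _ < ∑ w ∈ primeProducts P E, δ * (#(P a) * #(P b)) := sum_lt_sum_of_nonempty hneE hcon
      _ = _ := by
        rw [sum_const, nsmul_eq_mul]
        push_cast
        ring
  linarith

/-- Comparing a rational approximation to `θ` with one to `w ^ j * θ`. -/
lemma denom_le_of_denom_mul {j : ℕ} {T R N m D θ : ℝ} (hT : 0 < T) (hR : 0 < R) (hN : 0 < N)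
    (hm : 0 < m) (hD : D = N * m) {w q q' : ℕ} {a : ℤ} (hwm : m ≤ w) (hwm' : (w : ℝ) ≤ 2 * m)
    (hq : 1 ≤ q) (hqT : (q : ℝ) ≤ T) (ha : IsCoprime (q : ℤ) a) (hwq : w.Coprime q)
    (hθ : |q * θ - a| ≤ T / D ^ j) (hq' : 1 ≤ q') (hq'R : (q' : ℝ) ≤ R)
    (hd : dZ (q' * ((w : ℝ) ^ j * θ)) ≤ R / N ^ j) (hsize : T * R * (2 ^ j + 1) < N ^ j) :
    (q : ℝ) ≤ R ∧ |q * θ - a| ≤ R / D ^ j := by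
  obtain ⟨b, hb⟩ := exists_int_dZ (q' * ((w : ℝ) ^ j * θ))
  rw [hb] at hd
  have hw0 : (0 : ℝ) < w := by linarith
  have hq0 : (0 : ℝ) < q := by exact_mod_cast hq
  have hq'0 : (0 : ℝ) < q' := by exact_mod_cast hq'
  have hdiff : |(q' : ℝ) * (w : ℝ) ^ j * a - q * b| < 1 := by
    have e : (q' : ℝ) * (w : ℝ) ^ j * a - q * b =
        q * (q' * ((w : ℝ) ^ j * θ) - b) - q' * (w : ℝ) ^ j * (q * θ - a) := by ring
    rw [e]
    calc _ ≤ |q * (q' * ((w : ℝ) ^ j * θ) - b)| + |q' * (w : ℝ) ^ j * (q * θ - a)| := abs_sub _ _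
      _ = q * |q' * ((w : ℝ) ^ j * θ) - b| + q' * (w : ℝ) ^ j * |q * θ - a| := by
        rw [abs_mul, abs_mul, abs_of_pos hq0,
          abs_of_pos (by positivity : 0 < (q' : ℝ) * (w : ℝ) ^ j)]
      _ ≤ T * (R / N ^ j) + R * (2 * m) ^ j * (T / D ^ j) := by gcongr
      _ = T * R * (2 ^ j + 1) / N ^ j := by
        rw [hD, mul_pow, mul_pow]
        field_simp
        ring
      _ < 1 := by rwa [div_lt_one (by positivity)]
  have heq : (q' : ℤ) * (w : ℤ) ^ j * a = q * b := by
    have h1 : |(q' : ℤ) * (w : ℤ) ^ j * a - q * b| < 1 := by exact_mod_cast hdiff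
    have := Int.abs_lt_one_iff.1 h1
    linarith
  have hdvd : q ∣ q' := by
    have h1 : (q : ℤ) ∣ (q' : ℤ) * (w : ℤ) ^ j * a := ⟨b, heq⟩
    have h2 : (q : ℤ) ∣ (q' : ℤ) * (w : ℤ) ^ j := ha.dvd_of_dvd_mul_right h1
    have h3 : q ∣ q' * w ^ j := by exact_mod_cast h2
    exact (Nat.Coprime.pow_right j hwq.symm).dvd_of_dvd_mul_right h3
  have hle : q ≤ q' := Nat.le_of_dvd hq' hdvd
  have hle' : (q : ℝ) ≤ q' := by exact_mod_cast hle
  refine ⟨hle'.trans hq'R, ?_⟩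
  have heq' : (q' : ℝ) * (w : ℝ) ^ j * a = q * b := by exact_mod_cast heq
  have e : (q : ℝ) * θ - a = q / (q' * (w : ℝ) ^ j) * (q' * ((w : ℝ) ^ j * θ) - b) := by
    have : (b : ℝ) = q' * (w : ℝ) ^ j * a / q := by rw [heq']; field_simp
    rw [this]
    field_simp
  rw [e, abs_mul, abs_of_pos (by positivity)]
  calc (q : ℝ) / (q' * (w : ℝ) ^ j) * |q' * ((w : ℝ) ^ j * θ) - b|
      ≤ q' / (q' * m ^ j) * (R / N ^ j) := by gcongr
    _ = R / D ^ j := by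
      rw [hD, mul_pow]
      field_simp

lemma exists_coprime_of_dZ_le {q₀ : ℕ} (hq₀ : 0 < q₀) {θ ε : ℝ} (h : dZ (q₀ * θ) ≤ ε) :
    ∃ q : ℕ, ∃ a : ℤ, 1 ≤ q ∧ q ≤ q₀ ∧ IsCoprime (q : ℤ) a ∧ |q * θ - a| ≤ ε := by
  obtain ⟨a₀, ha₀⟩ := exists_int_dZ (q₀ * θ)
  rw [ha₀] at h
  set g := Int.gcd q₀ a₀ with hg
  have hg0 : 0 < g := Int.gcd_pos_of_ne_zero_left _ (by exact_mod_cast hq₀.ne')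
  have hgq : (g : ℤ) ∣ q₀ := Int.gcd_dvd_left _ _
  obtain ⟨q, hq⟩ : g ∣ q₀ := by exact_mod_cast hgq
  obtain ⟨a, ha⟩ : (g : ℤ) ∣ a₀ := Int.gcd_dvd_right _ _
  have hq0 : 0 < q := Nat.pos_of_mul_pos_left (hq ▸ hq₀)
  refine ⟨q, a, hq0, ?_, ?_, ?_⟩
  · rw [hq]
    exact Nat.le_mul_of_pos_left q hg0
  · rw [Int.isCoprime_iff_gcd_eq_one]
    have h1 : g = g * Int.gcd q a := by
      conv_lhs => rw [hg, hq, ha]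
      push_cast
      rw [Int.gcd_mul_left]
      simp
    exact Nat.eq_of_mul_eq_mul_left hg0 (by rw [mul_one]; exact h1.symm)
  · refine le_trans ?_ h
    have e : (q₀ : ℝ) * θ - a₀ = g * (q * θ - a) := by
      rw [hq, ha]
      push_cast
      ring
    rw [e, abs_mul]
    have : (1 : ℝ) ≤ |(g : ℝ)| := by
      rw [abs_of_nonneg (Nat.cast_nonneg _)]
      exact_mod_cast hg0
    exact le_mul_of_one_le_left (abs_nonneg _) this

lemma scale_bounds {k n : ℕ} (hk : 2 ≤ k) (hn : 2 ≤ n) {M : Fin k → ℕ} (hM : ∀ i, 2 ≤ M i) {Q : ℝ}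
    (hQ : Q = (k : ℝ) ^ k * ∏ i, Real.log (M i)) (h : ∀ i, Q ^ n < M i) :
    (k : ℝ) ^ k ≤ Q ∧ ∀ i, 1 ≤ Real.log (M i) ∧ k * Real.log (M i) ≤ Q := by
  have hk' : (2 : ℝ) ≤ k := by exact_mod_cast hk
  have hQ' : Q = ∏ i, (k * Real.log (M i)) := by
    rw [hQ, prod_mul_distrib, prod_const, card_univ, Fintype.card_fin]
  have hfac : ∀ i, (1.38 : ℝ) ≤ k * Real.log (M i) := fun i => by
    have h2 : Real.log 2 ≤ Real.log (M i) :=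
      Real.log_le_log (by norm_num) (by exact_mod_cast hM i)
    have := Real.log_two_gt_d9
    nlinarith
  have hQ1 : (1.9 : ℝ) ≤ Q := by
    calc (1.9 : ℝ) ≤ 1.38 ^ 2 := by norm_num
      _ ≤ 1.38 ^ k := pow_le_pow_right₀ (by norm_num) hk
      _ = ∏ _i : Fin k, (1.38 : ℝ) := by simp
      _ ≤ ∏ i, (k * Real.log (M i)) := prod_le_prod (fun _ _ => by norm_num) fun i _ => hfac i
      _ = Q := hQ'.symm
  have hlog : ∀ i, 1 ≤ Real.log (M i) := fun i => by
    have h1 : (3.6 : ℝ) ≤ M i := by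
      calc (3.6 : ℝ) ≤ 1.9 ^ 2 := by norm_num
        _ ≤ Q ^ 2 := by gcongr
        _ ≤ Q ^ n := pow_le_pow_right₀ (by linarith) hn
        _ ≤ M i := (h i).le
    rw [Real.le_log_iff_exp_le (by linarith)]
    linarith [Real.exp_one_lt_d9]
  refine ⟨?_, fun i => ⟨hlog i, ?_⟩⟩
  · rw [hQ]
    refine le_mul_of_one_le_right (by positivity) ?_
    calc (1 : ℝ) = ∏ _i : Fin k, (1 : ℝ) := by simp
      _ ≤ _ := prod_le_prod (fun _ _ => by norm_num) fun i _ => hlog i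
  · rw [hQ', ← mul_prod_erase univ _ (mem_univ i)]
    refine le_mul_of_one_le_right (by have := hlog i; positivity) ?_
    calc (1 : ℝ) = ∏ _i ∈ univ.erase i, (1 : ℝ) := by simp
      _ ≤ _ := prod_le_prod (fun _ _ => by norm_num) fun i _ => by linarith [hfac i]

lemma le_mul_card_of_scale {A : ℝ} (hA : 16 ≤ A)
    (hcard : ∀ M k : ℝ, A ≤ M → 1 ≤ k → A * k ≤ Real.log M → ∀ P : Finset ℕ,
      (∀ p : ℕ, p.Prime → M ≤ p → (p : ℝ) < M * (1 + 1 / (8 * k)) → p ∈ P) →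
        M / (A * k * Real.log M) ≤ #P)
    {k n M : ℕ} (hk : 2 ≤ k) (hn : 2 * A ≤ n) {Q : ℝ} (hQ : (k : ℝ) ^ k ≤ Q) (h : Q ^ n < M)
    (hlog : 1 ≤ Real.log M) {P : Finset ℕ}
    (hP : ∀ p : ℕ, p.Prime → M ≤ p → (p : ℝ) < M * (1 + 1 / (8 * k)) → p ∈ P) :
    (M : ℝ) ≤ A * k * (#P * Real.log M) := by
  have hk' : (2 : ℝ) ≤ k := by exact_mod_cast hk
  have hQ4 : 4 ≤ Q := by
    calc (4 : ℝ) = 2 ^ 2 := by norm_num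
      _ ≤ (k : ℝ) ^ 2 := by gcongr
      _ ≤ (k : ℝ) ^ k := pow_le_pow_right₀ (by linarith) hk
      _ ≤ Q := hQ
  have h1 : A ≤ M := by
    have := natCast_le_pow (T := Q) (by linarith) n
    linarith
  have h2 : A * k ≤ Real.log M := by
    have e : n * (k * Real.log k) ≤ Real.log M := by
      calc n * (k * Real.log k) = Real.log (((k : ℝ) ^ k) ^ n) := by
            rw [Real.log_pow, Real.log_pow]
        _ ≤ Real.log (Q ^ n) := by
            refine Real.log_le_log (by positivity) ?_
            gcongr
        _ ≤ Real.log M := Real.log_le_log (by positivity) h.le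
    have e2 : (1 / 2 : ℝ) ≤ Real.log k := by
      have := Real.log_le_log (by norm_num) hk'
      linarith [Real.log_two_gt_d9]
    calc A * k ≤ n * (1 / 2) * k := by gcongr; linarith
      _ = n * (k * (1 / 2)) := by ring
      _ ≤ n * (k * Real.log k) := by gcongr
      _ ≤ _ := e
  have h3 := hcard M k h1 (by linarith) h2 P fun p hp hM => hP p hp (by exact_mod_cast hM)
  rw [div_le_iff₀ (by positivity)] at h3
  linarith

lemma prod_le_pow_mul_card {A : ℝ} {k c : ℕ} (hA0 : 0 ≤ A) (hAc : A ≤ 2 ^ c) (hk : 2 ≤ k)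
    {M : Fin k → ℕ} {P : Fin k → Finset ℕ} {Q : ℝ}
    (hQ : Q = (k : ℝ) ^ k * ∏ i, Real.log (M i)) (hkQ : (k : ℝ) ^ k ≤ Q)
    (hM : ∀ i, (M i : ℝ) ≤ A * k * (#(P i) * Real.log (M i))) :
    ∏ i, (M i : ℝ) ≤ Q ^ (c + 1) * ∏ i, (#(P i) : ℝ) := by
  have hk' : (2 : ℝ) ≤ k := by exact_mod_cast hk
  have hQ0 : 0 ≤ Q := le_trans (by positivity) hkQ
  have hAk : A ^ k ≤ Q ^ c := by
    calc A ^ k ≤ (2 ^ c) ^ k := by gcongr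
      _ = (2 ^ k) ^ c := by rw [← pow_mul, ← pow_mul, mul_comm]
      _ ≤ Q ^ c := by
        gcongr
        refine le_trans ?_ hkQ
        gcongr
  calc ∏ i, (M i : ℝ) ≤ ∏ i, (A * k * (#(P i) * Real.log (M i))) :=
        prod_le_prod (fun _ _ => by positivity) fun i _ => hM i
    _ = A ^ k * (Q * ∏ i, (#(P i) : ℝ)) := by
        rw [hQ]
        simp only [prod_mul_distrib, prod_const, card_univ, Fintype.card_fin]
        ring
    _ ≤ Q ^ c * (Q * ∏ i, (#(P i) : ℝ)) := by gcongr
    _ = _ := by ring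

lemma div_pow_le_of_le_inv {Q δ k : ℝ} {c C n : ℕ} (hQ : 0 < Q) (hδ : 0 < δ) (hδ1 : δ ≤ 1)
    (hδQ : δ ≤ 1 / Q) (hk : 1 ≤ k) (hn : (c + 1) * C ≤ n) : (Q ^ c / δ) ^ C ≤ (k / δ) ^ n := by
  have hQδ : Q ≤ 1 / δ := (le_one_div hδ hQ).1 hδQ
  have hkδ : 1 / δ ≤ k / δ := by gcongr
  have h1 : 1 ≤ 1 / δ := one_le_one_div hδ hδ1
  calc (Q ^ c / δ) ^ C ≤ ((1 / δ) ^ c * (1 / δ)) ^ C := by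
        rw [div_eq_mul_one_div]
        gcongr
    _ = (1 / δ) ^ ((c + 1) * C) := by rw [← pow_succ, pow_mul]
    _ ≤ (1 / δ) ^ n := pow_le_pow_right₀ h1 hn
    _ ≤ (k / δ) ^ n := by gcongr

lemma exists_pow_le_of_le_log_pow (A : ℝ) (C : ℕ) : ∃ g : ℕ, ∀ k δ : ℝ, 1 ≤ k → 0 < δ →
    δ ≤ 1 / 2 → ∀ q : ℕ, 1 ≤ q →
    (q : ℝ) ≤ ((130 * (1 + Real.log q) * (A * k)) ^ 2 / δ) ^ C →
      ((130 * (1 + Real.log q) * (A * k)) ^ 2 / δ) ^ C ≤ (k / δ) ^ g := by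
  obtain ⟨B, hB1, hB⟩ := exists_one_add_log_pow_le (2 * C) (ε := 1 / 2) (by norm_num)
  set G : ℝ := ((130 * A) ^ 2) ^ C * B with hG
  have hG0 : 0 ≤ G := by positivity
  obtain ⟨m, hm⟩ := pow_unbounded_of_one_lt (G ^ 2) one_lt_two
  refine ⟨m + 4 * C, fun k δ hk hδ hδ2 q hq hqR => ?_⟩
  set x : ℝ := k / δ with hx
  have hx2 : 2 ≤ x := by
    rw [hx, le_div_iff₀ hδ]
    linarith
  have hq1 : (1 : ℝ) ≤ q := by exact_mod_cast hq
  have hkδ : k ^ 2 / δ ≤ x ^ 2 := by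
    rw [hx, div_pow]
    refine div_le_div_of_nonneg_left (by positivity) (by positivity) ?_
    nlinarith
  have hs2 : √q * √q = (q : ℝ) := Real.mul_self_sqrt (by positivity)
  have hs0 : 0 < √(q : ℝ) := Real.sqrt_pos.2 (by linarith)
  have hR : ((130 * (1 + Real.log q) * (A * k)) ^ 2 / δ) ^ C ≤ G * x ^ (2 * C) * √q := by
    calc ((130 * (1 + Real.log q) * (A * k)) ^ 2 / δ) ^ C
        = ((130 * A) ^ 2) ^ C * (1 + Real.log q) ^ (2 * C) * (k ^ 2 / δ) ^ C := by
          rw [pow_mul, ← mul_pow, ← mul_pow]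
          congr 1
          ring
      _ ≤ ((130 * A) ^ 2) ^ C * (B * √q) * (x ^ 2) ^ C := by
          have := hB q hq1
          rw [← Real.sqrt_eq_rpow] at this
          gcongr
      _ = _ := by rw [hG, pow_mul]; ring
  have hsG : √q ≤ G * x ^ (2 * C) := by
    refine le_of_mul_le_mul_right ?_ hs0
    rw [hs2]
    exact hqR.trans hR
  calc ((130 * (1 + Real.log q) * (A * k)) ^ 2 / δ) ^ C ≤ G * x ^ (2 * C) * √q := hR
    _ ≤ G * x ^ (2 * C) * (G * x ^ (2 * C)) := by gcongr
    _ = G ^ 2 * x ^ (4 * C) := by ring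
    _ ≤ x ^ m * x ^ (4 * C) := by
        gcongr
        exact hm.le.trans (by gcongr)
    _ = _ := (pow_add _ _ _).symm

lemma exists_log_sq_le_pow {A : ℝ} (hA : 0 ≤ A) (c : ℕ) : ∃ g : ℕ, ∀ Q k δ : ℝ, 2 ≤ Q → 0 ≤ k →
    k ≤ Q → 0 < δ → 1 / Q ≤ δ → ∀ q : ℕ, 1 ≤ q → (q : ℝ) ≤ Q ^ c →
      (130 * (1 + Real.log q) * (A * k)) ^ 2 / δ ≤ Q ^ g := by
  obtain ⟨m, hm⟩ := pow_unbounded_of_one_lt ((130 * (1 + c) * A) ^ 2) one_lt_two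
  refine ⟨m + 5, fun Q k δ hQ hk hkQ hδ hδQ q hq hqQ => ?_⟩
  have hQ0 : 0 < Q := by linarith
  have hq1 : (1 : ℝ) ≤ q := by exact_mod_cast hq
  have hlog0 : 0 ≤ Real.log q := Real.log_nonneg hq1
  have hlog : 1 + Real.log q ≤ (1 + c) * Q := by
    have h1 : Real.log q ≤ c * Real.log Q := by
      rw [← Real.log_pow]
      exact Real.log_le_log (by linarith) hqQ
    have h2 : Real.log Q ≤ Q := Real.log_le_self hQ0.le
    have h3 : (c : ℝ) * Real.log Q ≤ c * Q := by gcongr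
    linarith
  have hδ' : 1 / δ ≤ Q := (one_div_le hQ0 hδ).1 hδQ
  calc (130 * (1 + Real.log q) * (A * k)) ^ 2 / δ
      = (130 * (1 + Real.log q) * (A * k)) ^ 2 * (1 / δ) := div_eq_mul_one_div _ _
    _ ≤ (130 * ((1 + c) * Q) * (A * Q)) ^ 2 * Q := by gcongr
    _ = (130 * (1 + c) * A) ^ 2 * Q ^ 5 := by ring
    _ ≤ Q ^ m * Q ^ 5 := by
        gcongr
        exact hm.le.trans (by gcongr)
    _ = _ := (pow_add _ _ _).symm

lemma prod_eq_mul_mul_prod_filter {ι : Type*} [Fintype ι] [DecidableEq ι] {a b : ι}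
    (hab : a ≠ b) (f : ι → ℝ) :
    ∏ i, f i = f a * f b * ∏ i ∈ univ.filter (fun i => i ≠ a ∧ i ≠ b), f i := by
  have h : univ.filter (fun i => i ≠ a ∧ i ≠ b) = (univ.erase a).erase b := by
    ext i
    simp [and_comm]
  rw [h, mul_assoc, mul_prod_erase _ f (by simp [hab.symm]), mul_prod_erase _ f (mem_univ a)]

lemma coprime_of_mem_primeProducts_of_lt {ι : Type*} {P : ι → Finset ℕ} {A : Finset ι} {q w : ℕ}
    (hq : 1 ≤ q) (hP : ∀ i, ∀ p ∈ P i, p.Prime ∧ q < p) (hw : w ∈ primeProducts P A) :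
    w.Coprime q := by
  obtain ⟨g, hg, rfl⟩ := mem_primeProducts.1 hw
  refine Nat.Coprime.prod_left fun i hi => ?_
  obtain ⟨hp, hlt⟩ := hP i _ (hg i hi)
  exact hp.coprime_iff_not_dvd.2 (Nat.not_dvd_of_pos_of_lt hq hlt)

lemma exists_denom_of_primeProducts_of_large {A : ℝ} (hA : 1 ≤ A) (j : ℕ) (hj : 1 ≤ j) (c : ℕ) :
    ∃ n₀ : ℕ, ∀ n : ℕ, n₀ ≤ n → ∀ (k : ℕ) (M : Fin k → ℕ) (P : Fin k → Finset ℕ) (Q : ℝ), 2 ≤ k →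
      2 ≤ Q → k ≤ Q → (∀ i, Q ^ n < M i) → (∀ i, ∀ p ∈ P i, p.Prime) →
      (∀ i, ∀ p ∈ P i, M i ≤ p) → (∀ i, ∀ p ∈ P i, (p : ℝ) ≤ M i * (1 + 1 / (4 * k))) →
      (∀ i i', i ≠ i' → Disjoint (P i) (P i')) →
      (∀ i, (M i : ℝ) ≤ A * k * (#(P i) * Real.log (M i))) →
      ∀ δ θ : ℝ, 0 < δ → δ ≤ 1 / 2 → 1 / Q ≤ δ → (primeProducts P univ).Nonempty →
      δ * #(primeProducts P univ) ≤ ‖∑ z ∈ primeProducts P univ, eC (θ * (z : ℝ) ^ j)‖ →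
      (∃ q : ℕ, 0 < q ∧ (q : ℝ) ≤ Q ^ c ∧ dZ (q * θ) ≤ Q ^ c / (∏ i, (M i : ℝ)) ^ j) →
      ∃ q : ℕ, 0 < q ∧ (q : ℝ) ≤ (k / δ) ^ n ∧
        dZ (q * θ) ≤ (k / δ) ^ n / (∏ i, (M i : ℝ)) ^ j := by
  obtain ⟨C, hC⟩ := exists_denom_of_prime_pairs j hj
  obtain ⟨g, hg⟩ := exists_log_sq_le_pow (A := A) (by linarith) c
  obtain ⟨g', hg'⟩ := exists_pow_le_of_le_log_pow A C
  set e : ℕ := g + c + j + 1 with he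
  refine ⟨e * (C + j + 2) + g', fun n hn k M P Q hk hQ2 hkQ hM hP hPM hPM' hd hcard δ θ hδ hδ2 hδQ
    hne hS ⟨q₀, hq₀0, hq₀Q, hq₀d⟩ => ?_⟩
  obtain ⟨q, a, hq1, hqq₀, hcop, hqa⟩ := exists_coprime_of_dZ_le hq₀0 hq₀d
  have hk' : (2 : ℝ) ≤ k := by exact_mod_cast hk
  have hQ0 : 0 < Q := by linarith
  have hqQ : (q : ℝ) ≤ Q ^ c := le_trans (by exact_mod_cast hqq₀) hq₀Q
  have hn1 : e * (C + j + 2) ≤ n := by omega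
  have hece : e ≤ e * (C + j + 2) := Nat.le_mul_of_pos_right e (by omega)
  have hMpos : ∀ i, (0 : ℝ) < M i := fun i => lt_trans (by positivity) (hM i)
  let i₀ : Fin k := ⟨0, by omega⟩
  let i₁ : Fin k := ⟨1, by omega⟩
  have hi : i₀ ≠ i₁ := by simp [i₀, i₁]
  obtain ⟨w, hw, hwS⟩ := exists_fixed_of_le_norm_sum_primeProducts hP hd hi hne hS
  set m : ℝ := ∏ i ∈ univ.filter (fun i => i ≠ i₀ ∧ i ≠ i₁), (M i : ℝ) with hm
  set N : ℝ := (M i₀ : ℝ) * M i₁ with hN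
  set D : ℝ := ∏ i, (M i : ℝ) with hD
  have hDN : D = N * m := prod_eq_mul_mul_prod_filter hi _
  have hm0 : 0 < m := prod_pos fun i _ => hMpos i
  have hN0 : 0 < N := mul_pos (hMpos _) (hMpos _)
  obtain ⟨hmw, hwm⟩ := primeProducts_bounds hPM hPM' hw
  have hqlt : ∀ i, q < M i := fun i => by
    have : (q : ℝ) < M i := by
      refine lt_of_le_of_lt (hqQ.trans ?_) (hM i)
      exact pow_le_pow_of_two_le hQ2 (by omega)
    exact_mod_cast this
  have hwq : w.Coprime q := coprime_of_mem_primeProducts_of_lt hq1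
    (fun i p hp => ⟨hP i p hp, (hqlt i).trans_le (hPM i p hp)⟩) hw
  set T : ℝ := Q ^ e with hT
  have hT2 : 2 ≤ T := two_le_pow hQ2 (by omega)
  have hqT : (q : ℝ) ≤ T := hqQ.trans (pow_le_pow_of_two_le hQ2 (by omega))
  have h2j : (2 : ℝ) ^ j ≤ Q ^ j := by gcongr
  have hα : dZ (q * ((w : ℝ) ^ j * θ)) ≤ T / N ^ j := by
    have e1 : (q : ℝ) * ((w : ℝ) ^ j * θ) - ((w : ℤ) ^ j * a : ℤ) = (w : ℝ) ^ j * (q * θ - a) := by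
      push_cast
      ring
    calc dZ (q * ((w : ℝ) ^ j * θ)) ≤ |(w : ℝ) ^ j * (q * θ - a)| := by
          rw [← e1]
          exact dZ_le_abs_sub_int _ _
      _ = (w : ℝ) ^ j * |q * θ - a| := by rw [abs_mul, abs_of_nonneg (by positivity)]
      _ ≤ (2 * m) ^ j * (Q ^ c / D ^ j) := by gcongr
      _ = 2 ^ j * Q ^ c / N ^ j := by
          rw [hDN, mul_pow, mul_pow]
          field_simp
      _ ≤ T / N ^ j := by
          gcongr
          calc (2 : ℝ) ^ j * Q ^ c ≤ Q ^ j * Q ^ c := by gcongr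
            _ = Q ^ (j + c) := (pow_add _ _ _).symm
            _ ≤ T := pow_le_pow_of_two_le hQ2 (by omega)
  have hTM : ∀ i, T ^ (C + j + 2) < M i := fun i => by
    refine lt_of_le_of_lt ?_ (hM i)
    rw [hT, ← pow_mul]
    exact pow_le_pow_of_two_le hQ2 hn1
  have hTC : ∀ i, T ^ C ≤ M i := fun i =>
    (pow_le_pow_of_two_le hT2 (by omega)).trans (hTM i).le
  have hPle : ∀ i, ∀ p ∈ P i, p.Prime ∧ M i ≤ p ∧ p ≤ 2 * M i := fun i p hp => by
    refine ⟨hP i p hp, hPM i p hp, ?_⟩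
    have h1 : (p : ℝ) ≤ 2 * M i := by
      refine (hPM' i p hp).trans ?_
      rw [mul_comm (2 : ℝ)]
      gcongr
      have : 1 / (4 * (k : ℝ)) ≤ 1 := by
        rw [div_le_one (by positivity)]
        linarith
      linarith
    exact_mod_cast h1
  set V : ℝ := (130 * (1 + Real.log q) * (A * k)) ^ 2 / δ with hV
  have hVT : V ≤ T := (hg Q k δ hQ2 (by positivity) hkQ hδ hδQ q hq1 hqQ).trans
    (pow_le_pow_of_two_le hQ2 (by omega))
  have hV0 : 0 < V := by
    have : 0 ≤ Real.log q := Real.log_natCast_nonneg q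
    positivity
  obtain ⟨q', hq'0, hq'V, hq'd⟩ := hC T hT2 (M i₀) (M i₁) (hTC _) (hTC _) q hq1 hqT
    ((w : ℝ) ^ j * θ) hα (P i₀) (P i₁) (hPle _) (hPle _) (A * k) (by nlinarith) (hcard _) (hcard _)
    δ hδ (by linarith) hVT hwS
  have hsize : T * V ^ C * (2 ^ j + 1) < N ^ j := by
    have hM1 : ∀ i, (1 : ℝ) ≤ M i := fun i => (one_le_pow_of_two_le hT2 _).trans (hTC i)
    calc T * V ^ C * (2 ^ j + 1) ≤ T * T ^ C * T ^ (j + 1) := by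
          gcongr
          calc (2 : ℝ) ^ j + 1 ≤ 2 ^ j + 2 ^ j := by
                gcongr
                exact one_le_pow_of_two_le le_rfl j
            _ = 2 ^ (j + 1) := by ring
            _ ≤ T ^ (j + 1) := by gcongr
      _ = T ^ (C + j + 2) := by ring
      _ < M i₀ := hTM _
      _ ≤ N := le_mul_of_one_le_right (hMpos _).le (hM1 _)
      _ ≤ N ^ j := le_self_pow₀ (one_le_mul_of_one_le_of_one_le (hM1 _) (hM1 _)) (by omega)
  obtain ⟨hqR, hθR⟩ := denom_le_of_denom_mul (by linarith) (pow_pos hV0 C) hN0 hm0 hDN hmw hwm hq1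
    hqT hcop hwq (hqa.trans (by
      gcongr
      exact pow_le_pow_of_two_le hQ2 (by omega))) hq'0 hq'V hq'd hsize
  have hfin : V ^ C ≤ (k / δ) ^ n := by
    refine (hg' k δ (by linarith) hδ hδ2 q hq1 hqR).trans (pow_le_pow_of_two_le ?_ (by omega))
    rw [le_div_iff₀ hδ]
    linarith
  refine ⟨q, hq1, hqR.trans hfin, (dZ_le_abs_sub_int _ a).trans (hθR.trans ?_)⟩
  have hD0 : 0 < D := hDN ▸ mul_pos hN0 hm0
  gcongr

/-- Lemma 3.2 of the paper: diophantine properties of almost primes. -/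
theorem almost_primes_diophantine (j : ℕ) (hj : 1 ≤ j) :
    ∃ L : ℝ, 1 ≤ L ∧
      ∀ (k : ℕ) (M : Fin k → ℕ) (η : Fin k → ℝ) (δ : ℝ),
        2 ≤ k → 0 < δ → δ < 1 / 2 →
        (∀ i, 0 < M i) →
        (∀ i i', i ≠ i' →
          Disjoint (Set.Ico ((M i : ℝ)) ((1 + 1 / (4 * (k : ℝ))) * M i))
                   (Set.Ico ((M i' : ℝ)) ((1 + 1 / (4 * (k : ℝ))) * M i'))) →
        (∀ i, ((k : ℝ) ^ k * ∏ i', Real.log (M i')) ^ L < (M i : ℝ)) →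
        (∀ i, 1 / (8 * (k : ℝ)) ≤ η i ∧ η i ≤ 1 / (4 * (k : ℝ))) →
        IsDiophantine L (k : ℝ) ((∏ i, (M i : ℝ)) ^ (j : ℝ))
          ((Fintype.piFinset (fun i => primesNear (M i) (η i))).image
            (fun g => ∏ i, (g i : ℤ) ^ j)) := by
  obtain ⟨A, hA, hcard⟩ := exists_card_primes_ge
  obtain ⟨C, hC⟩ := exists_denom_of_primeProducts j hj
  obtain ⟨c, hc⟩ := pow_unbounded_of_one_lt A one_lt_two
  obtain ⟨n₀, hn₀⟩ := exists_denom_of_primeProducts_of_large (by linarith : 1 ≤ A) j hj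
    ((c + 2) * C)
  obtain ⟨n₁, hn₁⟩ := exists_nat_ge (2 * A)
  set n : ℕ := n₀ + n₁ + (c + 2) * C + 2 with hn
  refine ⟨n, by exact_mod_cast (by omega : 1 ≤ n), ?_⟩
  intro k M η _ hk _ _ hM0 hdisj hML hη δ θ hδ hδ2 havg
  simp only [Real.rpow_natCast] at hML ⊢
  set P : Fin k → Finset ℕ := fun i => primesNear (M i) (η i) with hPdef
  have hk' : (2 : ℝ) ≤ k := by exact_mod_cast hk
  obtain ⟨hne, hS⟩ := le_norm_sum_primeProducts_of_le_avg hj hδ havg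
  have hmem : ∀ i p, p ∈ P i ↔ (M i ≤ p ∧ p ≤ 2 * M i) ∧ p.Prime ∧ (p : ℝ) < M i * (1 + η i) :=
    fun i p => by simp [hPdef, primesNear]
  have hη1 : ∀ i, η i ≤ 1 / 8 := fun i => (hη i).2.trans (by
    rw [div_le_div_iff₀ (by positivity) (by norm_num)]
    linarith)
  have hP : ∀ i, ∀ p ∈ P i, p.Prime := fun i p hp => ((hmem i p).1 hp).2.1
  have hPM : ∀ i, ∀ p ∈ P i, M i ≤ p := fun i p hp => ((hmem i p).1 hp).1.1
  have hPlt : ∀ i, ∀ p ∈ P i, (p : ℝ) < M i * (1 + 1 / (4 * k)) := fun i p hp =>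
    ((hmem i p).1 hp).2.2.trans_le (by gcongr; exact (hη i).2)
  have hd : ∀ i i', i ≠ i' → Disjoint (P i) (P i') := fun i i' hii => by
    refine disjoint_left.2 fun p hp hp' => ?_
    have hIco : ∀ i, p ∈ P i → (p : ℝ) ∈ Set.Ico (M i : ℝ) ((1 + 1 / (4 * (k : ℝ))) * M i) :=
      fun i hp => ⟨by exact_mod_cast hPM i p hp, by rw [mul_comm]; exact hPlt i p hp⟩
    exact Set.disjoint_left.1 (hdisj i i' hii) (hIco i hp) (hIco i' hp')
  have hM2 : ∀ i, 2 ≤ M i := fun i => by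
    by_contra hlt
    have hM1 : M i = 1 := by have := hM0 i; omega
    obtain ⟨z, hz⟩ := hne
    obtain ⟨f, hf, -⟩ := mem_primeProducts.1 hz
    have hfi := ((hmem i _).1 (hf i (mem_univ i))).2
    have h2 : (2 : ℝ) ≤ f i := by exact_mod_cast hfi.1.two_le
    have h3 := hfi.2
    rw [hM1] at h3
    push_cast at h3
    linarith [hη1 i]
  set Q : ℝ := (k : ℝ) ^ k * ∏ i, Real.log (M i) with hQ
  obtain ⟨hkQ, hlogs⟩ := scale_bounds hk (by omega : 2 ≤ n) hM2 hQ hML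
  have hkk : (k : ℝ) ≤ (k : ℝ) ^ k := le_self_pow₀ (by linarith) (by omega)
  have hQ2 : 2 ≤ Q := by linarith
  have hQ0 : 0 < Q := by linarith
  have hMcard : ∀ i, (M i : ℝ) ≤ A * k * (#(P i) * Real.log (M i)) := fun i => by
    refine le_mul_card_of_scale hA hcard hk (n := n) ?_ hkQ (hML i) (hlogs i).1
      fun p hp hMp hpM => ?_
    · exact hn₁.trans (by exact_mod_cast (by omega : n₁ ≤ n))
    · have h1 : (p : ℝ) < M i * (1 + η i) := hpM.trans_le (by gcongr; exact (hη i).1)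
      refine (hmem i p).2 ⟨⟨hMp, ?_⟩, hp, h1⟩
      have h2 : (p : ℝ) ≤ 2 * M i := by
        have h3 : (M i : ℝ) * (1 + η i) ≤ M i * 2 := by
          gcongr
          linarith [hη1 i]
        linarith
      exact_mod_cast h2
  have hD := prod_le_pow_mul_card (by linarith) hc.le hk hQ hkQ hMcard
  set T : ℝ := Q ^ (c + 1) / δ with hT
  have hQc : Q ≤ Q ^ (c + 1) := le_self_pow₀ (by linarith) (by omega)
  have hQT : Q ≤ T := by
    rw [hT, le_div_iff₀ hδ]
    nlinarith
  have hT0 : 0 < T := by linarith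
  have hPIco : ∀ i, P i = {p ∈ Ico (M i) ⌈(M i : ℝ) * (1 + η i)⌉₊ | p.Prime} := fun i => by
    ext p
    rw [hmem, mem_filter, mem_Ico, Nat.lt_ceil]
    refine ⟨fun h => ⟨⟨h.1.1, h.2.2⟩, h.2.1⟩, fun h => ⟨⟨h.1.1, ?_⟩, h.2, h.1.2⟩⟩
    have h2 : (p : ℝ) ≤ 2 * M i := by
      have h3 : (M i : ℝ) * (1 + η i) ≤ M i * 2 := by
        gcongr
        linarith [hη1 i]
      linarith [h.1.2]
    exact_mod_cast h2
  have hceil : ∀ i, ⌈(M i : ℝ) * (1 + η i)⌉₊ ≤ 2 * M i := fun i => by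
    refine Nat.ceil_le.2 ?_
    push_cast
    rw [mul_comm (2 : ℝ)]
    gcongr
    linarith [hη1 i]
  have hq₀ := hC T (by linarith) k M _ P (fun i => hM0 i)
    (fun i => by
      refine le_trans ?_ ((hlogs i).2.trans hQT)
      exact le_mul_of_one_le_left (by linarith [(hlogs i).1]) (by linarith))
    hPIco hceil (fun i p hp => (hPlt i p hp).le) hd θ (by
      refine le_trans ?_ hS
      rw [card_primeProducts hP hd, hT, div_div_eq_mul_div, div_le_iff₀ (by positivity)]
      push_cast
      calc (∏ i, (M i : ℝ)) * δ ≤ Q ^ (c + 1) * (∏ i, (#(P i) : ℝ)) * δ := by gcongr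
        _ = _ := by ring)
  have hD0 : 0 < ∏ i, (M i : ℝ) := prod_pos fun i _ => by exact_mod_cast hM0 i
  rcases le_total δ (1 / Q) with hcase | hcase
  · obtain ⟨q, hq0, hqT, hqd⟩ := hq₀
    have hTn : T ^ C ≤ (k / δ) ^ n :=
      div_pow_le_of_le_inv hQ0 hδ (by linarith) hcase (by linarith)
        (show (c + 2) * C ≤ n by omega)
    exact ⟨q, hq0, hqT.trans hTn, hqd.trans (by gcongr)⟩
  · refine hn₀ n (by omega) k M P Q hk hQ2 (hkk.trans hkQ) hML hP hPM
      (fun i p hp => (hPlt i p hp).le) hd hMcard δ θ hδ hδ2.le hcase hne hS ?_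
    obtain ⟨q, hq0, hqT, hqd⟩ := hq₀
    have hTn : T ^ C ≤ Q ^ ((c + 2) * C) := by
      rw [pow_mul]
      gcongr
      rw [hT, div_le_iff₀ hδ, pow_succ Q (c + 1), mul_assoc]
      refine le_mul_of_one_le_right (by positivity) ?_
      rw [div_le_iff₀ hQ0] at hcase
      linarith
    exact ⟨q, hq0, hqT.trans hTn, hqd.trans (by gcongr)⟩
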